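/- arXiv:1208.4714 — 3 statements merged into one kernel-verified Lean document; each statement's English description precedes it below -/
import Mathlib

section
/- Let t > 0 be a real number and let 𝓛 be a finite t-parallel set of lines in ℝ² such that not all the lines of 𝓛 are parallel to each other. Then there is a line ℓ ∈ 𝓛 containing at least t/2 ordinary points of 𝓛. -/
/-- A line in the Euclidean plane `ℝ × ℝ`: a one-dimensional affine subspace. -/
def IsLine (L : AffineSubspace ℝ (ℝ × ℝ)) : Prop :=
  (L : Set (ℝ × ℝ)).Nonempty ∧ Module.finrank ℝ L.direction = 1

/-- A point is an ordinary point of a set of lines `𝓛` if it lies on exactly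
two of the lines of `𝓛`. -/
def IsOrdinaryPoint (𝓛 : Set (AffineSubspace ℝ (ℝ × ℝ))) (p : ℝ × ℝ) : Prop :=
  {L ∈ 𝓛 | p ∈ L}.ncard = 2

namespace Betts
noncomputable def X (c l : ℝ × ℝ) : ℝ := (c.2 - l.2) * (l.1 - c.1)⁻¹
def IsEnd (S : Finset (ℝ × ℝ)) (e : ℝ) (c l : ℝ × ℝ) : Prop :=
  l ∈ S ∧ l.1 ≠ c.1 ∧ ∀ l' ∈ S, l'.1 ≠ c.1 → e * X c l ≤ e * X c l'
def Only (S : Finset (ℝ × ℝ)) (e q : ℝ) (c : ℝ × ℝ) : Prop :=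
  ∃ l, IsEnd S e c l ∧ l.1 = q ∧ ∀ l', IsEnd S e c l' → l'.1 = q
def Many (S : Finset (ℝ × ℝ)) (t : ℝ) : Prop :=
  ∃ l ∈ S, ∃ T ⊆ S, ∃ m, t / 2 ≤ (T.card : ℝ) ∧ ∀ c ∈ T, c.1 = m ∧ l.1 ≠ m ∧
    ∀ l' ∈ S, l'.1 ≠ m → X c l' = X c l → l' = l

def Inv (S : Finset (ℝ × ℝ)) (m n : ℝ) : Prop :=
  n < m ∧ (∀ l ∈ S, ¬ (n < l.1 ∧ l.1 < m)) ∧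
  ∀ c ∈ S, c.1 = m → ∀ e : ℝ, (e = 1 ∨ e = -1) →
    (∃ l, IsEnd S e c l ∧ m < l.1) ∨ Only S e n c

lemma X_shift (c c' l : ℝ × ℝ) (h : c'.1 = c.1) :
    X c' l = X c l + (c'.2 - c.2) * (l.1 - c.1)⁻¹ := by
  unfold X; rw [h]; ring

lemma X_inj {c l l' : ℝ × ℝ} (h : l.1 = l'.1) (hc : l.1 ≠ c.1) (hX : X c l = X c l') : l = l' := by
  unfold X at hX
  rw [← h] at hX
  have : (l.1 - c.1)⁻¹ ≠ 0 := inv_ne_zero (sub_ne_zero.2 hc)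
  have := mul_right_cancel₀ this hX
  exact Prod.ext h (by linarith)

lemma exists_end (S : Finset (ℝ × ℝ)) (e : ℝ) (c : ℝ × ℝ) (h : ∃ l ∈ S, l.1 ≠ c.1) :
    ∃ l, IsEnd S e c l := by
  obtain ⟨l, hl, hlc⟩ := h
  obtain ⟨a, ha, hmin⟩ := Finset.exists_min_image (S.filter (fun l => l.1 ≠ c.1))
    (fun l => e * X c l) ⟨l, by simp [hl, hlc]⟩
  simp only [Finset.mem_filter] at ha hmin
  exact ⟨a, ha.1, ha.2, fun l' h1 h2 => hmin l' ⟨h1, h2⟩⟩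

lemma only_shift {S : Finset (ℝ × ℝ)} {e : ℝ} {c c' l : ℝ × ℝ}
    (hcc : c'.1 = c.1) (hl : IsEnd S e c l)
    (hr : ∀ l' ∈ S, l'.1 ≠ c.1 → l'.1 ≠ l.1 →
      e * (c'.2 - c.2) * (l.1 - c.1)⁻¹ < e * (c'.2 - c.2) * (l'.1 - c.1)⁻¹) :
    Only S e l.1 c' := by
  obtain ⟨h1, h2, h3⟩ := hl
  refine ⟨l, ⟨h1, by rwa [hcc], ?_⟩, rfl, ?_⟩
  · intro l' h4 h5
    rw [hcc] at h5
    have h6 := h3 l' h4 h5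
    rw [X_shift c c' l hcc, X_shift c c' l' hcc]
    by_cases h7 : l'.1 = l.1
    · rw [h7]; linarith
    · have := hr l' h4 h5 h7; linarith
  · rintro l' ⟨h4, h5, h6⟩
    rw [hcc] at h5
    by_contra h7
    have h8 := h6 l h1 (by rwa [hcc])
    have := hr l' h4 h5 h7
    have := h3 l' h4 h5
    rw [X_shift c c' l hcc, X_shift c c' l' hcc] at h8
    linarith

lemma card_only {S : Finset (ℝ × ℝ)} {t : ℝ} (ht : 0 < t) (hM : ¬ Many S t) {e : ℝ}
    (he : e = 1 ∨ e = -1) (m q : ℝ) (A : Finset (ℝ × ℝ)) (hA : A ⊆ S)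
    (hm : ∀ c ∈ A, c.1 = m ∧ Only S e q c) : (A.card : ℝ) < t / 2 := by
  by_contra hcon
  push Not at hcon
  apply hM
  rcases A.eq_empty_or_nonempty with rfl | ⟨c0, hc0⟩
  · simp at hcon; linarith
  have he0 : e ≠ 0 := by rcases he with rfl | rfl <;> norm_num
  obtain ⟨h0m, l, hl, hlq, -⟩ := hm c0 hc0
  refine ⟨l, hl.1, A, hA, m, hcon, ?_⟩
  intro c hc
  obtain ⟨hcm, k, hk, hkq, hko⟩ := hm c hc
  have hkl : k = l := by
    have h1 := hl.2.2 k hk.1 (by rw [h0m, ← hcm]; exact hk.2.1)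
    have h2 := hk.2.2 l hl.1 (by rw [hcm, ← h0m]; exact hl.2.1)
    rw [X_shift c0 c l (by rw [hcm, h0m]), X_shift c0 c k (by rw [hcm, h0m])] at h2
    rw [hkq, hlq] at h2
    have h3 : e * X c0 k = e * X c0 l := by linarith
    exact X_inj (c := c0) (by rw [hkq, hlq]) (by rw [h0m, ← hcm]; exact hk.2.1)
      (mul_left_cancel₀ he0 h3)
  subst hkl
  refine ⟨hcm, by rw [← hcm]; exact hk.2.1, ?_⟩
  intro l' h1 h2 h3
  have h4 : IsEnd S e c l' := ⟨h1, by rwa [hcm], by rw [h3]; exact hk.2.2⟩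
  exact X_inj (by rw [hko l' h4, hkq]) (by rwa [hcm]) h3
lemma rate_p {m p s : ℝ} (hp : m < p) (hs : s ≠ m) (hsp : s ≠ p) (hn : ¬ (m < s ∧ s < p)) :
    (s - m)⁻¹ < (p - m)⁻¹ := by
  rcases lt_or_gt_of_ne hs with h | h
  · have : (s - m)⁻¹ < 0 := inv_lt_zero.2 (by linarith)
    have : 0 < (p - m)⁻¹ := inv_pos.2 (by linarith)
    linarith
  · have : p < s := lt_of_le_of_ne (by by_contra h'; exact hn ⟨h, by linarith⟩) (Ne.symm hsp)
    exact inv_strictAnti₀ (by linarith) (by linarith)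

lemma rate_n {m n s : ℝ} (hn : n < m) (hs : s ≠ m) (hsn : s ≠ n) (hg : ¬ (n < s ∧ s < m)) :
    (n - m)⁻¹ < (s - m)⁻¹ := by
  have := rate_p (m := -m) (p := -n) (s := -s) (by linarith) (by simpa using hs)
    (by simpa using hsn) (by rintro ⟨h1, h2⟩; exact hg ⟨by linarith, by linarith⟩)
  rw [show -s - -m = -(s - m) by ring, show -n - -m = -(n-m) by ring, inv_neg, inv_neg] at this
  linarith

lemma only_p {S : Finset (ℝ × ℝ)} {e m p : ℝ} (hp : m < p)
    (hg : ∀ l ∈ S, ¬ (m < l.1 ∧ l.1 < p)) {c c' l : ℝ × ℝ} (hc : c.1 = m) (hc' : c'.1 = m)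
    (hl : IsEnd S e c l) (hlp : l.1 = p) (h : e * (c'.2 - c.2) < 0) : Only S e p c' := by
  rw [← hlp]
  refine only_shift (by rw [hc, hc']) hl ?_
  intro l' h1 h2 h3
  rw [hc] at h2 ⊢; rw [hlp] at h3 ⊢
  exact mul_lt_mul_of_neg_left (rate_p hp h2 h3 (hg l' h1)) h

lemma only_n {S : Finset (ℝ × ℝ)} {e m n : ℝ} (hn : n < m)
    (hg : ∀ l ∈ S, ¬ (n < l.1 ∧ l.1 < m)) {c c' l : ℝ × ℝ} (hc : c.1 = m) (hc' : c'.1 = m)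
    (hl : IsEnd S e c l) (hlp : l.1 = n) (h : 0 < e * (c'.2 - c.2)) : Only S e n c' := by
  rw [← hlp]
  refine only_shift (by rw [hc, hc']) hl ?_
  intro l' h1 h2 h3
  rw [hc] at h2 ⊢; rw [hlp] at h3 ⊢
  exact mul_lt_mul_of_pos_left (rate_n hn h2 h3 (hg l' h1)) h
lemma mixed {S : Finset (ℝ × ℝ)} {e m n p : ℝ} (he : e = 1 ∨ e = -1) (hI : Inv S m n) (hp : m < p)
    (hg : ∀ l ∈ S, ¬ (m < l.1 ∧ l.1 < p)) {c c' : ℝ × ℝ} (hc : c.1 = m) (hcS : c ∈ S)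
    (hc' : c'.1 = m) (hcS' : c' ∈ S) (hne : c' ≠ c)
    (hno : ∀ l, IsEnd S e c l → ¬ p < l.1) (hN : ¬ Only S e n c) (hP : ¬ Only S e p c) :
    Only S e n c' ∨ Only S e p c' := by
  have hb : e * (c'.2 - c.2) ≠ 0 := by
    intro h0
    apply hne
    refine Prod.ext (by rw [hc, hc']) ?_
    rcases he with rfl | rfl <;> linarith
  obtain ⟨l, hl, hml⟩ := (hI.2.2 c hcS hc e he).resolve_right hN
  have hlp : l.1 = p := by
    by_contra h
    rcases lt_or_gt_of_ne h with h | h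
    · exact hg l hl.1 ⟨hml, h⟩
    · exact hno l hl h
  rcases lt_or_gt_of_ne hb with h | h
  · exact Or.inr (only_p hp hg hc hc' hl hlp h)
  · left
    have : ∃ d, IsEnd S e c d ∧ d.1 ≠ p := by
      by_contra h'; push Not at h'
      exact hP ⟨l, hl, hlp, h'⟩
    obtain ⟨d, hd, hdp⟩ := this
    have hdm : d.1 < m := by
      have h1 := hd.2.1
      rw [hc] at h1
      refine lt_of_le_of_ne ?_ h1
      by_contra h2
      rcases lt_or_gt_of_ne hdp with h3 | h3
      · exact hg d hd.1 ⟨by linarith, h3⟩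
      · exact hno d hd h3
    refine (hI.2.2 c' hcS' hc' e he).resolve_left ?_
    rintro ⟨k, hk, hmk⟩
    have h1 := hk.2.2 d hd.1 (by rw [hc']; exact hdm.ne)
    rw [X_shift c c' k (by rw [hc, hc']), X_shift c c' d (by rw [hc, hc'])] at h1
    have h2 := hd.2.2 k hk.1 (by rw [hc]; exact hmk.ne')
    have h3 : (d.1 - c.1)⁻¹ < 0 := inv_lt_zero.2 (by linarith)
    have h4 : 0 < (k.1 - c.1)⁻¹ := inv_pos.2 (by linarith)
    have h5 := mul_neg_of_pos_of_neg h h3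
    have h6 := mul_pos h h4
    linarith

open Classical in
lemma card_union {S : Finset (ℝ × ℝ)} {m : ℝ} {s : ℝ} {P Q : ℝ × ℝ → Prop} (x : ℝ)
    (hs : s ≠ 0)
    (hP : ∀ c ∈ S, ∀ c' ∈ S, c.1 = m → c'.1 = m → P c → 0 < s * (c'.2 - c.2) → P c')
    (hQ : ∀ c ∈ S, ∀ c' ∈ S, c.1 = m → c'.1 = m → Q c → 0 < s * (c'.2 - c.2) → Q c')
    (h1 : ((S.filter (fun c => c.1 = m ∧ P c)).card : ℝ) < x)
    (h2 : ((S.filter (fun c => c.1 = m ∧ Q c)).card : ℝ) < x) :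
    ((S.filter (fun c => c.1 = m ∧ (P c ∨ Q c))).card : ℝ) < x := by
  by_cases h : ∀ c ∈ S, c.1 = m → P c → Q c
  · refine lt_of_le_of_lt (Nat.cast_le.2 (Finset.card_le_card ?_)) h2
    intro c
    simp only [Finset.mem_filter]
    rintro ⟨a, b, d | d⟩
    exacts [⟨a, b, h c a b d⟩, ⟨a, b, d⟩]
  · push Not at h
    obtain ⟨c, hc, hcm, hPc, hQc⟩ := h
    refine lt_of_le_of_lt (Nat.cast_le.2 (Finset.card_le_card ?_)) h1
    intro c'
    simp only [Finset.mem_filter]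
    · rintro ⟨a, b, d | d⟩
      · exact ⟨a, b, d⟩
      · refine ⟨a, b, ?_⟩
        rcases lt_trichotomy 0 (s * (c'.2 - c.2)) with h | h | h
        · exact hP c hc c' a hcm b hPc h
        · have : c' = c := Prod.ext (by rw [b, hcm]) (by
            have := (mul_eq_zero.1 h.symm).resolve_left hs
            linarith)
          rwa [this]
        · exact absurd (hQ c' a c hc b hcm d (by linarith)) hQc

open Classical in
lemma count {S : Finset (ℝ × ℝ)} {t : ℝ} (ht : 0 < t) (hM : ¬ Many S t) {m n p : ℝ}
    (hI : Inv S m n) (hp : m < p) (hg : ∀ l ∈ S, ¬ (m < l.1 ∧ l.1 < p))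
    (hk : t + 1 ≤ ((S.filter (fun c => c.1 = m)).card : ℝ)) :
    ∃ c ∈ S, c.1 = m ∧ ∀ e : ℝ, (e = 1 ∨ e = -1) → ∃ l, IsEnd S e c l ∧ p < l.1 := by
  by_contra hcon
  push Not at hcon
  have hcard : ∀ e : ℝ, (e = 1 ∨ e = -1) → ∀ q,
      ((S.filter (fun c => c.1 = m ∧ Only S e q c)).card : ℝ) < t / 2 := by
    intro e he q
    refine card_only ht hM he m q _ (Finset.filter_subset _ _) ?_
    intro c hc
    exact (Finset.mem_filter.1 hc).2
  have hon : ∀ e : ℝ, (e = 1 ∨ e = -1) → ∀ c ∈ S, ∀ c' ∈ S, c.1 = m → c'.1 = m →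
      Only S e n c → 0 < e * (c'.2 - c.2) → Only S e n c' := by
    rintro e he c - c' - h1 h2 ⟨l, hl, hln, -⟩ h
    exact only_n hI.1 hI.2.1 h1 h2 hl hln h
  have hop : ∀ e : ℝ, (e = 1 ∨ e = -1) → ∀ c ∈ S, ∀ c' ∈ S, c.1 = m → c'.1 = m →
      Only S e p c → e * (c'.2 - c.2) < 0 → Only S e p c' := by
    rintro e he c - c' - h1 h2 ⟨l, hl, hln, -⟩ h
    exact only_p hp hg h1 h2 hl hln h
  have o1 : (1:ℝ) = 1 ∨ (1:ℝ) = -1 := Or.inl rfl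
  have o2 : (-1:ℝ) = 1 ∨ (-1:ℝ) = -1 := Or.inr rfl
  have hU := card_union (S := S) (m := m) (s := 1) (t/2) one_ne_zero (hon 1 o1)
    (fun c hc c' hc' h1 h2 h3 h4 => hop (-1) o2 c hc c' hc' h1 h2 h3 (by linarith))
    (hcard 1 o1 n) (hcard (-1) o2 p)
  have hL := card_union (S := S) (m := m) (s := -1) (t/2) (by norm_num) (hon (-1) o2)
    (fun c hc c' hc' h1 h2 h3 h4 => hop 1 o1 c hc c' hc' h1 h2 h3 (by linarith))
    (hcard (-1) o2 n) (hcard 1 o1 p)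
  set C := S.filter (fun c => c.1 = m) with hC
  set U := S.filter (fun c => c.1 = m ∧ (Only S 1 n c ∨ Only S (-1) p c)) with hUd
  set V := S.filter (fun c => c.1 = m ∧ (Only S (-1) n c ∨ Only S 1 p c)) with hVd
  have h2 : 1 < (C \ (U ∪ V)).card := by
    have a1 := Finset.card_union_le U V
    have a2 := Finset.le_card_sdiff (U ∪ V) C
    have a3 : ((U ∪ V).card : ℝ) ≤ U.card + V.card := by exact_mod_cast a1
    have a4 : (C.card : ℝ) ≤ (C \ (U ∪ V)).card + (U ∪ V).card := by
      have : C.card ≤ (C \ (U ∪ V)).card + (U ∪ V).card := by omega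
      exact_mod_cast this
    have : (1:ℝ) < (C \ (U ∪ V)).card := by linarith
    exact_mod_cast this
  obtain ⟨c, hc, c', hc', hne⟩ := Finset.one_lt_card.1 h2
  have key : ∀ c ∈ C \ (U ∪ V), (c ∈ S ∧ c.1 = m) ∧
      ∀ e : ℝ, (e = 1 ∨ e = -1) → ¬ Only S e n c ∧ ¬ Only S e p c := by
    intro c hc
    obtain ⟨h3, h4⟩ := Finset.mem_sdiff.1 hc
    have h5 := Finset.mem_filter.1 h3
    refine ⟨h5, ?_⟩
    have h6 : c ∉ U := fun h => h4 (Finset.mem_union_left _ h)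
    have h7 : c ∉ V := fun h => h4 (Finset.mem_union_right _ h)
    rintro e (rfl | rfl)
    · exact ⟨fun h => h6 (Finset.mem_filter.2 ⟨h5.1, h5.2, Or.inl h⟩),
        fun h => h7 (Finset.mem_filter.2 ⟨h5.1, h5.2, Or.inr h⟩)⟩
    · exact ⟨fun h => h7 (Finset.mem_filter.2 ⟨h5.1, h5.2, Or.inl h⟩),
        fun h => h6 (Finset.mem_filter.2 ⟨h5.1, h5.2, Or.inr h⟩)⟩
  obtain ⟨⟨hcS, hcm⟩, hcU⟩ := key c hc
  obtain ⟨⟨hcS', hcm'⟩, hcU'⟩ := key c' hc'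
  obtain ⟨e, he, hno⟩ := hcon c hcS hcm
  have hno' : ∀ l, IsEnd S e c l → ¬ p < l.1 := fun l hl => not_lt.2 (hno l hl)
  rcases mixed he hI hp hg hcm hcS hcm' hcS' hne.symm hno' (hcU e he).1 (hcU e he).2 with h | h
  · exact (hcU' e he).1 h
  · exact (hcU' e he).2 h

lemma step {S : Finset (ℝ × ℝ)} {m p : ℝ} (hp : m < p) (hg : ∀ l ∈ S, ¬ (m < l.1 ∧ l.1 < p))
    {c : ℝ × ℝ} (hcS : c ∈ S) (hcm : c.1 = m)
    (hc : ∀ e : ℝ, (e = 1 ∨ e = -1) → ∃ l, IsEnd S e c l ∧ p < l.1) : Inv S p m := by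
  refine ⟨hp, hg, ?_⟩
  intro q hq hqp e he
  by_contra hcon
  push Not at hcon
  obtain ⟨h1, h2⟩ := hcon
  obtain ⟨d, hd⟩ := exists_end S e q ⟨c, hcS, by rw [hcm, hqp]; exact hp.ne⟩
  have : ∃ d, IsEnd S e q d ∧ d.1 ≠ m := by
    by_contra h; push Not at h
    exact h2 ⟨d, hd, h d hd, h⟩
  clear! d
  obtain ⟨d, hd, hdm⟩ := this
  have hdp : d.1 < p := lt_of_le_of_ne (h1 d hd) (by rw [← hqp]; exact hd.2.1)
  have hdm' : d.1 < m := by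
    refine lt_of_le_of_ne ?_ hdm
    by_contra h; exact hg d hd.1 ⟨by linarith, hdp⟩
  obtain ⟨r, hr, hrp⟩ := hc e he
  refine absurd (h1 r ⟨hr.1, by rw [hqp]; exact hrp.ne', ?_⟩) (not_le.2 hrp)
  intro l' h3 h4
  refine le_trans ?_ (hd.2.2 l' h3 h4)
  have e1 := hr.2.2 q hq (by rw [hqp, hcm]; exact hp.ne')
  have e2 := hr.2.2 d hd.1 (by rw [hcm]; exact hdm)
  have f1 : X c r * (r.1 - m) = c.2 - r.2 := by
    unfold X; rw [hcm, inv_mul_cancel_right₀]; linarith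
  have f2 : X c q * (p - m) = c.2 - q.2 := by
    unfold X; rw [hcm, hqp, inv_mul_cancel_right₀]; linarith
  have f3 : X c d * (d.1 - m) = c.2 - d.2 := by
    unfold X; rw [hcm, inv_mul_cancel_right₀]; exact sub_ne_zero.2 hdm
  have f4 : X q r * (r.1 - p) = q.2 - r.2 := by
    unfold X; rw [hqp, inv_mul_cancel_right₀]; linarith
  have f5 : X q d * (d.1 - p) = q.2 - d.2 := by
    unfold X; rw [hqp, inv_mul_cancel_right₀]; linarith
  have g1 : e * X q r ≤ e * X c r := by
    have : (e * X c r - e * X q r) * (r.1 - p) = (e * X c q - e * X c r) * (p - m) := by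
      linear_combination e * f1 - e * f4 - e * f2
    have h0 : 0 ≤ (e * X c q - e * X c r) * (p - m) := mul_nonneg (by linarith) (by linarith)
    rw [← this] at h0
    have := nonneg_of_mul_nonneg_left h0 (by linarith)
    linarith
  have g2 : e * X c r ≤ e * X q d := by
    have : (e * X q d - e * X c r) * (p - d.1) =
        (e * X c q - e * X c r) * (p - m) + (e * X c d - e * X c r) * (m - d.1) := by
      linear_combination -e * f5 - e * f2 + e * f3
    have h0 : 0 ≤ (e * X c q - e * X c r) * (p - m) + (e * X c d - e * X c r) * (m - d.1) :=
      add_nonneg (mul_nonneg (by linarith) (by linarith)) (mul_nonneg (by linarith) (by linarith))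
    rw [← this] at h0
    have := nonneg_of_mul_nonneg_left h0 (by linarith)
    linarith
  linarith

open Classical in
lemma main {S : Finset (ℝ × ℝ)} {t : ℝ} (ht : 0 < t)
    (hk : ∀ l ∈ S, t + 1 ≤ ((S.filter (fun c => c.1 = l.1)).card : ℝ))
    (hne : ∃ l ∈ S, ∃ l' ∈ S, l.1 ≠ l'.1) : Many S t := by
  by_contra hM
  obtain ⟨u, hu, v, hv, huv⟩ := hne
  let G := S.filter (fun l => (∃ k ∈ S, l.1 < k.1) ∧ ∃ n, Inv S l.1 n)
  have hG : G.Nonempty := by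
    obtain ⟨a, ha, hmin⟩ := Finset.exists_min_image S (fun l => l.1) ⟨u, hu⟩
    have hex : ∃ k ∈ S, a.1 < k.1 := by
      by_contra h; push Not at h
      exact huv (by linarith [h u hu, h v hv, hmin u hu, hmin v hv])
    refine ⟨a, Finset.mem_filter.2 ⟨ha, hex, a.1 - 1, by linarith, ?_, ?_⟩⟩
    · intro l hl h; linarith [hmin l hl]
    · intro c hc hca e he
      left
      obtain ⟨k, hk1, hk2⟩ := hex
      obtain ⟨l, hl⟩ := exists_end S e c ⟨k, hk1, by rw [hca]; exact hk2.ne'⟩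
      exact ⟨l, hl, lt_of_le_of_ne (hmin l hl.1) (by rw [← hca]; exact hl.2.1.symm)⟩
  obtain ⟨a, ha, hmax⟩ := Finset.exists_max_image G (fun l => l.1) hG
  obtain ⟨haS, ⟨k, hkS, hak⟩, n, hI⟩ := Finset.mem_filter.1 ha
  obtain ⟨b, hb, hbmin⟩ := Finset.exists_min_image (S.filter (fun l => a.1 < l.1))
    (fun l => l.1) ⟨k, by simp [hkS, hak]⟩
  simp only [Finset.mem_filter] at hb hbmin
  have hg : ∀ l ∈ S, ¬ (a.1 < l.1 ∧ l.1 < b.1) := by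
    rintro l hl ⟨h1, h2⟩
    linarith [hbmin l ⟨hl, h1⟩]
  obtain ⟨c, hcS, hca, hc⟩ := count ht hM hI hb.2 hg (hk a haS)
  obtain ⟨l, hl, hbl⟩ := hc 1 (Or.inl rfl)
  have := hmax b (Finset.mem_filter.2 ⟨hb.1, ⟨l, hl.1, hbl⟩, a.1, step hb.2 hg hcS hca hc⟩)
  linarith [hb.2]

end Betts

namespace Betts

lemma exists_lam (𝓛 : Set (AffineSubspace ℝ (ℝ × ℝ))) (hfin : 𝓛.Finite)
    (hlines : ∀ L ∈ 𝓛, IsLine L) :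
    ∃ lam : ℝ, ∀ L ∈ 𝓛, ∀ v ∈ L.direction, v ≠ 0 → v.1 + lam * v.2 ≠ 0 := by
  have h1 : ∀ L : AffineSubspace ℝ (ℝ × ℝ), ∃ w : ℝ × ℝ, L ∈ 𝓛 →
      ∀ v ∈ L.direction, ∃ a : ℝ, a • w = v := by
    intro L
    by_cases hL : L ∈ 𝓛
    · obtain ⟨w, -, hw⟩ := finrank_eq_one_iff'.1 (hlines L hL).2
      refine ⟨w, fun _ v hv => ?_⟩
      obtain ⟨a, ha⟩ := hw ⟨v, hv⟩
      exact ⟨a, by simpa using congrArg Subtype.val ha⟩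
    · exact ⟨0, fun h => absurd h hL⟩
  choose w hw using h1
  obtain ⟨lam, hlam⟩ := (hfin.image (fun L => - (w L).1 / (w L).2)).exists_notMem
  refine ⟨lam, fun L hL v hv hv0 h => hlam ⟨L, hL, ?_⟩⟩
  obtain ⟨a, ha⟩ := hw L hL v hv
  have ha0 : a ≠ 0 := by rintro rfl; apply hv0; rw [← ha, zero_smul]
  have e1 : v.1 = a * (w L).1 := by rw [← ha]; rfl
  have e2 : v.2 = a * (w L).2 := by rw [← ha]; rfl
  have h3 : (w L).1 + lam * (w L).2 = 0 := by
    rw [e1, e2] at h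
    have : a * ((w L).1 + lam * (w L).2) = 0 := by linarith
    exact (mul_eq_zero.1 this).resolve_left ha0
  have h4 : (w L).2 ≠ 0 := by
    intro h5
    rw [h5] at h3 e2
    apply hv0
    refine Prod.ext ?_ ?_
    · rw [e1]; simp only [mul_zero, add_zero] at h3; rw [h3]; simp
    · rw [e2]; simp
  show - (w L).1 / (w L).2 = lam
  rw [div_eq_iff h4]; linarith

lemma exists_coord (L : AffineSubspace ℝ (ℝ × ℝ)) (hL : IsLine L) (lam : ℝ)
    (hlam : ∀ v ∈ L.direction, v ≠ 0 → v.1 + lam * v.2 ≠ 0) :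
    ∃ c : ℝ × ℝ, (∀ x : ℝ × ℝ, x ∈ L ↔ x.2 = c.1 * (x.1 + lam * x.2) + c.2) ∧
      ∀ v : ℝ × ℝ, v ∈ L.direction ↔ v.2 = c.1 * (v.1 + lam * v.2) := by
  obtain ⟨⟨q, hq⟩, hr⟩ := hL
  obtain ⟨⟨w, hwL⟩, hw0, hw⟩ := finrank_eq_one_iff'.1 hr
  have hw0' : w ≠ 0 := fun h => hw0 (Subtype.ext h)
  have hd := hlam w hwL hw0'
  set D := w.1 + lam * w.2 with hD
  have hdir : ∀ v : ℝ × ℝ, v ∈ L.direction ↔ v.2 = w.2 / D * (v.1 + lam * v.2) := by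
    intro v
    constructor
    · intro hv
      obtain ⟨a, ha⟩ := hw ⟨v, hv⟩
      have ha' : a • w = v := by simpa using congrArg Subtype.val ha
      have e1 : v.1 = a * w.1 := by rw [← ha']; rfl
      have e2 : v.2 = a * w.2 := by rw [← ha']; rfl
      rw [e1, e2, show a * w.1 + lam * (a * w.2) = a * D by rw [hD]; ring]
      field_simp
    · intro hv
      have : v = ((v.1 + lam * v.2) / D) • w := by
        have h2 : v.2 = (v.1 + lam * v.2) / D * w.2 := by
          linear_combination hv
        refine Prod.ext ?_ h2
        show v.1 = (v.1 + lam * v.2) / D * w.1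
        have h3 : (v.1 + lam * v.2) / D * D = v.1 + lam * v.2 := div_mul_cancel₀ _ hd
        have h4 : w.1 = D - lam * w.2 := by rw [hD]; ring
        rw [h4]
        linear_combination -h3 - lam * h2
      rw [this]
      exact L.direction.smul_mem _ hwL
  refine ⟨(w.2 / D, q.2 - w.2 / D * (q.1 + lam * q.2)), ?_, hdir⟩
  intro x
  have : x ∈ L ↔ x -ᵥ q ∈ L.direction := by
    rw [AffineSubspace.vsub_right_mem_direction_iff_mem hq]
  rw [this, hdir]
  simp only [vsub_eq_sub, Prod.fst_sub, Prod.snd_sub]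
  constructor <;> intro h <;> linear_combination h
noncomputable def pt (lam : ℝ) (c l : ℝ × ℝ) : ℝ × ℝ :=
  (X c l - lam * (c.1 * X c l + c.2), c.1 * X c l + c.2)

lemma X_spec {c l : ℝ × ℝ} (h : l.1 ≠ c.1) (x : ℝ) :
    c.1 * x + c.2 = l.1 * x + l.2 ↔ x = X c l := by
  unfold X
  rw [← div_eq_mul_inv, eq_div_iff (sub_ne_zero.2 h)]
  constructor <;> intro h <;> linear_combination -h

lemma eq_pt {lam : ℝ} {c l x : ℝ × ℝ} (h : l.1 ≠ c.1)
    (h1 : x.2 = c.1 * (x.1 + lam * x.2) + c.2) (h2 : x.2 = l.1 * (x.1 + lam * x.2) + l.2) :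
    x = pt lam c l := by
  have h3 := (X_spec h (x.1 + lam * x.2)).1 (by rw [← h1, ← h2])
  unfold pt
  rw [← h3, ← h1]
  ext <;> simp

end Betts

/-- Betts' lemma: a finite `t`-parallel family of lines in `ℝ²`, not all parallel,
has a line containing at least `t/2` ordinary points of the family. -/
theorem betts_lemma (t : ℝ) (ht : 0 < t) (𝓛 : Set (AffineSubspace ℝ (ℝ × ℝ)))
    (hfin : 𝓛.Finite) (hlines : ∀ L ∈ 𝓛, IsLine L)
    (hparallel : ∀ L ∈ 𝓛,
      t ≤ ({L' ∈ 𝓛 | L' ≠ L ∧ AffineSubspace.Parallel L' L}.ncard : ℝ))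
    (hnotall : ¬ ∀ L ∈ 𝓛, ∀ L' ∈ 𝓛, AffineSubspace.Parallel L L') :
    ∃ L ∈ 𝓛, t / 2 ≤
      ({p : ℝ × ℝ | p ∈ L ∧ IsOrdinaryPoint 𝓛 p}.ncard : ℝ) := by
  obtain ⟨lam, hlam⟩ := Betts.exists_lam 𝓛 hfin hlines
  have hco : ∀ L : AffineSubspace ℝ (ℝ × ℝ), ∃ c : ℝ × ℝ, L ∈ 𝓛 →
      (∀ x : ℝ × ℝ, x ∈ L ↔ x.2 = c.1 * (x.1 + lam * x.2) + c.2) ∧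
      ∀ v : ℝ × ℝ, v ∈ L.direction ↔ v.2 = c.1 * (v.1 + lam * v.2) := by
    intro L
    by_cases hL : L ∈ 𝓛
    · obtain ⟨c, hc⟩ := Betts.exists_coord L (hlines L hL) lam (hlam L hL)
      exact ⟨c, fun _ => hc⟩
    · exact ⟨0, fun h => absurd h hL⟩
  choose f hf using hco
  have hmem : ∀ L ∈ 𝓛, ∀ x : ℝ × ℝ, x ∈ L ↔ x.2 = (f L).1 * (x.1 + lam * x.2) + (f L).2 :=
    fun L hL => (hf L hL).1
  have hinj : ∀ L ∈ 𝓛, ∀ L' ∈ 𝓛, f L = f L' → L = L' := by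
    intro L hL L' hL' h
    ext x
    rw [hmem L hL, hmem L' hL', h]
  have hpar : ∀ L ∈ 𝓛, ∀ L' ∈ 𝓛, AffineSubspace.Parallel L L' ↔ (f L).1 = (f L').1 := by
    intro L hL L' hL'
    constructor
    · intro h
      have h1 := h.direction_eq
      have h2 : (((1 - lam * (f L).1, (f L).1) : ℝ × ℝ)) ∈ L.direction := by
        rw [(hf L hL).2]; ring
      rw [h1, (hf L' hL').2] at h2
      simp only at h2
      linear_combination h2
    · intro h
      rw [AffineSubspace.parallel_iff_direction_eq_and_eq_bot_iff_eq_bot]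
      constructor
      · ext v
        rw [(hf L hL).2, (hf L' hL').2, h]
      · have n1 : L ≠ ⊥ := (AffineSubspace.nonempty_iff_ne_bot L).1 (hlines L hL).1
        have n2 : L' ≠ ⊥ := (AffineSubspace.nonempty_iff_ne_bot L').1 (hlines L' hL').1
        simp [n1, n2]
  classical
  set F := hfin.toFinset with hF
  have hFm : ∀ L, L ∈ F ↔ L ∈ 𝓛 := fun L => hfin.mem_toFinset
  set S := F.image f with hS
  have hSm : ∀ L ∈ 𝓛, f L ∈ S := fun L hL => Finset.mem_image_of_mem f ((hFm L).2 hL)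
  have hMany : Betts.Many S t := by
    apply Betts.main ht
    · intro l hl
      obtain ⟨L, hL, rfl⟩ := Finset.mem_image.1 hl
      rw [hFm] at hL
      have h1 := hparallel L hL
      have h2 : {L' ∈ 𝓛 | L' ≠ L ∧ AffineSubspace.Parallel L' L} =
          ((F.filter (fun L' => L' ≠ L ∧ AffineSubspace.Parallel L' L) : Finset _) : Set _) := by
        ext L'; simp [hFm]
      rw [h2, Set.ncard_coe_finset] at h1
      have h3 : (F.filter (fun L' => L' ≠ L ∧ AffineSubspace.Parallel L' L)).card + 1 ≤
          (S.filter (fun c => c.1 = (f L).1)).card := by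
        rw [← Finset.card_insert_of_notMem (a := L) (by simp)]
        refine Finset.card_le_card_of_injOn f ?_ ?_
        · intro L' hL'
          simp only [Finset.coe_insert, Set.mem_insert_iff, Finset.mem_coe,
            Finset.mem_filter] at hL' ⊢
          rcases hL' with rfl | ⟨h3, -, h4⟩
          · exact ⟨hSm _ hL, rfl⟩
          · rw [hFm] at h3
            exact ⟨hSm _ h3, (hpar _ h3 _ hL).1 h4⟩
        · have : ∀ L' ∈ insert L (F.filter (fun L' => L' ≠ L ∧ AffineSubspace.Parallel L' L)),
              L' ∈ 𝓛 := by
            intro L' h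
            rcases Finset.mem_insert.1 h with rfl | h
            · exact hL
            · exact (hFm _).1 (Finset.mem_filter.1 h).1
          intro A hA B hB hAB
          exact hinj A (this A hA) B (this B hB) hAB
      have h4 : ((F.filter (fun L' => L' ≠ L ∧ AffineSubspace.Parallel L' L)).card : ℝ) + 1 ≤
          (S.filter (fun c => c.1 = (f L).1)).card := by exact_mod_cast h3
      linarith
    · push Not at hnotall
      obtain ⟨L, hL, L', hL', h⟩ := hnotall
      exact ⟨f L, hSm L hL, f L', hSm L' hL', fun h' => h ((hpar L hL L' hL').2 h')⟩
  obtain ⟨l, hl, T, hTS, m, hT, hc⟩ := hMany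
  obtain ⟨L, hL, rfl⟩ := Finset.mem_image.1 hl
  rw [hFm] at hL
  refine ⟨L, hL, hT.trans ?_⟩
  have hfinite : {p : ℝ × ℝ | p ∈ L ∧ IsOrdinaryPoint 𝓛 p}.Finite := by
    refine (hfin.image (fun L' => Betts.pt lam (f L) (f L'))).subset ?_
    rintro p ⟨hpL, hp⟩
    obtain ⟨A, B, hAB, hEq⟩ := Set.ncard_eq_two.1 hp
    have : ∃ L' ∈ 𝓛, p ∈ L' ∧ L' ≠ L := by
      have hA : A ∈ {L ∈ 𝓛 | p ∈ L} := by rw [hEq]; simp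
      have hB : B ∈ {L ∈ 𝓛 | p ∈ L} := by rw [hEq]; simp
      by_cases h : A = L
      · exact ⟨B, hB.1, hB.2, fun h' => hAB (h.trans h'.symm)⟩
      · exact ⟨A, hA.1, hA.2, h⟩
    obtain ⟨L', hL', hpL', hne⟩ := this
    rw [hmem L hL] at hpL
    rw [hmem L' hL'] at hpL'
    refine ⟨L', hL', (Betts.eq_pt ?_ hpL hpL').symm⟩
    intro h
    apply hne
    refine hinj _ hL' _ hL (Prod.ext h ?_)
    rw [h] at hpL'
    linarith
  rw [← Set.ncard_coe_finset]
  refine Nat.cast_le.2 (Set.ncard_le_ncard_of_injOn (fun c => Betts.pt lam c (f L)) ?_ ?_ hfinite)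
  · intro c hcT
    obtain ⟨hcm, hlm, hu⟩ := hc c hcT
    obtain ⟨K, hK, rfl⟩ := Finset.mem_image.1 (hTS hcT)
    rw [hFm] at hK
    have hne : (f L).1 ≠ (f K).1 := by rwa [hcm]
    have hx := (Betts.X_spec hne _).2 rfl
    have hpmem : ∀ M ∈ 𝓛, Betts.pt lam (f K) (f L) ∈ M ↔
        (f K).1 * Betts.X (f K) (f L) + (f K).2 = (f M).1 * Betts.X (f K) (f L) + (f M).2 := by
      intro M hM
      rw [hmem M hM]
      simp [Betts.pt]
    refine ⟨(hpmem L hL).2 hx, ?_⟩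
    have : {M ∈ 𝓛 | Betts.pt lam (f K) (f L) ∈ M} = {K, L} := by
      ext M
      simp only [Set.mem_ofPred_eq, Set.mem_insert_iff, Set.mem_singleton_iff]
      constructor
      · rintro ⟨hM, hpM⟩
        rw [hpmem M hM] at hpM
        by_cases h : (f M).1 = (f K).1
        · left
          refine hinj _ hM _ hK (Prod.ext h ?_)
          rw [h] at hpM
          linarith
        · right
          refine hinj _ hM _ hL (hu _ (hSm M hM) (by rwa [← hcm]) ?_)
          exact ((Betts.X_spec h _).1 hpM).symm
      · rintro (rfl | rfl)
        · exact ⟨hK, (hpmem _ hK).2 rfl⟩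
        · exact ⟨hL, (hpmem _ hL).2 hx⟩
    show {M ∈ 𝓛 | Betts.pt lam (f K) (f L) ∈ M}.ncard = 2
    rw [this]
    exact Set.ncard_pair (fun h => hne (by rw [h]))
  · intro c hcT c' hcT' h
    obtain ⟨hcm, hlm, -⟩ := hc c hcT
    obtain ⟨hcm', -, -⟩ := hc c' hcT'
    simp only [Betts.pt, Prod.mk.injEq] at h
    obtain ⟨h1, h2⟩ := h
    have h3 : Betts.X c (f L) = Betts.X c' (f L) := by rw [h2] at h1; linarith
    rw [h3, hcm, hcm'] at h2
    exact Prod.ext (by rw [hcm, hcm']) (by linarith)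
end

section
/- There is an absolute constant c > 0 such that the following holds. Let m ≥ 2 be an integer, let ε > 0, and let P be a set of n points in the real projective plane ℝP² contained in a union of m lines ℓ₁ ∪ ⋯ ∪ ℓ_m which do not all pass through a single common point, with at least εn points of P lying on each line ℓ_i. Suppose moreover that m ≤ n^{1/10000} and 1/ε ≤ n^{1/10000}. Then P spans at least c·ε^{12}·n²/m⁶ ordinary lines. -/
/-- The real projective plane: one-dimensional subspaces of `ℝ³`. -/
abbrev RP2 := Projectivization ℝ (Fin 3 → ℝ)

/-- A line in `ℝP²`: the set of points contained in a fixed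
two-dimensional linear subspace of `ℝ³`. -/
def IsProjLine (L : Set RP2) : Prop :=
  ∃ W : Submodule ℝ (Fin 3 → ℝ), Module.finrank ℝ W = 2 ∧
    L = {x : RP2 | x.submodule ≤ W}

/-- The number of ordinary lines of `P`: lines containing exactly two points of `P`. -/
noncomputable def numOrdinaryLines (P : Set RP2) : ℕ :=
  {L : Set RP2 | IsProjLine L ∧ (P ∩ L).ncard = 2}.ncard


namespace OrdLines

/-- Hook argument: many products avoid a given small set. -/
lemma hooks (k : ℕ) : ∀ (X Y C : Finset ℝ), (∀ x ∈ X, 0 < x) → (∀ y ∈ Y, 0 < y) →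
    k ≤ X.card → k ≤ Y.card → C.card + 2 * k ≤ X.card + Y.card →
    k ^ 2 ≤ ((X ×ˢ Y).filter (fun p => p.1 * p.2 ∉ C)).card := by
  induction k with
  | zero => intros; simp
  | succ k ih =>
    intro X Y C hX hY hkX hkY hC
    have hXn : X.Nonempty := Finset.card_pos.mp (by omega)
    have hYn : Y.Nonempty := Finset.card_pos.mp (by omega)
    set a := X.min' hXn with ha
    set b := Y.max' hYn with hb
    have haX : a ∈ X := X.min'_mem hXn
    have hbY : b ∈ Y := Y.max'_mem hYn
    have h1 := ih (X.erase a) (Y.erase b) C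
      (fun x hx => hX x (Finset.mem_of_mem_erase hx))
      (fun y hy => hY y (Finset.mem_of_mem_erase hy))
      (by rw [Finset.card_erase_of_mem haX]; omega)
      (by rw [Finset.card_erase_of_mem hbY]; omega)
      (by rw [Finset.card_erase_of_mem haX, Finset.card_erase_of_mem hbY]; omega)
    -- the hook
    set H : Finset (ℝ × ℝ) := Y.image (fun y => (a, y)) ∪ (X.erase a).image (fun x => (x, b))
      with hH
    have hHcard : H.card = Y.card + (X.card - 1) := by
      rw [hH, Finset.card_union_of_disjoint, Finset.card_image_of_injective,
        Finset.card_image_of_injective, Finset.card_erase_of_mem haX]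
      · intro x y h; simpa using h
      · intro x y h; simpa using h
      · rw [Finset.disjoint_left]
        intro p hp hq
        simp only [Finset.mem_image, Finset.mem_erase] at hp hq
        obtain ⟨y, _, rfl⟩ := hp
        obtain ⟨x, ⟨hx, _⟩, h⟩ := hq
        exact hx (by simpa using congrArg Prod.fst h)
    have hinj : Set.InjOn (fun p : ℝ × ℝ => p.1 * p.2) (H : Set (ℝ × ℝ)) := by
      have hapos := hX a haX
      have hbpos := hY b hbY
      have key : ∀ y ∈ Y, ∀ x ∈ X, x ≠ a → a * y < x * b := by
        intro y hy x hx hxa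
        have h1 : y ≤ b := Y.le_max' y hy
        have h2 : a < x := lt_of_le_of_ne (X.min'_le x hx) (Ne.symm hxa)
        have h3 := hY y hy
        nlinarith
      intro p hp q hq hpq
      simp only [hH, Finset.coe_union, Finset.coe_image, Set.mem_union, Set.mem_image,
        Finset.mem_coe, Finset.mem_erase] at hp hq
      simp only at hpq
      rcases hp with ⟨y, hy, rfl⟩ | ⟨x, ⟨hxa, hx⟩, rfl⟩ <;>
      rcases hq with ⟨y', hy', rfl⟩ | ⟨x', ⟨hxa', hx'⟩, rfl⟩
      · exact Prod.ext rfl (mul_left_cancel₀ hapos.ne' hpq)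
      · exact absurd hpq (key y hy x' hx' hxa').ne
      · exact absurd hpq.symm (key y' hy' x hx hxa).ne
      · exact Prod.ext (mul_right_cancel₀ hbpos.ne' hpq) rfl
    have hHC : (H.filter (fun p => p.1 * p.2 ∈ C)).card ≤ C.card := by
      apply Finset.card_le_card_of_injOn (fun p => p.1 * p.2)
      · intro p hp
        simp only [Finset.coe_filter, Set.mem_ofPred_eq] at hp
        exact hp.2
      · exact hinj.mono (by intro p hp; simp only [Finset.coe_filter, Set.mem_ofPred_eq] at hp; exact hp.1)
    have hsplit := Finset.card_filter_add_card_filter_not (s := H) (fun p => p.1 * p.2 ∈ C)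
    have hsub : (((X.erase a) ×ˢ (Y.erase b)).filter (fun p => p.1 * p.2 ∉ C)) ∪
        (H.filter (fun p => p.1 * p.2 ∉ C)) ⊆ (X ×ˢ Y).filter (fun p => p.1 * p.2 ∉ C) := by
      intro p hp
      simp only [hH, Finset.mem_union, Finset.mem_filter, Finset.mem_product, Finset.mem_erase,
        Finset.mem_image] at hp ⊢
      rcases hp with ⟨⟨⟨_, h1⟩, ⟨_, h2⟩⟩, h3⟩ | ⟨⟨y, hy, rfl⟩ | ⟨x, hx, rfl⟩, h3⟩
      · exact ⟨⟨h1, h2⟩, h3⟩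
      · exact ⟨⟨haX, hy⟩, h3⟩
      · exact ⟨⟨hx.2, hbY⟩, h3⟩
    have hdisj : Disjoint (((X.erase a) ×ˢ (Y.erase b)).filter (fun p => p.1 * p.2 ∉ C))
        (H.filter (fun p => p.1 * p.2 ∉ C)) := by
      rw [Finset.disjoint_left]
      intro p hp hq
      simp only [hH, Finset.mem_union, Finset.mem_filter, Finset.mem_product, Finset.mem_erase,
        Finset.mem_image] at hp hq
      rcases hq with ⟨⟨y, hy, rfl⟩ | ⟨x, hx, rfl⟩, h3⟩
      · exact hp.1.1.1 rfl
      · exact hp.1.2.1 rfl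
    have h2 := Finset.card_le_card hsub
    rw [Finset.card_union_of_disjoint hdisj] at h2
    have h3 : (k + 1) ^ 2 = k ^ 2 + 2 * k + 1 := by ring
    omega

/-- Monotone chains in a grid. -/
lemma chain_mono (F : Finset ℝ) (B : ℕ) (φ ψ : ℝ → ℕ) (hφ : MonotoneOn φ (F : Set ℝ))
    (hψ : MonotoneOn ψ (F : Set ℝ)) (hφB : ∀ x ∈ F, φ x < B) (hψB : ∀ x ∈ F, ψ x < B) :
    (F.image (fun x => (φ x, ψ x))).card ≤ 2 * B := by
  have : (F.image (fun x => (φ x, ψ x))).card ≤ (Finset.range (2 * B)).card := by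
    apply Finset.card_le_card_of_injOn (fun p => p.1 + p.2)
    · intro p hp
      simp only [Finset.coe_image, Set.mem_image, Finset.mem_coe] at hp
      obtain ⟨x, hx, rfl⟩ := hp
      have := hφB x hx
      have := hψB x hx
      simp; omega
    · intro p hp q hq hpq
      simp only [Finset.coe_image, Set.mem_image, Finset.mem_coe] at hp hq
      obtain ⟨x, hx, rfl⟩ := hp
      obtain ⟨y, hy, rfl⟩ := hq
      simp only at hpq
      rcases le_total x y with h | h
      · have h1 := hφ hx hy h
        have h2 := hψ hx hy h
        ext <;> simp <;> omega
      · have h1 := hφ hy hx h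
        have h2 := hψ hy hx h
        ext <;> simp <;> omega
  simpa using this

lemma chain_any (F : Finset ℝ) (B : ℕ) (φ ψ : ℝ → ℕ)
    (hφ : MonotoneOn φ (F : Set ℝ) ∨ AntitoneOn φ (F : Set ℝ))
    (hψ : MonotoneOn ψ (F : Set ℝ) ∨ AntitoneOn ψ (F : Set ℝ))
    (hφB : ∀ x ∈ F, φ x < B) (hψB : ∀ x ∈ F, ψ x < B) :
    (F.image (fun x => (φ x, ψ x))).card ≤ 2 * B := by
  have flip : ∀ χ : ℝ → ℕ, (∀ x ∈ F, χ x < B) →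
      (MonotoneOn χ (F : Set ℝ) ∨ AntitoneOn χ (F : Set ℝ)) →
      ∃ χ' : ℝ → ℕ, MonotoneOn χ' (F : Set ℝ) ∧ (∀ x ∈ F, χ' x < B) ∧
        ∃ g : ℕ → ℕ, ∀ x ∈ F, χ x = g (χ' x) := by
    intro χ hB h
    rcases h with h | h
    · exact ⟨χ, h, hB, id, fun _ _ => rfl⟩
    · refine ⟨fun x => B - 1 - χ x, ?_, ?_, fun t => B - 1 - t, ?_⟩
      · intro x hx y hy hxy
        have := h hx hy hxy
        simp only; omega
      · intro x hx
        have := hB x hx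
        simp only; omega
      · intro x hx
        have := hB x hx
        simp only; omega
  obtain ⟨φ', h1, h2, g, hg⟩ := flip φ hφB hφ
  obtain ⟨ψ', h1', h2', g', hg'⟩ := flip ψ hψB hψ
  refine le_trans ?_ (chain_mono F B φ' ψ' h1 h1' h2 h2')
  have : F.image (fun x => (φ x, ψ x)) =
      (F.image (fun x => (φ' x, ψ' x))).image (fun p => (g p.1, g' p.2)) := by
    rw [Finset.image_image]
    apply Finset.image_congr
    intro x hx
    simp [hg x hx, hg' x hx]
  rw [this]
  exact Finset.card_image_le

/-- A Möbius-like function is monotone or antitone on each sign class of its denominator. -/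
lemma moebius_mono (F : Finset ℝ) (u d : ℝ → ℝ) (Δ : ℝ)
    (hpos : ∀ x ∈ F, ∀ y ∈ F, 0 < d x * d y)
    (h : ∀ x ∈ F, ∀ y ∈ F, (u x - u y) * (d x * d y) = Δ * (x - y)) :
    MonotoneOn u (F : Set ℝ) ∨ AntitoneOn u (F : Set ℝ) := by
  rcases le_total 0 Δ with hΔ | hΔ
  · left
    intro x hx y hy hxy
    have h1 := hpos x hx y hy
    have h2 := h x hx y hy
    by_contra hc
    push Not at hc
    nlinarith [mul_pos (sub_pos.mpr hc) h1, mul_nonneg hΔ (sub_nonneg.mpr hxy)]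
  · right
    intro x hx y hy hxy
    have h1 := hpos x hx y hy
    have h2 := h x hx y hy
    by_contra hc
    push Not at hc
    nlinarith [mul_pos (sub_pos.mpr hc) h1, mul_nonneg (neg_nonneg.mpr hΔ) (sub_nonneg.mpr hxy)]

lemma cells (F : Finset ℝ) (B : ℕ) (u u' d d' : ℝ → ℝ) (Δ Δ' : ℝ) (β β' : ℝ → ℕ)
    (hβ : Monotone β) (hβ' : Monotone β')
    (hB : ∀ x ∈ F, β (u x) < B) (hB' : ∀ x ∈ F, β' (u' x) < B)
    (hd : ∀ x ∈ F, d x ≠ 0) (hd' : ∀ x ∈ F, d' x ≠ 0)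
    (h : ∀ x ∈ F, ∀ y ∈ F, (u x - u y) * (d x * d y) = Δ * (x - y))
    (h' : ∀ x ∈ F, ∀ y ∈ F, (u' x - u' y) * (d' x * d' y) = Δ' * (x - y)) :
    (F.image (fun x => (β (u x), β' (u' x)))).card ≤ 8 * B := by
  classical
  have one : ∀ G : Finset ℝ, G ⊆ F → (∀ x ∈ G, ∀ y ∈ G, 0 < d x * d y) →
      (∀ x ∈ G, ∀ y ∈ G, 0 < d' x * d' y) →
      (G.image (fun x => (β (u x), β' (u' x)))).card ≤ 2 * B := by
    intro G hG hp hp'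
    apply chain_any
    · rcases moebius_mono G u d Δ hp (fun x hx y hy => h x (hG hx) y (hG hy)) with m | m
      · exact Or.inl (fun x hx y hy hxy => hβ (m hx hy hxy))
      · exact Or.inr (fun x hx y hy hxy => hβ (m hx hy hxy))
    · rcases moebius_mono G u' d' Δ' hp' (fun x hx y hy => h' x (hG hx) y (hG hy)) with m | m
      · exact Or.inl (fun x hx y hy hxy => hβ' (m hx hy hxy))
      · exact Or.inr (fun x hx y hy hxy => hβ' (m hx hy hxy))
    · exact fun x hx => hB x (hG hx)
    · exact fun x hx => hB' x (hG hx)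
  have hsub : F.image (fun x => (β (u x), β' (u' x))) ⊆
      (((F.filter (fun x => 0 < d x ∧ 0 < d' x)).image (fun x => (β (u x), β' (u' x)))) ∪
      ((F.filter (fun x => 0 < d x ∧ d' x < 0)).image (fun x => (β (u x), β' (u' x))))) ∪
      (((F.filter (fun x => d x < 0 ∧ 0 < d' x)).image (fun x => (β (u x), β' (u' x)))) ∪
      ((F.filter (fun x => d x < 0 ∧ d' x < 0)).image (fun x => (β (u x), β' (u' x))))) := by
    rw [← Finset.image_union, ← Finset.image_union, ← Finset.image_union]
    apply Finset.image_subset_image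
    intro x hx
    simp only [Finset.mem_union, Finset.mem_filter]
    rcases lt_or_gt_of_ne (hd x hx) with h1 | h1 <;> rcases lt_or_gt_of_ne (hd' x hx) with h2 | h2 <;>
      tauto
  have c1 := one (F.filter (fun x => 0 < d x ∧ 0 < d' x)) (Finset.filter_subset _ _)
    (by intro x hx y hy; simp only [Finset.mem_filter] at hx hy; exact mul_pos hx.2.1 hy.2.1)
    (by intro x hx y hy; simp only [Finset.mem_filter] at hx hy; exact mul_pos hx.2.2 hy.2.2)
  have c2 := one (F.filter (fun x => 0 < d x ∧ d' x < 0)) (Finset.filter_subset _ _)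
    (by intro x hx y hy; simp only [Finset.mem_filter] at hx hy; exact mul_pos hx.2.1 hy.2.1)
    (by intro x hx y hy; simp only [Finset.mem_filter] at hx hy; exact mul_pos_of_neg_of_neg hx.2.2 hy.2.2)
  have c3 := one (F.filter (fun x => d x < 0 ∧ 0 < d' x)) (Finset.filter_subset _ _)
    (by intro x hx y hy; simp only [Finset.mem_filter] at hx hy; exact mul_pos_of_neg_of_neg hx.2.1 hy.2.1)
    (by intro x hx y hy; simp only [Finset.mem_filter] at hx hy; exact mul_pos hx.2.2 hy.2.2)
  have c4 := one (F.filter (fun x => d x < 0 ∧ d' x < 0)) (Finset.filter_subset _ _)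
    (by intro x hx y hy; simp only [Finset.mem_filter] at hx hy; exact mul_pos_of_neg_of_neg hx.2.1 hy.2.1)
    (by intro x hx y hy; simp only [Finset.mem_filter] at hx hy; exact mul_pos_of_neg_of_neg hx.2.2 hy.2.2)
  have := Finset.card_le_card hsub
  have e1 := Finset.card_union_le ((F.filter (fun x => 0 < d x ∧ 0 < d' x)).image (fun x => (β (u x), β' (u' x))) ∪
      ((F.filter (fun x => 0 < d x ∧ d' x < 0)).image (fun x => (β (u x), β' (u' x)))))
      (((F.filter (fun x => d x < 0 ∧ 0 < d' x)).image (fun x => (β (u x), β' (u' x)))) ∪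
      ((F.filter (fun x => d x < 0 ∧ d' x < 0)).image (fun x => (β (u x), β' (u' x)))))
  have e2 := Finset.card_union_le ((F.filter (fun x => 0 < d x ∧ 0 < d' x)).image (fun x => (β (u x), β' (u' x))))
      ((F.filter (fun x => 0 < d x ∧ d' x < 0)).image (fun x => (β (u x), β' (u' x))))
  have e3 := Finset.card_union_le ((F.filter (fun x => d x < 0 ∧ 0 < d' x)).image (fun x => (β (u x), β' (u' x))))
      ((F.filter (fun x => d x < 0 ∧ d' x < 0)).image (fun x => (β (u x), β' (u' x))))
  omega

/-- Cauchy–Schwarz for fibres. -/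
lemma same_cell {α κ : Type*} [DecidableEq κ] (F : Finset α) (g : α → κ) (T : ℕ)
    (hT : (F.image g).card ≤ T) :
    F.card ^ 2 ≤ T * ((F ×ˢ F).filter (fun p => g p.1 = g p.2)).card := by
  have h1 : F.card = ∑ b ∈ F.image g, (F.filter (fun a => g a = b)).card :=
    Finset.card_eq_sum_card_image g F
  have h2 : ((F ×ˢ F).filter (fun p => g p.1 = g p.2)).card =
      ∑ b ∈ F.image g, (F.filter (fun a => g a = b)).card ^ 2 := by
    rw [Finset.card_eq_sum_card_fiberwise (f := fun p : α × α => g p.1) (t := F.image g)]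
    · apply Finset.sum_congr rfl
      intro b _
      rw [sq, ← Finset.card_product]
      congr 1
      ext ⟨x, y⟩
      simp only [Finset.mem_filter, Finset.mem_product]
      constructor
      · rintro ⟨⟨⟨h1, h2⟩, h3⟩, h4⟩
        exact ⟨⟨h1, h4⟩, h2, by rw [← h3, h4]⟩
      · rintro ⟨⟨h1, h4⟩, h2, h3⟩
        exact ⟨⟨⟨h1, h2⟩, by rw [h3, h4]⟩, h4⟩
    · intro p hp
      simp only [Finset.coe_filter, Finset.mem_product, Set.mem_ofPred_eq] at hp
      exact Finset.mem_coe.mpr (Finset.mem_image_of_mem g hp.1.1)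
  rw [h2]
  calc F.card ^ 2 = (∑ b ∈ F.image g, (F.filter (fun a => g a = b)).card) ^ 2 := by rw [← h1]
    _ ≤ (F.image g).card * ∑ b ∈ F.image g, (F.filter (fun a => g a = b)).card ^ 2 :=
        sq_sum_le_card_mul_sum_sq
    _ ≤ _ := Nat.mul_le_mul_right _ hT

/-- Blocks of consecutive elements. -/
lemma exists_blocks (C : Finset ℝ) (B : ℕ) (hB : 0 < B) (hC : C.card < B * B) :
    ∃ β : ℝ → ℕ, Monotone β ∧ (∀ c ∈ C, β c < B) ∧
      ((C ×ˢ C).filter (fun p => β p.1 = β p.2)).card ≤ C.card * B := by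
  classical
  set rk : ℝ → ℕ := fun c => (C.filter (fun z => z < c)).card with hrk
  have hmono : Monotone rk := by
    intro a b hab
    apply Finset.card_le_card
    intro z hz
    simp only [Finset.mem_filter] at hz ⊢
    exact ⟨hz.1, lt_of_lt_of_le hz.2 hab⟩
  have hinj : ∀ a ∈ C, ∀ b ∈ C, rk a = rk b → a = b := by
    have : ∀ a ∈ C, ∀ b ∈ C, a < b → rk a < rk b := by
      intro a ha b hb hab
      apply Finset.card_lt_card
      refine ⟨?_, ?_⟩
      · intro z hz
        simp only [Finset.mem_filter] at hz ⊢
        exact ⟨hz.1, hz.2.trans hab⟩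
      · intro hsub
        have : a ∈ C.filter (fun z => z < a) := hsub (by simp [ha, hab])
        simp at this
    intro a ha b hb h
    rcases lt_trichotomy a b with h1 | h1 | h1
    · have := this a ha b hb h1; omega
    · exact h1
    · have := this b hb a ha h1; omega
  refine ⟨fun c => rk c / B, ?_, ?_, ?_⟩
  · intro a b hab
    exact Nat.div_le_div_right (hmono hab)
  · intro c hc
    rw [Nat.div_lt_iff_lt_mul hB]
    exact lt_of_le_of_lt (Finset.card_filter_le _ _) hC
  · have : ((C ×ˢ C).filter (fun p => rk p.1 / B = rk p.2 / B)).card ≤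
        (C ×ˢ Finset.range B).card := by
      apply Finset.card_le_card_of_injOn (fun p => (p.1, rk p.2 % B))
      · intro p hp
        simp only [Finset.coe_filter, Finset.mem_product, Set.mem_ofPred_eq] at hp
        simp [hp.1.1, Nat.mod_lt _ hB]
      · intro p hp q hq hpq
        simp only [Finset.coe_filter, Finset.mem_product, Set.mem_ofPred_eq] at hp hq
        simp only [Prod.mk.injEq] at hpq
        have e : rk p.2 = rk q.2 := by
          rw [← Nat.div_add_mod (rk p.2) B, ← Nat.div_add_mod (rk q.2) B, hpq.2, ← hp.2, ← hq.2,
            hpq.1]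
        exact Prod.ext hpq.1 (hinj _ hp.1.2 _ hq.1.2 e)
    simpa [Finset.card_product] using this

end OrdLines


namespace OrdLines

/-- The abstract incidence bound. -/
lemma incidence (n B : ℕ) (X Y Y' C C' : Finset ℝ) (hY : Y.card ≤ n) (hY' : Y'.card ≤ n)
    (hC : C.card ≤ n) (hC' : C'.card ≤ n) (hB0 : 0 < B) (hB : n < B * B)
    (f f' d d' : ℝ → ℝ → ℝ) (Δ Δ' : ℝ → ℝ) (G G' : ℝ → ℝ → Prop)
    [∀ x y, Decidable (G x y)] [∀ x y, Decidable (G' x y)]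
    (hf : ∀ x ∈ X, ∀ y ∈ Y, G x y → f x y ∈ C ∧ d x y ≠ 0)
    (hf' : ∀ x ∈ X, ∀ y ∈ Y', G' x y → f' x y ∈ C' ∧ d' x y ≠ 0)
    (hΔ : ∀ y ∈ Y, Δ y ≠ 0 ∧ ∀ x₁ ∈ X, ∀ x₂ ∈ X, G x₁ y → G x₂ y →
      (f x₁ y - f x₂ y) * (d x₁ y * d x₂ y) = Δ y * (x₁ - x₂))
    (hΔ' : ∀ y ∈ Y', Δ' y ≠ 0 ∧ ∀ x₁ ∈ X, ∀ x₂ ∈ X, G' x₁ y → G' x₂ y →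
      (f' x₁ y - f' x₂ y) * (d' x₁ y * d' x₂ y) = Δ' y * (x₁ - x₂))
    (h2 : ∀ c₁ ∈ C, ∀ c₂ ∈ C, c₁ ≠ c₂ → ∀ c₁' ∈ C', ∀ c₂' ∈ C', c₁' ≠ c₂' →
      ∀ S : Finset ((ℝ × ℝ) × (ℝ × ℝ)),
        (∀ s ∈ S, (s.1.1 ∈ Y ∧ s.1.2 ∈ Y' ∧ s.2.1 ∈ X ∧ s.2.2 ∈ X) ∧
          (G s.2.1 s.1.1 ∧ G s.2.2 s.1.1 ∧ G' s.2.1 s.1.2 ∧ G' s.2.2 s.1.2) ∧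
          f s.2.1 s.1.1 = c₁ ∧ f s.2.2 s.1.1 = c₂ ∧ f' s.2.1 s.1.2 = c₁' ∧ f' s.2.2 s.1.2 = c₂') →
        S.card ≤ 2) :
    (∑ q ∈ Y ×ˢ Y', (X.filter (fun x => G x q.1 ∧ G' x q.2)).card) ^ 2 ≤
      (n * n) * (8 * B * ((∑ q ∈ Y ×ˢ Y', (X.filter (fun x => G x q.1 ∧ G' x q.2)).card) +
        2 * ((n * B) * (n * B)))) := by
  classical
  obtain ⟨β, hβ, hβB, hβc⟩ := exists_blocks C B hB0 (lt_of_le_of_lt hC hB)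
  obtain ⟨β', hβ', hβB', hβc'⟩ := exists_blocks C' B hB0 (lt_of_le_of_lt hC' hB)
  set F : ℝ × ℝ → Finset ℝ := fun q => X.filter (fun x => G x q.1 ∧ G' x q.2) with hF
  set cell : ℝ × ℝ → ℝ → ℕ × ℕ := fun q x => (β (f x q.1), β' (f' x q.2)) with hcell
  have hFmem : ∀ q x, x ∈ F q ↔ x ∈ X ∧ G x q.1 ∧ G' x q.2 := by
    intro q x; simp [hF]
  -- the lower bound for each q
  have low : ∀ q ∈ Y ×ˢ Y', (F q).card ^ 2 ≤
      8 * B * ((F q ×ˢ F q).filter (fun p => cell q p.1 = cell q p.2)).card := by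
    intro q hq
    rw [Finset.mem_product] at hq
    apply same_cell
    apply cells (F q) B (fun x => f x q.1) (fun x => f' x q.2) (fun x => d x q.1)
      (fun x => d' x q.2) (Δ q.1) (Δ' q.2) β β' hβ hβ'
    · intro x hx
      rw [hFmem] at hx
      exact hβB _ (hf x hx.1 q.1 hq.1 hx.2.1).1
    · intro x hx
      rw [hFmem] at hx
      exact hβB' _ (hf' x hx.1 q.2 hq.2 hx.2.2).1
    · intro x hx
      rw [hFmem] at hx
      exact (hf x hx.1 q.1 hq.1 hx.2.1).2
    · intro x hx
      rw [hFmem] at hx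
      exact (hf' x hx.1 q.2 hq.2 hx.2.2).2
    · intro x hx y hy
      rw [hFmem] at hx hy
      exact (hΔ q.1 hq.1).2 x hx.1 y hy.1 hx.2.1 hy.2.1
    · intro x hx y hy
      rw [hFmem] at hx hy
      exact (hΔ' q.2 hq.2).2 x hx.1 y hy.1 hx.2.2 hy.2.2
  -- splitting off the diagonal
  have split : ∀ q, ((F q ×ˢ F q).filter (fun p => cell q p.1 = cell q p.2)).card ≤
      (F q).card + ((F q ×ˢ F q).filter (fun p => cell q p.1 = cell q p.2 ∧ p.1 ≠ p.2)).card := by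
    intro q
    have hsub : (F q ×ˢ F q).filter (fun p => cell q p.1 = cell q p.2) ⊆
        (F q).image (fun x => (x, x)) ∪
          (F q ×ˢ F q).filter (fun p => cell q p.1 = cell q p.2 ∧ p.1 ≠ p.2) := by
      intro p hp
      simp only [Finset.mem_filter, Finset.mem_union, Finset.mem_image, Finset.mem_product] at hp ⊢
      by_cases h : p.1 = p.2
      · left
        exact ⟨p.1, hp.1.1, Prod.ext rfl h⟩
      · right
        exact ⟨hp.1, hp.2, h⟩
    refine (Finset.card_le_card hsub).trans ((Finset.card_union_le _ _).trans ?_)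
    exact Nat.add_le_add_right Finset.card_image_le _
  -- off diagonal
  have off : ∑ q ∈ Y ×ˢ Y',
      ((F q ×ˢ F q).filter (fun p => cell q p.1 = cell q p.2 ∧ p.1 ≠ p.2)).card ≤
      2 * ((n * B) * (n * B)) := by
    set S : Finset ((ℝ × ℝ) × (ℝ × ℝ)) := ((Y ×ˢ Y') ×ˢ (X ×ˢ X)).filter
      (fun s => (s.2.1 ∈ F s.1 ∧ s.2.2 ∈ F s.1) ∧ cell s.1 s.2.1 = cell s.1 s.2.2 ∧ s.2.1 ≠ s.2.2)
      with hS
    have hSc : ∑ q ∈ Y ×ˢ Y',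
        ((F q ×ˢ F q).filter (fun p => cell q p.1 = cell q p.2 ∧ p.1 ≠ p.2)).card = S.card := by
      rw [Finset.card_eq_sum_card_fiberwise (s := S) (f := Prod.fst) (t := Y ×ˢ Y')]
      · apply Finset.sum_congr rfl
        intro q hq
        symm
        apply Finset.card_bij (fun s _ => s.2)
        · intro s hs
          simp only [hS, Finset.mem_filter, Finset.mem_product] at hs ⊢
          obtain ⟨⟨h1, h2, h3⟩, rfl⟩ := hs
          exact ⟨h2, h3⟩
        · intro s hs t ht hst
          simp only [Finset.mem_filter] at hs ht
          exact Prod.ext (hs.2.trans ht.2.symm) hst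
        · intro p hp
          refine ⟨(q, p), ?_, rfl⟩
          simp only [hS, Finset.mem_filter, Finset.mem_product] at hp hq ⊢
          exact ⟨⟨⟨hq, ((hFmem _ _).mp hp.1.1).1, ((hFmem _ _).mp hp.1.2).1⟩, hp.1, hp.2⟩, trivial⟩
      · intro s hs
        rw [Finset.mem_coe] at hs ⊢
        rw [hS, Finset.mem_filter, Finset.mem_product] at hs
        exact hs.1.1
    rw [hSc]
    set T := ((C ×ˢ C).filter (fun p => β p.1 = β p.2)) ×ˢ
      ((C' ×ˢ C').filter (fun p => β' p.1 = β' p.2)) with hT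
    have hTc : T.card ≤ (n * B) * (n * B) := by
      rw [hT, Finset.card_product]
      exact Nat.mul_le_mul (hβc.trans (Nat.mul_le_mul_right _ hC))
        (hβc'.trans (Nat.mul_le_mul_right _ hC'))
    set Φ : (ℝ × ℝ) × (ℝ × ℝ) → (ℝ × ℝ) × (ℝ × ℝ) := fun s =>
      ((f s.2.1 s.1.1, f s.2.2 s.1.1), (f' s.2.1 s.1.2, f' s.2.2 s.1.2)) with hΦ
    have hSmem : ∀ s ∈ S, (s.1.1 ∈ Y ∧ s.1.2 ∈ Y' ∧ s.2.1 ∈ X ∧ s.2.2 ∈ X) ∧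
        (G s.2.1 s.1.1 ∧ G s.2.2 s.1.1 ∧ G' s.2.1 s.1.2 ∧ G' s.2.2 s.1.2) ∧
        cell s.1 s.2.1 = cell s.1 s.2.2 ∧ s.2.1 ≠ s.2.2 := by
      intro s hs
      simp only [hS, Finset.mem_filter, Finset.mem_product, hFmem] at hs
      tauto
    have hmaps : ∀ s ∈ S, Φ s ∈ T := by
      intro s hs
      obtain ⟨⟨h1, h2, h3, h4⟩, ⟨g1, g2, g3, g4⟩, hc, _⟩ := hSmem s hs
      simp only [hT, hΦ, Finset.mem_product, Finset.mem_filter]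
      simp only [hcell, Prod.mk.injEq] at hc
      exact ⟨⟨⟨(hf _ h3 _ h1 g1).1, (hf _ h4 _ h1 g2).1⟩, hc.1⟩,
        ⟨(hf' _ h3 _ h2 g3).1, (hf' _ h4 _ h2 g4).1⟩, hc.2⟩
    have := Finset.card_le_mul_card_image_of_maps_to hmaps 2 (by
      intro b hb
      simp only [hT, Finset.mem_product, Finset.mem_filter] at hb
      by_cases hne : (S.filter (fun s => Φ s = b)).Nonempty
      · obtain ⟨s, hs⟩ := hne
        rw [Finset.mem_filter] at hs
        obtain ⟨⟨h1, h2', h3, h4⟩, ⟨g1, g2, g3, g4⟩, hc, hx⟩ := hSmem s hs.1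
        have e := hs.2
        have e1 : b.1.1 ≠ b.1.2 := by
          rw [← e]
          intro he
          simp only [hΦ] at he
          have := (hΔ _ h1).2 _ h3 _ h4 g1 g2
          rw [he, sub_self, zero_mul] at this
          exact mul_ne_zero (hΔ _ h1).1 (sub_ne_zero.mpr hx) this.symm
        have e2 : b.2.1 ≠ b.2.2 := by
          rw [← e]
          intro he
          simp only [hΦ] at he
          have := (hΔ' _ h2').2 _ h3 _ h4 g3 g4
          rw [he, sub_self, zero_mul] at this
          exact mul_ne_zero (hΔ' _ h2').1 (sub_ne_zero.mpr hx) this.symm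
        apply h2 b.1.1 hb.1.1.1 b.1.2 hb.1.1.2 e1 b.2.1 hb.2.1.1 b.2.2 hb.2.1.2 e2
        intro t ht
        rw [Finset.mem_filter] at ht
        obtain ⟨k1, k2, k3, k4⟩ := hSmem t ht.1
        refine ⟨k1, k2, ?_⟩
        rw [← ht.2]
        exact ⟨rfl, rfl, rfl, rfl⟩
      · rw [Finset.not_nonempty_iff_eq_empty] at hne
        rw [hne]; simp)
    exact this.trans (Nat.mul_le_mul_left 2 hTc)
  calc (∑ q ∈ Y ×ˢ Y', (F q).card) ^ 2
      ≤ (Y ×ˢ Y').card * ∑ q ∈ Y ×ˢ Y', (F q).card ^ 2 := sq_sum_le_card_mul_sum_sq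
    _ ≤ (n * n) * ∑ q ∈ Y ×ˢ Y', (F q).card ^ 2 := by
        apply Nat.mul_le_mul_right
        rw [Finset.card_product]
        exact Nat.mul_le_mul hY hY'
    _ ≤ _ := by
        apply Nat.mul_le_mul_left
        calc ∑ q ∈ Y ×ˢ Y', (F q).card ^ 2
            ≤ ∑ q ∈ Y ×ˢ Y', 8 * B *
              ((F q).card +
                ((F q ×ˢ F q).filter (fun p => cell q p.1 = cell q p.2 ∧ p.1 ≠ p.2)).card) :=
              Finset.sum_le_sum (fun q hq => (low q hq).trans (Nat.mul_le_mul_left _ (split q)))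
          _ = 8 * B * (∑ q ∈ Y ×ˢ Y', (F q).card + ∑ q ∈ Y ×ˢ Y',
              ((F q ×ˢ F q).filter (fun p => cell q p.1 = cell q p.2 ∧ p.1 ≠ p.2)).card) := by
              rw [← Finset.mul_sum, Finset.sum_add_distrib]
          _ ≤ _ := by
              apply Nat.mul_le_mul_left
              exact Nat.add_le_add_left off _

end OrdLines


namespace OrdLines

/-- Collinearity of the point `x` on the horizontal axis, the point with abscissa `y` on the line
`S₁, T₁` and the point with abscissa `c` on the line `S₂, T₂`. -/
def Rel (S₁ T₁ S₂ T₂ x y c : ℝ) : Prop :=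
  (y - x) * (S₂ * c + T₂) = (c - x) * (S₁ * y + T₁)

/-- Non-degeneracy: no point is on two of the three lines. -/
structure Nice (S₁ T₁ S₂ T₂ : ℝ) (X Y C : Finset ℝ) : Prop where
  x1 : ∀ x ∈ X, S₁ * x + T₁ ≠ 0
  x2 : ∀ x ∈ X, S₂ * x + T₂ ≠ 0
  y1 : ∀ y ∈ Y, S₁ * y + T₁ ≠ 0
  y2 : ∀ y ∈ Y, S₁ * y + T₁ ≠ S₂ * y + T₂
  c1 : ∀ c ∈ C, S₂ * c + T₂ ≠ 0
  c2 : ∀ c ∈ C, S₁ * c + T₁ ≠ S₂ * c + T₂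

lemma quad_roots (q0 q1 q2 : ℝ) (S : Finset ℝ) (h : ∀ x ∈ S, q0 + q1 * x + q2 * x ^ 2 = 0)
    (hS : 2 < S.card) : q0 = 0 ∧ q1 = 0 ∧ q2 = 0 := by
  obtain ⟨a, b, c, ha, hb, hc, hab, hac, hbc⟩ := Finset.two_lt_card_iff.mp hS
  have h1 := h a ha
  have h2 := h b hb
  have h3 := h c hc
  have e1 : q1 + q2 * (a + b) = 0 := by
    apply mul_left_cancel₀ (sub_ne_zero.mpr hab)
    linear_combination h1 - h2
  have e2 : q1 + q2 * (a + c) = 0 := by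
    apply mul_left_cancel₀ (sub_ne_zero.mpr hac)
    linear_combination h1 - h3
  have e3 : q2 = 0 := by
    apply mul_left_cancel₀ (sub_ne_zero.mpr hbc)
    linear_combination e1 - e2
  have e4 : q1 = 0 := by rw [e3] at e1; linarith
  exact ⟨by rw [e3, e4] at h1; linarith, e4, e3⟩

section
variable {S₁ T₁ S₂ T₂ : ℝ}

lemma Rel.den_ne {x y c : ℝ} (h : Rel S₁ T₁ S₂ T₂ x y c) (hx : S₂ * x + T₂ ≠ 0)
    (hy : S₁ * y + T₁ ≠ 0) : (S₁ * y + T₁) - (y - x) * S₂ ≠ 0 := by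
  intro h0
  unfold Rel at h
  have h1 : (y - x) * (S₂ * x + T₂) = 0 := by linear_combination h + (c - x) * h0
  rcases mul_eq_zero.mp h1 with h2 | h2
  · apply hy
    linear_combination h0 + S₂ * h2
  · exact hx h2

lemma Rel.eq_f {x y c : ℝ} (h : Rel S₁ T₁ S₂ T₂ x y c) (hx : S₂ * x + T₂ ≠ 0)
    (hy : S₁ * y + T₁ ≠ 0) :
    (x * (S₁ * y + T₁) + (y - x) * T₂) / ((S₁ * y + T₁) - (y - x) * S₂) = c := by
  have := h.den_ne hx hy
  unfold Rel at h
  rw [div_eq_iff this]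
  linear_combination h

lemma Rel.y_unique {x y y' c : ℝ} (h : Rel S₁ T₁ S₂ T₂ x y c) (h' : Rel S₁ T₁ S₂ T₂ x y' c)
    (hx : S₁ * x + T₁ ≠ 0) (hc : S₂ * c + T₂ ≠ 0) : y = y' := by
  unfold Rel at h h'
  by_contra hne
  have h1 : (S₂ * c + T₂) - (c - x) * S₁ = 0 := by
    apply mul_left_cancel₀ (sub_ne_zero.mpr hne)
    linear_combination h - h'
  have h2 : (c - x) * (S₁ * x + T₁) = 0 := by linear_combination -h + (y - x) * h1
  rcases mul_eq_zero.mp h2 with h3 | h3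
  · apply hc
    linear_combination h1 + S₁ * h3
  · exact hx h3

lemma Rel.x_unique {x x' y c : ℝ} (h : Rel S₁ T₁ S₂ T₂ x y c) (h' : Rel S₁ T₁ S₂ T₂ x' y c)
    (hy : S₁ * y + T₁ ≠ 0) (hy2 : S₁ * y + T₁ ≠ S₂ * y + T₂) : x = x' := by
  unfold Rel at h h'
  by_contra hne
  have h1 : (S₁ * y + T₁) - (S₂ * c + T₂) = 0 := by
    apply mul_left_cancel₀ (sub_ne_zero.mpr hne)
    linear_combination h - h'
  have h2 : (y - c) * (S₁ * y + T₁) = 0 := by linear_combination h + (y - x) * h1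
  rcases mul_eq_zero.mp h2 with h3 | h3
  · apply hy2
    linear_combination h1 - S₂ * h3
  · exact hy h3

lemma Rel.elim {x₁ x₂ y c₁ c₂ : ℝ} (h₁ : Rel S₁ T₁ S₂ T₂ x₁ y c₁) (h₂ : Rel S₁ T₁ S₂ T₂ x₂ y c₂) :
    x₂ * ((S₂ * c₂ + T₂) * ((S₂ * c₁ + T₂) - (S₁ * c₁ + T₁)) +
        (S₁ * x₁ + T₁) * (S₂ * (c₂ - c₁))) =
      (S₂ * c₂ + T₂) * ((S₂ * c₁ + T₂) - (S₁ * c₁ + T₁)) * x₁ +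
        (S₁ * x₁ + T₁) * (T₂ * (c₁ - c₂)) := by
  unfold Rel at h₁ h₂
  linear_combination ((S₂ * c₂ + T₂) - (c₂ - x₂) * S₁) * h₁ - ((S₂ * c₁ + T₂) - (c₁ - x₁) * S₁) * h₂

end

lemma two_bound (S₁ T₁ S₂ T₂ S₃ T₃ S₄ T₄ : ℝ) (h13 : S₁ * T₃ - S₃ * T₁ ≠ 0)
    (h14 : S₁ * T₄ - S₄ * T₁ ≠ 0) (X Y C Y' C' : Finset ℝ) (hN : Nice S₁ T₁ S₂ T₂ X Y C)
    (hN' : Nice S₃ T₃ S₄ T₄ X Y' C') (c₁ c₂ c₁' c₂' : ℝ) (hc₁ : c₁ ∈ C) (hc₂ : c₂ ∈ C)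
    (hc₁' : c₁' ∈ C') (hne' : c₁' ≠ c₂')
    (S : Finset ((ℝ × ℝ) × (ℝ × ℝ)))
    (hS : ∀ s ∈ S, (s.1.1 ∈ Y ∧ s.1.2 ∈ Y' ∧ s.2.1 ∈ X ∧ s.2.2 ∈ X) ∧
      Rel S₁ T₁ S₂ T₂ s.2.1 s.1.1 c₁ ∧ Rel S₁ T₁ S₂ T₂ s.2.2 s.1.1 c₂ ∧
      Rel S₃ T₃ S₄ T₄ s.2.1 s.1.2 c₁' ∧ Rel S₃ T₃ S₄ T₄ s.2.2 s.1.2 c₂') :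
    S.card ≤ 2 := by
  classical
  by_contra hcon
  push Not at hcon
  have hinj : Set.InjOn (fun s : (ℝ × ℝ) × (ℝ × ℝ) => s.2.1) (S : Set _) := by
    intro s hs t ht hst
    simp only at hst
    obtain ⟨⟨m1, m2, m3, m4⟩, r1, r2, r3, r4⟩ := hS s hs
    obtain ⟨⟨n1, n2, n3, n4⟩, u1, u2, u3, u4⟩ := hS t ht
    rw [hst] at r1 r3
    have e1 := r1.y_unique u1 (hN.x1 _ n3) (hN.c1 _ hc₁)
    have e2 := r3.y_unique u3 (hN'.x1 _ n3) (hN'.c1 _ hc₁')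
    rw [e1] at r2
    have e3 := r2.x_unique u2 (hN.y1 _ n1) (hN.y2 _ n1)
    exact Prod.ext (Prod.ext e1 e2) (Prod.ext hst e3)
  have hcard := Finset.card_image_of_injOn hinj
  set α := (S₂ * c₂ + T₂) * ((S₂ * c₁ + T₂) - (S₁ * c₁ + T₁)) with hα
  set α' := (S₄ * c₂' + T₄) * ((S₄ * c₁' + T₄) - (S₃ * c₁' + T₃)) with hα'
  set h := S₂ * (c₂ - c₁) with hh
  set h' := S₄ * (c₂' - c₁') with hh'
  set g := T₂ * (c₁ - c₂) with hg
  set g' := T₄ * (c₁' - c₂') with hg'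
  have hα0 : α ≠ 0 := mul_ne_zero (hN.c1 _ hc₂) (sub_ne_zero.mpr (hN.c2 _ hc₁).symm)
  -- (αx + (S₁x+T₁)g)(α' + (S₃x+T₃)h') - (α'x + (S₃x+T₃)g')(α + (S₁x+T₁)h)
  obtain ⟨z0, z1, z2⟩ := quad_roots
    (T₁ * g * (α' + T₃ * h') - T₃ * g' * (α + T₁ * h))
    ((α + S₁ * g) * (α' + T₃ * h') + T₁ * g * (S₃ * h') - (α' + S₃ * g') * (α + T₁ * h)
      - T₃ * g' * (S₁ * h))
    ((α + S₁ * g) * (S₃ * h') - (α' + S₃ * g') * (S₁ * h))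
    (S.image (fun s : (ℝ × ℝ) × (ℝ × ℝ) => s.2.1)) (by
      intro x hx
      rw [Finset.mem_image] at hx
      obtain ⟨s, hs, rfl⟩ := hx
      obtain ⟨-, r1, r2, r3, r4⟩ := hS s hs
      have e1 := r1.elim r2
      have e2 := r3.elim r4
      rw [← hα, ← hh, ← hg] at e1
      rw [← hα', ← hh', ← hg'] at e2
      linear_combination -(α' + (S₃ * s.2.1 + T₃) * h') * e1 + (α + (S₁ * s.2.1 + T₁) * h) * e2)
    (by rw [hcard]; exact hcon)
  have key : α * (S₁ * T₃ - S₃ * T₁) * ((c₁' - c₂') * (S₁ * T₄ - S₄ * T₁)) = 0 := by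
    have e : α * (S₁ * T₃ - S₃ * T₁) * (S₁ * g' + T₁ * h') = 0 := by
      linear_combination -(S₁ ^ 2) * z0 + S₁ * T₁ * z1 - T₁ ^ 2 * z2
    rw [hg', hh'] at e
    linear_combination e
  exact mul_ne_zero (mul_ne_zero hα0 h13) (mul_ne_zero (sub_ne_zero.mpr hne') h14) key

/-- The sum-product type estimate. -/
lemma sum_product (n B : ℕ) (S₁ T₁ S₂ T₂ S₃ T₃ S₄ T₄ : ℝ) (h13 : S₁ * T₃ - S₃ * T₁ ≠ 0)
    (h14 : S₁ * T₄ - S₄ * T₁ ≠ 0) (X Y C Y' C' : Finset ℝ) (hN : Nice S₁ T₁ S₂ T₂ X Y C)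
    (hN' : Nice S₃ T₃ S₄ T₄ X Y' C') (hX : X.card ≤ n) (hY : Y.card ≤ n) (hY' : Y'.card ≤ n)
    (hC : C.card ≤ n) (hC' : C'.card ≤ n) (hB0 : 0 < B) (hB : n < B * B) (hB4 : B * B ≤ 4 * n)
    (D : ℕ)
    (hD : ∀ x ∈ X, ∃ Z ⊆ Y, D ≤ Z.card ∧ ∀ y ∈ Z, ∃ c ∈ C, Rel S₁ T₁ S₂ T₂ x y c)
    (hD' : ∀ x ∈ X, ∃ Z ⊆ Y', D ≤ Z.card ∧ ∀ y ∈ Z, ∃ c ∈ C', Rel S₃ T₃ S₄ T₄ x y c) :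
    (X.card * (D * D)) ^ 2 ≤ 72 * B * n ^ 5 := by
  classical
  have main := incidence n B X Y Y' C C' hY hY' hC hC' hB0 hB
    (fun x y => (x * (S₁ * y + T₁) + (y - x) * T₂) / ((S₁ * y + T₁) - (y - x) * S₂))
    (fun x y => (x * (S₃ * y + T₃) + (y - x) * T₄) / ((S₃ * y + T₃) - (y - x) * S₄))
    (fun x y => (S₁ * y + T₁) - (y - x) * S₂)
    (fun x y => (S₃ * y + T₃) - (y - x) * S₄)
    (fun y => (S₁ * y + T₁) * ((S₁ * y + T₁) - (S₂ * y + T₂)))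
    (fun y => (S₃ * y + T₃) * ((S₃ * y + T₃) - (S₄ * y + T₄)))
    (fun x y => ∃ c ∈ C, Rel S₁ T₁ S₂ T₂ x y c)
    (fun x y => ∃ c ∈ C', Rel S₃ T₃ S₄ T₄ x y c)
    (by
      rintro x hx y hy ⟨c, hc, hr⟩
      rw [hr.eq_f (hN.x2 x hx) (hN.y1 y hy)]
      exact ⟨hc, hr.den_ne (hN.x2 x hx) (hN.y1 y hy)⟩)
    (by
      rintro x hx y hy ⟨c, hc, hr⟩
      rw [hr.eq_f (hN'.x2 x hx) (hN'.y1 y hy)]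
      exact ⟨hc, hr.den_ne (hN'.x2 x hx) (hN'.y1 y hy)⟩)
    (by
      intro y hy
      refine ⟨mul_ne_zero (hN.y1 y hy) (sub_ne_zero.mpr (hN.y2 y hy)), ?_⟩
      rintro x₁ hx₁ x₂ hx₂ ⟨c₁, hc₁, r₁⟩ ⟨c₂, hc₂, r₂⟩
      have d1 := r₁.den_ne (hN.x2 _ hx₁) (hN.y1 _ hy)
      have d2 := r₂.den_ne (hN.x2 _ hx₂) (hN.y1 _ hy)
      rw [div_sub_div _ _ d1 d2, div_mul_cancel₀ _ (mul_ne_zero d1 d2)]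
      ring)
    (by
      intro y hy
      refine ⟨mul_ne_zero (hN'.y1 y hy) (sub_ne_zero.mpr (hN'.y2 y hy)), ?_⟩
      rintro x₁ hx₁ x₂ hx₂ ⟨c₁, hc₁, r₁⟩ ⟨c₂, hc₂, r₂⟩
      have d1 := r₁.den_ne (hN'.x2 _ hx₁) (hN'.y1 _ hy)
      have d2 := r₂.den_ne (hN'.x2 _ hx₂) (hN'.y1 _ hy)
      rw [div_sub_div _ _ d1 d2, div_mul_cancel₀ _ (mul_ne_zero d1 d2)]
      ring)
    (by
      intro c₁ hc₁ c₂ hc₂ _ c₁' hc₁' c₂' hc₂' hne' S hS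
      apply two_bound S₁ T₁ S₂ T₂ S₃ T₃ S₄ T₄ h13 h14 X Y C Y' C' hN hN' c₁ c₂ c₁' c₂'
        hc₁ hc₂ hc₁' hne' S
      intro s hs
      obtain ⟨⟨m1, m2, m3, m4⟩, ⟨⟨k1, _, g1⟩, ⟨k2, _, g2⟩, ⟨k3, _, g3⟩, ⟨k4, _, g4⟩⟩,
        e1, e2, e3, e4⟩ := hS s hs
      refine ⟨⟨m1, m2, m3, m4⟩, ?_, ?_, ?_, ?_⟩
      · rw [← e1, g1.eq_f (hN.x2 _ m3) (hN.y1 _ m1)]; exact g1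
      · rw [← e2, g2.eq_f (hN.x2 _ m4) (hN.y1 _ m1)]; exact g2
      · rw [← e3, g3.eq_f (hN'.x2 _ m3) (hN'.y1 _ m2)]; exact g3
      · rw [← e4, g4.eq_f (hN'.x2 _ m4) (hN'.y1 _ m2)]; exact g4)
  set Q := ∑ q ∈ Y ×ˢ Y', (X.filter (fun x => (∃ c ∈ C, Rel S₁ T₁ S₂ T₂ x q.1 c) ∧
    (∃ c ∈ C', Rel S₃ T₃ S₄ T₄ x q.2 c))).card with hQ
  have hQn : Q ≤ n ^ 3 := by
    calc Q ≤ ∑ q ∈ Y ×ˢ Y', n :=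
          Finset.sum_le_sum (fun q _ => (Finset.card_filter_le _ _).trans hX)
      _ = (Y.card * Y'.card) * n := by simp [Finset.card_product]
      _ ≤ (n * n) * n := Nat.mul_le_mul_right _ (Nat.mul_le_mul hY hY')
      _ = n ^ 3 := by ring
  have hQl : X.card * (D * D) ≤ Q := by
    have e : Q = ∑ x ∈ X, ((Y ×ˢ Y').filter (fun q => (∃ c ∈ C, Rel S₁ T₁ S₂ T₂ x q.1 c) ∧
        (∃ c ∈ C', Rel S₃ T₃ S₄ T₄ x q.2 c))).card := by
      rw [hQ]
      simp only [Finset.card_filter]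
      exact Finset.sum_comm
    rw [e, ← smul_eq_mul, ← Finset.sum_const]
    apply Finset.sum_le_sum
    intro x hx
    obtain ⟨Z, hZ, hDZ, hz⟩ := hD x hx
    obtain ⟨Z', hZ', hDZ', hz'⟩ := hD' x hx
    calc D * D ≤ Z.card * Z'.card := Nat.mul_le_mul hDZ hDZ'
      _ = (Z ×ˢ Z').card := (Finset.card_product _ _).symm
      _ ≤ _ := by
        apply Finset.card_le_card
        intro q hq
        rw [Finset.mem_product] at hq
        rw [Finset.mem_filter, Finset.mem_product]
        exact ⟨⟨hZ hq.1, hZ' hq.2⟩, hz _ hq.1, hz' _ hq.2⟩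
  calc (X.card * (D * D)) ^ 2 ≤ Q ^ 2 := Nat.pow_le_pow_left hQl 2
    _ ≤ (n * n) * (8 * B * (Q + 2 * ((n * B) * (n * B)))) := main
    _ ≤ (n * n) * (8 * B * (n ^ 3 + 2 * (n * n * (4 * n)))) := by
        have : (n * B) * (n * B) ≤ n * n * (4 * n) := by
          calc (n * B) * (n * B) = n * n * (B * B) := by ring
            _ ≤ _ := Nat.mul_le_mul_left _ hB4
        gcongr
    _ = 72 * B * n ^ 5 := by ring

end OrdLines


namespace OrdLines

/-- The point with abscissa `x` on the line with slope `l.1` and intercept `l.2`. -/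
def pt (l : ℝ × ℝ) (x : ℝ) : ℝ × ℝ := (x, l.1 * x + l.2)

/-- Collinearity in the affine plane. -/
def Collin (a b c : ℝ × ℝ) : Prop := (b.1 - a.1) * (c.2 - a.2) = (c.1 - a.1) * (b.2 - a.2)

/-- The determinant detecting concurrency of three lines. -/
def dt (i j k : ℝ × ℝ) : ℝ := (j.1 - i.1) * (k.2 - i.2) - (k.1 - i.1) * (j.2 - i.2)

/-- Pairs of points spanning an ordinary line. -/
def IsOrd (V : Finset (ℝ × ℝ)) (a b : ℝ × ℝ) : Prop :=
  a ≠ b ∧ ∀ c ∈ V, Collin a b c → c = a ∨ c = b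

open Classical in
/-- The ordered pairs of points spanning an ordinary line. -/
noncomputable def ordPairs (V : Finset (ℝ × ℝ)) : Finset ((ℝ × ℝ) × (ℝ × ℝ)) :=
  (V ×ˢ V).filter (fun p => IsOrd V p.1 p.2)

open Classical in
/-- Abscissas of the points of `V` on `l` which are on no other line. -/
noncomputable def Aset (V L : Finset (ℝ × ℝ)) (l : ℝ × ℝ) : Finset ℝ :=
  (V.image Prod.fst).filter
    (fun x => pt l x ∈ V ∧ ∀ l' ∈ L, l' ≠ l → l'.1 * x + l'.2 ≠ l.1 * x + l.2)

lemma mem_Aset {V L : Finset (ℝ × ℝ)} {l : ℝ × ℝ} {x : ℝ} :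
    x ∈ Aset V L l ↔ pt l x ∈ V ∧ ∀ l' ∈ L, l' ≠ l → l'.1 * x + l'.2 ≠ l.1 * x + l.2 := by
  classical
  simp only [Aset, Finset.mem_filter, Finset.mem_image, and_iff_right_iff_imp]
  intro h
  exact ⟨_, h.1, rfl⟩

lemma Aset_card_le (V L : Finset (ℝ × ℝ)) (l : ℝ × ℝ) : (Aset V L l).card ≤ V.card := by
  classical
  exact (Finset.card_filter_le _ _).trans Finset.card_image_le

lemma line_eq {l l' : ℝ × ℝ} {x y : ℝ} (hxy : x ≠ y) (hx : l'.1 * x + l'.2 = l.1 * x + l.2)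
    (hy : l'.1 * y + l'.2 = l.1 * y + l.2) : l' = l := by
  have h1 : l'.1 = l.1 := by
    apply mul_left_cancel₀ (sub_ne_zero.mpr hxy)
    linear_combination hx - hy
  have h2 : l'.2 = l.2 := by rw [h1] at hx; linarith
  exact Prod.ext h1 h2

open Classical in
lemma Aset_card (V L : Finset (ℝ × ℝ)) (l : ℝ × ℝ) :
    (V.filter (fun v => v.2 = l.1 * v.1 + l.2)).card ≤ (Aset V L l).card + L.card := by
  set W := V.filter (fun v => v.2 = l.1 * v.1 + l.2) with hW
  have h1 := Finset.card_filter_add_card_filter_not (s := W) (fun v => v.1 ∈ Aset V L l)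
  have hWinj : Set.InjOn Prod.fst (W : Set (ℝ × ℝ)) := by
    intro v hv w hw h
    rw [Finset.mem_coe, hW, Finset.mem_filter] at hv hw
    exact Prod.ext h (by rw [hv.2, hw.2, h])
  have h2 : (W.filter (fun v => v.1 ∈ Aset V L l)).card ≤ (Aset V L l).card := by
    apply Finset.card_le_card_of_injOn Prod.fst
    · intro v hv
      rw [Finset.mem_coe, Finset.mem_filter] at hv
      exact hv.2
    · exact hWinj.mono (by intro v hv; rw [Finset.mem_coe, Finset.mem_filter] at hv; exact hv.1)
  have h3 : (W.filter (fun v => ¬ v.1 ∈ Aset V L l)).card ≤ L.card := by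
    have ex : ∀ v ∈ W.filter (fun v => ¬ v.1 ∈ Aset V L l), ∃ l' ∈ L, l' ≠ l ∧
        l'.1 * v.1 + l'.2 = l.1 * v.1 + l.2 := by
      intro v hv
      rw [Finset.mem_filter, mem_Aset, hW, Finset.mem_filter] at hv
      by_contra hc
      push Not at hc
      apply hv.2
      refine ⟨?_, hc⟩
      have : pt l v.1 = v := Prod.ext rfl hv.1.2.symm
      rw [this]; exact hv.1.1
    choose! g hg using ex
    apply Finset.card_le_card_of_injOn g
    · intro v hv
      exact (hg v hv).1
    · intro v hv w hw hvw
      by_contra hne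
      have hx : v.1 ≠ w.1 := by
        intro h
        rw [Finset.mem_coe, Finset.mem_filter] at hv hw
        exact hne (hWinj hv.1 hw.1 h)
      have e1 := (hg v hv).2.2
      have e2 := (hg w hw).2.2
      rw [← hvw] at e2
      exact (hg v hv).2.1 (line_eq hx e1 e2)
  omega

open Classical in
/-- Points of `V` lying on two lines of `L`. -/
noncomputable def vert (V L : Finset (ℝ × ℝ)) : Finset (ℝ × ℝ) :=
  V.filter (fun v => ∃ l ∈ L, ∃ l' ∈ L, l ≠ l' ∧ v.2 = l.1 * v.1 + l.2 ∧ v.2 = l'.1 * v.1 + l'.2)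

lemma vert_card (V L : Finset (ℝ × ℝ)) : (vert V L).card ≤ L.card * L.card := by
  classical
  have ex : ∀ v ∈ vert V L, ∃ q : (ℝ × ℝ) × (ℝ × ℝ), q.1 ∈ L ∧ q.2 ∈ L ∧ q.1 ≠ q.2 ∧
      v.2 = q.1.1 * v.1 + q.1.2 ∧ v.2 = q.2.1 * v.1 + q.2.2 := by
    intro v hv
    rw [vert, Finset.mem_filter] at hv
    obtain ⟨-, l, hl, l', hl', h1, h2, h3⟩ := hv
    exact ⟨(l, l'), hl, hl', h1, h2, h3⟩
  choose! g hg using ex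
  rw [← Finset.card_product]
  apply Finset.card_le_card_of_injOn g
  · intro v hv
    have := hg v hv
    rw [Finset.mem_coe, Finset.mem_product]
    exact ⟨this.1, this.2.1⟩
  · intro v hv w hw hvw
    obtain ⟨-, -, h3, h4, h5⟩ := hg v hv
    obtain ⟨-, -, k3, k4, k5⟩ := hg w hw
    rw [← hvw] at k4 k5
    have hx : v.1 = w.1 := by
      by_contra hne
      exact h3 (line_eq hne (h4.symm.trans h5) (k4.symm.trans k5))
    exact Prod.ext hx (by rw [h4, k4, hx])

open Classical in
/-- For fixed `a`, the partners `b` for which the line through them contains a vertex. -/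
noncomputable def badSet (V L : Finset (ℝ × ℝ)) (i j : ℝ × ℝ) (a : ℝ) : Finset ℝ :=
  (Aset V L j).filter (fun b => ∃ z ∈ vert V L, z ≠ pt i a ∧ Collin (pt i a) (pt j b) z)

lemma Aset_off {V L : Finset (ℝ × ℝ)} {i j : ℝ × ℝ} {a : ℝ} (ha : a ∈ Aset V L i) (hj : j ∈ L)
    (hij : i ≠ j) : j.1 * a + j.2 ≠ i.1 * a + i.2 :=
  (mem_Aset.mp ha).2 j hj (Ne.symm hij)

lemma badSet_card (V L : Finset (ℝ × ℝ)) {i j : ℝ × ℝ} {a : ℝ} (ha : a ∈ Aset V L i) (hj : j ∈ L)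
    (hij : i ≠ j) : (badSet V L i j a).card ≤ L.card * L.card := by
  classical
  refine le_trans ?_ (vert_card V L)
  have ex : ∀ b ∈ badSet V L i j a, ∃ z ∈ vert V L, z ≠ pt i a ∧ Collin (pt i a) (pt j b) z := by
    intro b hb
    rw [badSet, Finset.mem_filter] at hb
    exact hb.2
  choose! g hg using ex
  apply Finset.card_le_card_of_injOn g
  · intro b hb
    exact (hg b hb).1
  · intro b hb b' hb' h
    obtain ⟨-, h1, h2⟩ := hg b hb
    obtain ⟨-, -, k2⟩ := hg b' hb'
    rw [← h] at k2
    set z := g b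
    by_contra hne
    have hoff := Aset_off ha hj hij
    simp only [Collin, pt] at h2 k2
    -- z - a is orthogonal to both
    have e1 : (z.1 - a) * (j.1 * a + j.2 - (i.1 * a + i.2)) = 0 := by
      apply mul_left_cancel₀ (sub_ne_zero.mpr hne)
      linear_combination (b' - a) * h2 - (b - a) * k2
    have e2 : z.1 = a := by
      rcases mul_eq_zero.mp e1 with e | e
      · linarith
      · exact absurd (sub_eq_zero.mp e) hoff
    rw [e2] at h2 k2
    have e3 : z.2 = i.1 * a + i.2 := by
      have : z.2 - (i.1 * a + i.2) = 0 := by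
        apply mul_left_cancel₀ (sub_ne_zero.mpr hne)
        linear_combination h2 - k2
      linarith
    exact h1 (Prod.ext e2 e3)

/-- A pair of points is ordinary, or aligned with a vertex, or aligned with a third point. -/
lemma trichotomy (V L : Finset (ℝ × ℝ)) (hcov : ∀ v ∈ V, ∃ l ∈ L, v.2 = l.1 * v.1 + l.2)
    {i j : ℝ × ℝ} (hi : i ∈ L) (hj : j ∈ L) (hij : i ≠ j) {a b : ℝ} (ha : a ∈ Aset V L i)
    (hb : b ∈ Aset V L j) :
    (pt i a, pt j b) ∈ ordPairs V ∨ b ∈ badSet V L i j a ∨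
      ∃ k ∈ L, k ≠ i ∧ k ≠ j ∧ ∃ c ∈ Aset V L k, Collin (pt i a) (pt j b) (pt k c) := by
  classical
  by_cases hord : (pt i a, pt j b) ∈ ordPairs V
  · exact Or.inl hord
  right
  have hoffa := Aset_off ha hj hij
  have hoffb := Aset_off hb hi hij.symm
  have hne : pt i a ≠ pt j b := by
    intro h
    have h1 : a = b := congrArg Prod.fst h
    have h2 : i.1 * a + i.2 = j.1 * b + j.2 := congrArg Prod.snd h
    rw [← h1] at h2
    exact hoffa h2.symm
  rw [ordPairs, Finset.mem_filter, Finset.mem_product] at hord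
  simp only [IsOrd, (mem_Aset.mp ha).1, (mem_Aset.mp hb).1, and_self, true_and, hne, ne_eq,
    not_false_eq_true] at hord
  push Not at hord
  obtain ⟨v, hv, hcol, hva, hvb⟩ := hord
  by_cases hvert : v ∈ vert V L
  · left
    rw [badSet, Finset.mem_filter]
    exact ⟨hb, v, hvert, hva, hcol⟩
  right
  obtain ⟨k, hk, hvk⟩ := hcov v hv
  have hpt : pt k v.1 = v := Prod.ext rfl hvk.symm
  have hvA : v.1 ∈ Aset V L k := by
    rw [mem_Aset]
    refine ⟨by rw [hpt]; exact hv, ?_⟩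
    intro l' hl' hne' h
    apply hvert
    rw [vert, Finset.mem_filter]
    exact ⟨hv, k, hk, l', hl', hne'.symm, hvk, by rw [h]; exact hvk⟩
  refine ⟨k, hk, ?_, ?_, v.1, hvA, by rw [hpt]; exact hcol⟩
  · rintro rfl
    have h1 : v.1 ≠ a := by
      intro h
      exact hva (by rw [← hpt, h])
    simp only [Collin, pt] at hcol
    rw [hvk] at hcol
    apply hoffb
    apply mul_left_cancel₀ (sub_ne_zero.mpr h1)
    linear_combination hcol
  · rintro rfl
    have h1 : v.1 ≠ b := by
      intro h
      exact hvb (by rw [← hpt, h])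
    simp only [Collin, pt] at hcol
    rw [hvk] at hcol
    apply hoffa
    apply mul_left_cancel₀ (sub_ne_zero.mpr h1)
    linear_combination -hcol

lemma rel_of_collin {i j k : ℝ × ℝ} {a b c : ℝ} (h : Collin (pt i a) (pt j b) (pt k c)) :
    Rel (j.1 - i.1) (j.2 - i.2) (k.1 - i.1) (k.2 - i.2) a b c := by
  simp only [Collin, pt] at h
  unfold Rel
  linear_combination h

lemma nice_Aset (V L : Finset (ℝ × ℝ)) {i j k : ℝ × ℝ} (hi : i ∈ L) (hj : j ∈ L) (hk : k ∈ L)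
    (hij : i ≠ j) (hik : i ≠ k) (hjk : j ≠ k) (X : Finset ℝ) (hX : X ⊆ Aset V L i) :
    Nice (j.1 - i.1) (j.2 - i.2) (k.1 - i.1) (k.2 - i.2) X (Aset V L j) (Aset V L k) := by
  constructor
  · intro x hx h
    exact Aset_off (hX hx) hj hij (by linear_combination h)
  · intro x hx h
    exact Aset_off (hX hx) hk hik (by linear_combination h)
  · intro y hy h
    exact Aset_off hy hi hij.symm (by linear_combination -h)
  · intro y hy h
    exact Aset_off hy hk hjk (by linear_combination -h)
  · intro y hy h
    exact Aset_off hy hi hik.symm (by linear_combination -h)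
  · intro y hy h
    exact Aset_off hy hj hjk.symm (by linear_combination h)

open Classical in
/-- Few points have many ordinary partners on a given line. -/
lemma few_ordinary (V L : Finset (ℝ × ℝ)) (i j : ℝ × ℝ) (t : ℝ)
    (X : Finset ℝ)
    (h : ∀ a ∈ X, t ≤ (((Aset V L j).filter (fun b => (pt i a, pt j b) ∈ ordPairs V)).card : ℝ)) :
    (X.card : ℝ) * t ≤ ((ordPairs V).card : ℝ) := by
  have h1 : ∑ a ∈ X, ((Aset V L j).filter (fun b => (pt i a, pt j b) ∈ ordPairs V)).card ≤
      (ordPairs V).card := by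
    rw [← Finset.card_sigma]
    apply Finset.card_le_card_of_injOn (fun s : (Σ _ : ℝ, ℝ) => (pt i s.1, pt j s.2))
    · intro s hs
      rw [Finset.mem_coe, Finset.mem_sigma, Finset.mem_filter] at hs
      exact hs.2.2
    · intro s _ t _ hst
      have e1 : s.1 = t.1 := congrArg (fun p : (ℝ × ℝ) × (ℝ × ℝ) => p.1.1) hst
      have e2 : s.2 = t.2 := congrArg (fun p : (ℝ × ℝ) × (ℝ × ℝ) => p.2.1) hst
      exact Sigma.ext e1 (heq_of_eq e2)
  calc (X.card : ℝ) * t = ∑ a ∈ X, t := by simp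
    _ ≤ ∑ a ∈ X, (((Aset V L j).filter (fun b => (pt i a, pt j b) ∈ ordPairs V)).card : ℝ) :=
        Finset.sum_le_sum h
    _ ≤ _ := by exact_mod_cast h1

end OrdLines


namespace OrdLines

/-- The elements of `R` of sign `σ`. -/
noncomputable def cls (R : Finset ℝ) (σ : ℝ) : Finset ℝ := R.filter (fun x => 0 < σ * x)

lemma cls_card (R : Finset ℝ) (h0 : ∀ x ∈ R, x ≠ 0) :
    R.card ≤ (cls R 1).card + (cls R (-1)).card := by
  classical
  refine le_trans (Finset.card_le_card ?_) (Finset.card_union_le _ _)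
  intro x hx
  rw [Finset.mem_union, cls, cls, Finset.mem_filter, Finset.mem_filter]
  rcases lt_or_gt_of_ne (h0 x hx) with h | h
  · right; exact ⟨hx, by linarith⟩
  · left; exact ⟨hx, by linarith⟩

/-- No element of `R` completes the pair to product `-1`. -/
def Unc (R : Finset ℝ) (p : ℝ × ℝ) : Prop := ∀ c ∈ R, p.1 * p.2 * c ≠ -1

open Classical in
lemma hook3 (k : ℕ) (R₁ R₂ R₃ : Finset ℝ) (h2 : ∀ x ∈ R₂, x ≠ 0)
    (σ : ℝ) (hσ : σ = 1 ∨ σ = -1)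
    (hm2 : ∀ τ : ℝ, τ = 1 ∨ τ = -1 → (cls R₂ τ).card ≤ (cls R₁ σ).card)
    (hm3 : ∀ τ : ℝ, τ = 1 ∨ τ = -1 → (cls R₃ τ).card ≤ (cls R₁ σ).card)
    (hk : 4 * k ≤ R₂.card) :
    k ^ 2 ≤ ((R₁ ×ˢ R₂).filter (fun p => Unc R₃ p)).card := by
  have hτ : ∃ τ : ℝ, (τ = 1 ∨ τ = -1) ∧ 2 * k ≤ (cls R₂ τ).card := by
    have := cls_card R₂ h2
    by_cases h : 2 * k ≤ (cls R₂ 1).card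
    · exact ⟨1, Or.inl rfl, h⟩
    · exact ⟨-1, Or.inr rfl, by omega⟩
  obtain ⟨τ, hτ, hkτ⟩ := hτ
  have σ2 : σ * σ = 1 := by rcases hσ with h | h <;> rw [h] <;> norm_num
  have τ2 : τ * τ = 1 := by rcases hτ with h | h <;> rw [h] <;> norm_num
  have hστ : -(σ * τ) = 1 ∨ -(σ * τ) = -1 := by
    rcases hσ with h | h <;> rcases hτ with h' | h' <;> rw [h, h'] <;> norm_num
  have σ0 : σ ≠ 0 := by intro h; rw [h] at σ2; norm_num at σ2
  have τ0 : τ ≠ 0 := by intro h; rw [h] at τ2; norm_num at τ2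
  set X := (cls R₁ σ).image (fun x => σ * x) with hX
  set Y := (cls R₂ τ).image (fun x => τ * x) with hY
  set C := (cls R₃ (-(σ * τ))).image (fun x => -(σ * τ) / x) with hC
  have cX : X.card = (cls R₁ σ).card :=
    Finset.card_image_of_injective _ (mul_right_injective₀ σ0)
  have cY : Y.card = (cls R₂ τ).card :=
    Finset.card_image_of_injective _ (mul_right_injective₀ τ0)
  have cC : C.card ≤ (cls R₁ σ).card := Finset.card_image_le.trans (hm3 _ hστ)
  have pX : ∀ x ∈ X, 0 < x := by
    intro x hx
    rw [hX, Finset.mem_image] at hx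
    obtain ⟨y, hy, rfl⟩ := hx
    rw [cls, Finset.mem_filter] at hy
    exact hy.2
  have pY : ∀ x ∈ Y, 0 < x := by
    intro x hx
    rw [hY, Finset.mem_image] at hx
    obtain ⟨y, hy, rfl⟩ := hx
    rw [cls, Finset.mem_filter] at hy
    exact hy.2
  have hXY := hm2 τ hτ
  refine le_trans (hooks k X Y C pX pY (by omega) (by omega) (by omega)) ?_
  apply Finset.card_le_card_of_injOn (fun p : ℝ × ℝ => (σ * p.1, τ * p.2))
  · intro p hp
    rw [Finset.mem_coe, Finset.mem_filter, Finset.mem_product] at hp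
    obtain ⟨⟨hp1, hp2⟩, hp3⟩ := hp
    have q1 := pX _ hp1
    have q2 := pY _ hp2
    rw [hX, Finset.mem_image] at hp1
    rw [hY, Finset.mem_image] at hp2
    obtain ⟨a, ha, hap⟩ := hp1
    obtain ⟨b, hb, hbp⟩ := hp2
    have ea : σ * p.1 = a := by rw [← hap]; linear_combination a * σ2
    have eb : τ * p.2 = b := by rw [← hbp]; linear_combination b * τ2
    rw [cls, Finset.mem_filter] at ha hb
    rw [Finset.mem_coe, Finset.mem_filter, Finset.mem_product]
    unfold Unc
    dsimp only
    rw [ea, eb]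
    refine ⟨⟨ha.1, hb.1⟩, ?_⟩
    intro c hc habc
    apply hp3
    have c0 : c ≠ 0 := by rintro rfl; norm_num at habc
    rw [hC, Finset.mem_image]
    refine ⟨c, ?_, ?_⟩
    · rw [cls, Finset.mem_filter]
      refine ⟨hc, ?_⟩
      have e : p.1 * p.2 * (-(σ * τ) * c) = 1 := by
        rw [← hap, ← hbp]
        linear_combination (-a * b * c) * (σ * σ) * τ2 + (-a * b * c) * σ2 - habc
      have : 0 < p.1 * p.2 := mul_pos q1 q2
      by_contra hneg
      push Not at hneg
      nlinarith [mul_nonneg this.le (neg_nonneg.mpr hneg)]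
    · rw [div_eq_iff c0, ← hap, ← hbp]
      linear_combination -(σ * τ) * habc
  · intro p _ q _ h
    have h1 := mul_left_cancel₀ σ0 (congrArg Prod.fst h)
    have h2 := mul_left_cancel₀ τ0 (congrArg Prod.snd h)
    exact Prod.ext h1 h2

/-- The ratio coordinate on a side of a triangle. -/
noncomputable def rho (l l' l'' : ℝ × ℝ) (x : ℝ) : ℝ :=
  ((l.1 - l'.1) * x + (l.2 - l'.2)) / ((l.1 - l''.1) * x + (l.2 - l''.2))

lemma Aset_ne {V L : Finset (ℝ × ℝ)} {i j : ℝ × ℝ} {a : ℝ} (ha : a ∈ Aset V L i) (hj : j ∈ L)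
    (hij : i ≠ j) : (i.1 - j.1) * a + (i.2 - j.2) ≠ 0 := by
  intro h
  exact Aset_off ha hj hij (by linear_combination -h)

lemma rho_ne {V L : Finset (ℝ × ℝ)} {i j k : ℝ × ℝ} {a : ℝ} (ha : a ∈ Aset V L i) (hj : j ∈ L)
    (hk : k ∈ L) (hij : i ≠ j) (hik : i ≠ k) : rho i j k a ≠ 0 :=
  div_ne_zero (Aset_ne ha hj hij) (Aset_ne ha hk hik)

lemma rho_inj {V L : Finset (ℝ × ℝ)} {i j k : ℝ × ℝ} (hk : k ∈ L)
    (hik : i ≠ k) (hd : dt i j k ≠ 0) :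
    Set.InjOn (rho i j k) (Aset V L i : Set ℝ) := by
  intro a ha b hb h
  unfold rho at h
  rw [div_eq_div_iff (Aset_ne ha hk hik) (Aset_ne hb hk hik)] at h
  have : dt i j k * (a - b) = 0 := by
    unfold dt
    linear_combination h
  rcases mul_eq_zero.mp this with h | h
  · exact absurd h hd
  · linarith

lemma rho_collin {V L : Finset (ℝ × ℝ)} {i j k : ℝ × ℝ} (hi : i ∈ L) (hj : j ∈ L) (hk : k ∈ L)
    (hij : i ≠ j) (hik : i ≠ k) (hjk : j ≠ k) {a b c : ℝ} (ha : a ∈ Aset V L i)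
    (hb : b ∈ Aset V L j) (hc : c ∈ Aset V L k) (h : Collin (pt i a) (pt j b) (pt k c)) :
    rho i j k a * rho j k i b * rho k i j c = -1 := by
  have h1 := Aset_ne ha hk hik
  have h2 := Aset_ne hb hi hij.symm
  have h3 := Aset_ne hc hj hjk.symm
  unfold rho
  rw [div_mul_div_comm, div_mul_div_comm, div_eq_iff (mul_ne_zero (mul_ne_zero h1 h2) h3)]
  simp only [Collin, pt] at h
  have hd : dt i j k = (j.1 - i.1) * (k.2 - i.2) - (k.1 - i.1) * (j.2 - i.2) := rfl
  first
  | linear_combination ((j.1 - i.1) * (k.2 - i.2) - (k.1 - i.1) * (j.2 - i.2)) * h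
  | linear_combination -((j.1 - i.1) * (k.2 - i.2) - (k.1 - i.1) * (j.2 - i.2)) * h

end OrdLines


namespace OrdLines

lemma tri_side (V L : Finset (ℝ × ℝ)) (hcov : ∀ v ∈ V, ∃ l ∈ L, v.2 = l.1 * v.1 + l.2)
    {i j k : ℝ × ℝ} (hi : i ∈ L) (hj : j ∈ L) (hk : k ∈ L)
    (hij : i ≠ j) (hik : i ≠ k) (hjk : j ≠ k) (hL : ∀ l ∈ L, l = i ∨ l = j ∨ l = k)
    (s : ℕ) (σ : ℝ) (hσ : σ = 1 ∨ σ = -1)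
    (hm2 : ∀ τ : ℝ, τ = 1 ∨ τ = -1 → (cls ((Aset V L j).image (rho j k i)) τ).card ≤
      (cls ((Aset V L i).image (rho i j k)) σ).card)
    (hm3 : ∀ τ : ℝ, τ = 1 ∨ τ = -1 → (cls ((Aset V L k).image (rho k i j)) τ).card ≤
      (cls ((Aset V L i).image (rho i j k)) σ).card)
    (hd : dt i j k ≠ 0) (hs : 4 * s ≤ (Aset V L j).card) :
    s ^ 2 ≤ (ordPairs V).card + V.card * (L.card * L.card) := by
  classical
  have hd' : dt j k i ≠ 0 := by
    intro h; apply hd; rw [← h]; unfold dt; ring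
  have hcard : ((Aset V L j).image (rho j k i)).card = (Aset V L j).card :=
    Finset.card_image_of_injOn (rho_inj hi hij.symm hd')
  have h1 := hook3 s _ _ ((Aset V L k).image (rho k i j)) (by
    intro x hx
    rw [Finset.mem_image] at hx
    obtain ⟨b, hb, rfl⟩ := hx
    exact rho_ne hb hk hi hjk hij.symm) σ hσ hm2 hm3 (by rw [hcard]; exact hs)
  set F := ((((Aset V L i).image (rho i j k)) ×ˢ ((Aset V L j).image (rho j k i))).filter
    (fun p => Unc ((Aset V L k).image (rho k i j)) p)) with hF
  set G₁ := ((Aset V L i) ×ˢ (Aset V L j)).filter (fun p => (pt i p.1, pt j p.2) ∈ ordPairs V)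
    with hG₁
  set G₂ := (Aset V L i).sigma (fun a => badSet V L i j a) with hG₂
  have hsub : F ⊆ G₁.image (fun p => (rho i j k p.1, rho j k i p.2)) ∪
      G₂.image (fun p => (rho i j k p.1, rho j k i p.2)) := by
    intro p hp
    rw [hF, Finset.mem_filter, Finset.mem_product, Finset.mem_image, Finset.mem_image] at hp
    obtain ⟨⟨⟨a, ha, ha'⟩, ⟨b, hb, hb'⟩⟩, hU⟩ := hp
    rw [Finset.mem_union, Finset.mem_image, Finset.mem_image]
    rcases trichotomy V L hcov hi hj hij ha hb with h | h | ⟨l, hl, hli, hlj, c, hc, hcol⟩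
    · left
      refine ⟨(a, b), ?_, Prod.ext ha' hb'⟩
      rw [hG₁, Finset.mem_filter, Finset.mem_product]
      exact ⟨⟨ha, hb⟩, h⟩
    · right
      refine ⟨⟨a, b⟩, ?_, Prod.ext ha' hb'⟩
      rw [hG₂, Finset.mem_sigma]
      exact ⟨ha, h⟩
    · exfalso
      rcases hL l hl with e | e | e
      · exact hli e
      · exact hlj e
      · rw [e] at hc hcol
        refine hU (rho k i j c) (Finset.mem_image_of_mem _ hc) ?_
        rw [← ha', ← hb']
        exact rho_collin hi hj hk hij hik hjk ha hb hc hcol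
  have c1 : G₁.card ≤ (ordPairs V).card := by
    apply Finset.card_le_card_of_injOn (fun p => (pt i p.1, pt j p.2))
    · intro p hp
      rw [Finset.mem_coe, hG₁, Finset.mem_filter] at hp
      exact hp.2
    · intro p _ q _ h
      have e1 : p.1 = q.1 := congrArg (fun p : (ℝ × ℝ) × (ℝ × ℝ) => p.1.1) h
      have e2 : p.2 = q.2 := congrArg (fun p : (ℝ × ℝ) × (ℝ × ℝ) => p.2.1) h
      exact Prod.ext e1 e2
  have c2 : G₂.card ≤ V.card * (L.card * L.card) := by
    rw [hG₂, Finset.card_sigma]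
    calc ∑ a ∈ Aset V L i, (badSet V L i j a).card ≤ ∑ a ∈ Aset V L i, (L.card * L.card) :=
          Finset.sum_le_sum (fun a ha => badSet_card V L ha hj hij)
      _ = (Aset V L i).card * (L.card * L.card) := by rw [Finset.sum_const, smul_eq_mul]
      _ ≤ _ := Nat.mul_le_mul_right _ (Aset_card_le V L i)
  calc s ^ 2 ≤ F.card := h1
    _ ≤ _ := Finset.card_le_card hsub
    _ ≤ _ := Finset.card_union_le _ _
    _ ≤ _ := Nat.add_le_add (Finset.card_image_le.trans c1) (Finset.card_image_le.trans c2)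

lemma sign_max (R : Finset ℝ) : ∃ σ : ℝ, (σ = 1 ∨ σ = -1) ∧
    ∀ τ : ℝ, τ = 1 ∨ τ = -1 → (cls R τ).card ≤ (cls R σ).card := by
  rcases le_total (cls R 1).card (cls R (-1)).card with h | h
  · refine ⟨-1, Or.inr rfl, ?_⟩
    rintro τ (rfl | rfl)
    · exact h
    · exact le_rfl
  · refine ⟨1, Or.inl rfl, ?_⟩
    rintro τ (rfl | rfl)
    · exact le_rfl
    · exact h

lemma triangle (V L : Finset (ℝ × ℝ)) (hcov : ∀ v ∈ V, ∃ l ∈ L, v.2 = l.1 * v.1 + l.2)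
    {i j k : ℝ × ℝ} (hi : i ∈ L) (hj : j ∈ L) (hk : k ∈ L)
    (hL : ∀ l ∈ L, l = i ∨ l = j ∨ l = k) (hd : dt i j k ≠ 0)
    (s : ℕ) (hs : ∀ l ∈ L, 4 * s ≤ (Aset V L l).card) :
    s ^ 2 ≤ (ordPairs V).card + V.card * (L.card * L.card) := by
  have hij : i ≠ j := by rintro rfl; apply hd; unfold dt; ring
  have hik : i ≠ k := by rintro rfl; apply hd; unfold dt; ring
  have hjk : j ≠ k := by rintro rfl; apply hd; unfold dt; ring
  have hd1 : dt j k i ≠ 0 := by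
    intro h; apply hd; rw [← h]; unfold dt; ring
  have hd2 : dt k i j ≠ 0 := by
    intro h; apply hd; rw [← h]; unfold dt; ring
  have hL1 : ∀ l ∈ L, l = j ∨ l = k ∨ l = i := by
    intro l hl
    rcases hL l hl with e | e | e
    · exact Or.inr (Or.inr e)
    · exact Or.inl e
    · exact Or.inr (Or.inl e)
  have hL2 : ∀ l ∈ L, l = k ∨ l = i ∨ l = j := by
    intro l hl
    rcases hL l hl with e | e | e
    · exact Or.inr (Or.inl e)
    · exact Or.inr (Or.inr e)
    · exact Or.inl e
  obtain ⟨σ₁, hσ₁, h1⟩ := sign_max ((Aset V L i).image (rho i j k))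
  obtain ⟨σ₂, hσ₂, h2⟩ := sign_max ((Aset V L j).image (rho j k i))
  obtain ⟨σ₃, hσ₃, h3⟩ := sign_max ((Aset V L k).image (rho k i j))
  have m1 : (cls ((Aset V L j).image (rho j k i)) σ₂).card ≤
        (cls ((Aset V L i).image (rho i j k)) σ₁).card →
      (cls ((Aset V L k).image (rho k i j)) σ₃).card ≤
        (cls ((Aset V L i).image (rho i j k)) σ₁).card →
      s ^ 2 ≤ (ordPairs V).card + V.card * (L.card * L.card) := fun a b =>
    tri_side V L hcov hi hj hk hij hik hjk hL s σ₁ hσ₁ (fun τ hτ => (h2 τ hτ).trans a)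
      (fun τ hτ => (h3 τ hτ).trans b) hd (hs j hj)
  have m2 : (cls ((Aset V L k).image (rho k i j)) σ₃).card ≤
        (cls ((Aset V L j).image (rho j k i)) σ₂).card →
      (cls ((Aset V L i).image (rho i j k)) σ₁).card ≤
        (cls ((Aset V L j).image (rho j k i)) σ₂).card →
      s ^ 2 ≤ (ordPairs V).card + V.card * (L.card * L.card) := fun a b =>
    tri_side V L hcov hj hk hi hjk hij.symm hik.symm hL1 s
      σ₂ hσ₂ (fun τ hτ => (h3 τ hτ).trans a)
      (fun τ hτ => (h1 τ hτ).trans b) hd1 (hs k hk)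
  have m3 : (cls ((Aset V L i).image (rho i j k)) σ₁).card ≤
        (cls ((Aset V L k).image (rho k i j)) σ₃).card →
      (cls ((Aset V L j).image (rho j k i)) σ₂).card ≤
        (cls ((Aset V L k).image (rho k i j)) σ₃).card →
      s ^ 2 ≤ (ordPairs V).card + V.card * (L.card * L.card) := fun a b =>
    tri_side V L hcov hk hi hj hik.symm hjk.symm hij hL2 s
      σ₃ hσ₃ (fun τ hτ => (h1 τ hτ).trans a)
      (fun τ hτ => (h2 τ hτ).trans b) hd2 (hs i hi)
  rcases le_total (cls ((Aset V L i).image (rho i j k)) σ₁).card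
    (cls ((Aset V L j).image (rho j k i)) σ₂).card with a | a
  · rcases le_total (cls ((Aset V L j).image (rho j k i)) σ₂).card
      (cls ((Aset V L k).image (rho k i j)) σ₃).card with b | b
    · exact m3 (a.trans b) b
    · exact m2 b a
  · rcases le_total (cls ((Aset V L i).image (rho i j k)) σ₁).card
      (cls ((Aset V L k).image (rho k i j)) σ₃).card with b | b
    · exact m3 b (a.trans b)
    · exact m1 a b

end OrdLines


namespace OrdLines

lemma dt_vertex {i j k l : ℝ × ℝ} (h1 : dt i j l = 0) (h2 : dt i k l = 0) (h3 : dt i j k ≠ 0) :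
    l = i := by
  unfold dt at h1 h2 h3
  have e1 : ((j.1 - i.1) * (k.2 - i.2) - (k.1 - i.1) * (j.2 - i.2)) * (l.1 - i.1) = 0 := by
    linear_combination (k.1 - i.1) * h1 - (j.1 - i.1) * h2
  have e2 : ((j.1 - i.1) * (k.2 - i.2) - (k.1 - i.1) * (j.2 - i.2)) * (l.2 - i.2) = 0 := by
    linear_combination (k.2 - i.2) * h1 - (j.2 - i.2) * h2
  have f1 := (mul_eq_zero.mp e1).resolve_left h3
  have f2 := (mul_eq_zero.mp e2).resolve_left h3
  exact Prod.ext (by linarith) (by linarith)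

open Classical in
/-- Those `b` on `j` whose line with `a` on `i` hits a point on `k`. -/
noncomputable def Zset (V L : Finset (ℝ × ℝ)) (i j k : ℝ × ℝ) (a : ℝ) : Finset ℝ :=
  (Aset V L j).filter (fun b => ∃ c ∈ Aset V L k, Collin (pt i a) (pt j b) (pt k c))

open Classical in
/-- Ordinary partners of `a` on `j`. -/
noncomputable def ordP (V L : Finset (ℝ × ℝ)) (i j : ℝ × ℝ) (a : ℝ) : Finset ℝ :=
  (Aset V L j).filter (fun b => (pt i a, pt j b) ∈ ordPairs V)

lemma exists_rich (V L : Finset (ℝ × ℝ)) (hcov : ∀ v ∈ V, ∃ l ∈ L, v.2 = l.1 * v.1 + l.2)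
    {i j : ℝ × ℝ} (hi : i ∈ L) (hj : j ∈ L) (hij : i ≠ j) {a : ℝ} (ha : a ∈ Aset V L i)
    (a0 : ℝ) (hA : a0 ≤ ((Aset V L j).card : ℝ)) (D : ℕ)
    (hD : ((L.card * L.card + L.card * D : ℕ) : ℝ) < a0 / 2)
    (hord : ((ordP V L i j a).card : ℝ) < a0 / 2) :
    ∃ k ∈ L, k ≠ i ∧ k ≠ j ∧ D ≤ (Zset V L i j k a).card := by
  classical
  by_contra hcon
  push Not at hcon
  have hsub : Aset V L j ⊆ ordP V L i j a ∪ (badSet V L i j a ∪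
      (L.filter (fun k => k ≠ i ∧ k ≠ j)).biUnion (fun k => Zset V L i j k a)) := by
    intro b hb
    rw [Finset.mem_union, Finset.mem_union, Finset.mem_biUnion]
    rcases trichotomy V L hcov hi hj hij ha hb with h | h | ⟨l, hl, hli, hlj, c, hc, hcol⟩
    · left; exact Finset.mem_filter.mpr ⟨hb, h⟩
    · right; left; exact h
    · right; right
      exact ⟨l, Finset.mem_filter.mpr ⟨hl, hli, hlj⟩, Finset.mem_filter.mpr ⟨hb, c, hc, hcol⟩⟩
  have h1 := Finset.card_le_card hsub
  have h2 := Finset.card_union_le (ordP V L i j a) (badSet V L i j a ∪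
      (L.filter (fun k => k ≠ i ∧ k ≠ j)).biUnion (fun k => Zset V L i j k a))
  have h3 := Finset.card_union_le (badSet V L i j a)
      ((L.filter (fun k => k ≠ i ∧ k ≠ j)).biUnion (fun k => Zset V L i j k a))
  have h4 : ((L.filter (fun k => k ≠ i ∧ k ≠ j)).biUnion (fun k => Zset V L i j k a)).card ≤
      L.card * D := by
    refine (Finset.card_biUnion_le_card_mul _ _ D ?_).trans
      (Nat.mul_le_mul_right _ (Finset.card_filter_le _ _))
    intro k hk
    rw [Finset.mem_filter] at hk
    exact (hcon k hk.1 hk.2.1 hk.2.2).le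
  have h5 := badSet_card V L ha hj hij
  have h6 : (Aset V L j).card ≤ (ordP V L i j a).card + (L.card * L.card + L.card * D) := by
    omega
  have h7 : ((Aset V L j).card : ℝ) ≤ ((ordP V L i j a).card : ℝ) +
      ((L.card * L.card + L.card * D : ℕ) : ℝ) := by exact_mod_cast h6
  linarith

/-- Conditions on a quadruple of lines relative to a base line. -/
def QC (i : ℝ × ℝ) (q : ((ℝ × ℝ) × (ℝ × ℝ)) × ((ℝ × ℝ) × (ℝ × ℝ))) : Prop :=
  q.1.2 ≠ i ∧ q.1.2 ≠ q.1.1 ∧ q.2.2 ≠ i ∧ q.2.2 ≠ q.2.1 ∧ dt i q.1.1 q.2.1 ≠ 0 ∧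
    dt i q.1.1 q.2.2 ≠ 0

open Classical in
/-- Points with many collinear triples for both pairs of lines. -/
noncomputable def Eset (V L : Finset (ℝ × ℝ)) (D : ℕ) (i : ℝ × ℝ)
    (q : ((ℝ × ℝ) × (ℝ × ℝ)) × ((ℝ × ℝ) × (ℝ × ℝ))) : Finset ℝ :=
  (Aset V L i).filter (fun a => QC i q ∧ D ≤ (Zset V L i q.1.1 q.1.2 a).card ∧
    D ≤ (Zset V L i q.2.1 q.2.2 a).card)

lemma Eset_bound (V L : Finset (ℝ × ℝ)) (D B : ℕ) (hB : 0 < B) (hB1 : V.card < B * B)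
    (hB2 : B * B ≤ 4 * V.card) {i : ℝ × ℝ} (hi : i ∈ L)
    (q : ((ℝ × ℝ) × (ℝ × ℝ)) × ((ℝ × ℝ) × (ℝ × ℝ))) (hq : q ∈ (L ×ˢ L) ×ˢ (L ×ˢ L)) :
    ((Eset V L D i q).card * (D * D)) ^ 2 ≤ 72 * B * V.card ^ 5 := by
  classical
  by_cases hQ : QC i q
  · simp only [Finset.mem_product] at hq
    obtain ⟨⟨hj, hk⟩, hj', hk'⟩ := hq
    have hQ' := hQ
    obtain ⟨q1, q2, q3, q4, q5, q6⟩ := hQ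
    have hij : i ≠ q.1.1 := by intro h; apply q5; rw [← h]; unfold dt; ring
    have hij' : i ≠ q.2.1 := by intro h; apply q5; rw [← h]; unfold dt; ring
    have hsub : Eset V L D i q ⊆ Aset V L i := Finset.filter_subset _ _
    refine sum_product V.card B _ _ _ _ _ _ _ _ q5 q6 (Eset V L D i q) (Aset V L q.1.1)
      (Aset V L q.1.2) (Aset V L q.2.1) (Aset V L q.2.2)
      (nice_Aset V L hi hj hk hij q1.symm q2.symm _ hsub)
      (nice_Aset V L hi hj' hk' hij' q3.symm q4.symm _ hsub)
      ((Finset.card_le_card hsub).trans (Aset_card_le V L i)) (Aset_card_le V L _)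
      (Aset_card_le V L _) (Aset_card_le V L _) (Aset_card_le V L _) hB hB1 hB2 D ?_ ?_
    · intro x hx
      refine ⟨Zset V L i q.1.1 q.1.2 x, Finset.filter_subset _ _,
        (Finset.mem_filter.mp hx).2.2.1, ?_⟩
      intro y hy
      obtain ⟨c, hc, hcol⟩ := (Finset.mem_filter.mp hy).2
      exact ⟨c, hc, rel_of_collin hcol⟩
    · intro x hx
      refine ⟨Zset V L i q.2.1 q.2.2 x, Finset.filter_subset _ _,
        (Finset.mem_filter.mp hx).2.2.2, ?_⟩
      intro y hy
      obtain ⟨c, hc, hcol⟩ := (Finset.mem_filter.mp hy).2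
      exact ⟨c, hc, rel_of_collin hcol⟩
  · have : Eset V L D i q = ∅ := by
      rw [Finset.eq_empty_iff_forall_notMem]
      intro a ha
      exact hQ (Finset.mem_filter.mp ha).2.1
    rw [this]
    simp

lemma few_bad (V L : Finset (ℝ × ℝ)) (i j : ℝ × ℝ) (a0 : ℝ) (ha0 : 0 < a0)
    (hO : 12 * ((ordPairs V).card : ℝ) ≤ a0 ^ 2) (X : Finset ℝ)
    (hX : ∀ a ∈ X, a0 / 2 ≤ ((ordP V L i j a).card : ℝ)) : (X.card : ℝ) ≤ a0 / 6 := by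
  classical
  have h := few_ordinary V L i j (a0 / 2) X (by
    intro a ha; have := hX a ha; unfold ordP at this; convert this)
  by_contra hc
  push Not at hc
  nlinarith

/-- From three poles in general position one gets a rich configuration. -/
lemma three_poles (V L : Finset (ℝ × ℝ)) (hcov : ∀ v ∈ V, ∃ l ∈ L, v.2 = l.1 * v.1 + l.2)
    (D B : ℕ) (hB : 0 < B) (hB1 : V.card < B * B) (hB2 : B * B ≤ 4 * V.card)
    (a0 : ℝ) (ha0 : 0 < a0) (hA : ∀ l ∈ L, a0 ≤ ((Aset V L l).card : ℝ))
    (hO : 12 * ((ordPairs V).card : ℝ) ≤ a0 ^ 2)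
    (hD : ((L.card * L.card + L.card * D : ℕ) : ℝ) < a0 / 2)
    {i j₁ j₂ j₃ : ℝ × ℝ} (hi : i ∈ L) (h1 : j₁ ∈ L) (h2 : j₂ ∈ L) (h3 : j₃ ∈ L)
    (d12 : dt i j₁ j₂ ≠ 0) (d13 : dt i j₁ j₃ ≠ 0) (d23 : dt i j₂ j₃ ≠ 0) :
    ∃ E : ℕ, a0 / 2 ≤ (((L.card * L.card) * (L.card * L.card) * E : ℕ) : ℝ) ∧
      (E * (D * D)) ^ 2 ≤ 72 * B * V.card ^ 5 := by
  classical
  have hi1 : i ≠ j₁ := by intro h; apply d12; rw [← h]; unfold dt; ring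
  have hi2 : i ≠ j₂ := by intro h; apply d12; rw [← h]; unfold dt; ring
  have hi3 : i ≠ j₃ := by intro h; apply d13; rw [← h]; unfold dt; ring
  have d32 : dt i j₃ j₂ ≠ 0 := by
    intro h; apply d23
    have : dt i j₂ j₃ = - dt i j₃ j₂ := by unfold dt; ring
    rw [this, h, neg_zero]
  set Q := (L ×ˢ L) ×ˢ (L ×ˢ L) with hQ
  have hne : Q.Nonempty := ⟨((i, i), (i, i)), by
    simp only [hQ, Finset.mem_product]; exact ⟨⟨hi, hi⟩, hi, hi⟩⟩
  obtain ⟨q, hq, hmax⟩ := Finset.exists_max_image Q (fun q => (Eset V L D i q).card) hne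
  refine ⟨(Eset V L D i q).card, ?_, Eset_bound V L D B hB hB1 hB2 hi q hq⟩
  set X : ℝ × ℝ → Finset ℝ := fun j =>
    (Aset V L i).filter (fun a => a0 / 2 ≤ ((ordP V L i j a).card : ℝ)) with hX
  have hXc : ∀ j, ((X j).card : ℝ) ≤ a0 / 6 := fun j =>
    few_bad V L i j a0 ha0 hO _ (fun a ha => (Finset.mem_filter.mp ha).2)
  have hsub : Aset V L i ⊆ X j₁ ∪ (X j₂ ∪ (X j₃ ∪ Q.biUnion (fun q => Eset V L D i q))) := by
    intro a ha
    simp only [Finset.mem_union, Finset.mem_biUnion]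
    by_cases g1 : a ∈ X j₁
    · exact Or.inl g1
    by_cases g2 : a ∈ X j₂
    · exact Or.inr (Or.inl g2)
    by_cases g3 : a ∈ X j₃
    · exact Or.inr (Or.inr (Or.inl g3))
    right; right; right
    have g : ∀ j, a ∉ X j → ((ordP V L i j a).card : ℝ) < a0 / 2 := by
      intro j hj
      by_contra hc
      push Not at hc
      exact hj (Finset.mem_filter.mpr ⟨ha, hc⟩)
    obtain ⟨k₁, hk₁, k1i, k1j, z1⟩ := exists_rich V L hcov hi h1 hi1 ha a0 (hA _ h1) D hD (g _ g1)
    obtain ⟨k₂, hk₂, k2i, k2j, z2⟩ := exists_rich V L hcov hi h2 hi2 ha a0 (hA _ h2) D hD (g _ g2)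
    obtain ⟨k₃, hk₃, k3i, k3j, z3⟩ := exists_rich V L hcov hi h3 hi3 ha a0 (hA _ h3) D hD (g _ g3)
    by_cases hk : dt i j₁ k₂ = 0
    · have hk' : dt i j₃ k₂ ≠ 0 := fun h => k2i (dt_vertex hk h d13)
      refine ⟨((j₃, k₃), (j₂, k₂)), ?_, ?_⟩
      · simp only [hQ, Finset.mem_product]; exact ⟨⟨h3, hk₃⟩, h2, hk₂⟩
      · exact Finset.mem_filter.mpr ⟨ha, ⟨k3i, k3j, k2i, k2j, d32, hk'⟩, z3, z2⟩
    · refine ⟨((j₁, k₁), (j₂, k₂)), ?_, ?_⟩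
      · simp only [hQ, Finset.mem_product]; exact ⟨⟨h1, hk₁⟩, h2, hk₂⟩
      · exact Finset.mem_filter.mpr ⟨ha, ⟨k1i, k1j, k2i, k2j, d12, hk⟩, z1, z2⟩
  have c0 := Finset.card_le_card hsub
  have c1 := Finset.card_union_le (X j₁) (X j₂ ∪ (X j₃ ∪ Q.biUnion (fun q => Eset V L D i q)))
  have c2 := Finset.card_union_le (X j₂) (X j₃ ∪ Q.biUnion (fun q => Eset V L D i q))
  have c3 := Finset.card_union_le (X j₃) (Q.biUnion (fun q => Eset V L D i q))
  have c4 := Finset.card_biUnion_le_card_mul Q (fun q => Eset V L D i q) _ hmax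
  have cQ : Q.card = (L.card * L.card) * (L.card * L.card) := by
    rw [hQ, Finset.card_product, Finset.card_product]
  rw [cQ] at c4
  have c5 : (Aset V L i).card ≤ (X j₁).card + ((X j₂).card + ((X j₃).card +
      (L.card * L.card) * (L.card * L.card) * (Eset V L D i q).card)) := by omega
  have c6 : ((Aset V L i).card : ℝ) ≤ (X j₁).card + ((X j₂).card + ((X j₃).card +
      (((L.card * L.card) * (L.card * L.card) * (Eset V L D i q).card : ℕ) : ℝ))) := by
    exact_mod_cast c5
  have := hXc j₁
  have := hXc j₂
  have := hXc j₃
  have := hA i hi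
  linarith

end OrdLines


namespace OrdLines

lemma num_contra (K n E D B : ℝ) (hK : 2 ≤ K) (hn : K ^ 100 ≤ n) (hE : n / (4 * K ^ 5) ≤ E)
    (hD : n / (32 * K ^ 2) ≤ D) (hB : B * B ≤ 4 * n)
    (h : (E * (D * D)) ^ 2 ≤ 72 * B * n ^ 5) : False := by
  have hK0 : 0 < K := by linarith
  have hn0 : 0 < n := lt_of_lt_of_le (by positivity) hn
  have e2 : ∀ r : ℕ, (2 : ℝ) ^ r ≤ K ^ r := fun r => pow_le_pow_left₀ (by norm_num) hK r
  have hE' : n / K ^ 7 ≤ E := by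
    refine le_trans ?_ hE
    apply div_le_div_of_nonneg_left hn0.le (by positivity)
    have := e2 2
    calc 4 * K ^ 5 ≤ K ^ 2 * K ^ 5 := by gcongr; linarith
      _ = K ^ 7 := by ring
  have hD' : n / K ^ 7 ≤ D := by
    refine le_trans ?_ hD
    apply div_le_div_of_nonneg_left hn0.le (by positivity)
    have := e2 5
    calc 32 * K ^ 2 ≤ K ^ 5 * K ^ 2 := by gcongr; linarith
      _ = K ^ 7 := by ring
  have y0 : 0 ≤ n / K ^ 7 := by positivity
  have hE0 : 0 ≤ E := y0.trans hE'
  have hD0 : 0 ≤ D := y0.trans hD'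
  have h1 : (n / K ^ 7) * ((n / K ^ 7) * (n / K ^ 7)) ≤ E * (D * D) := by gcongr
  have h2 : ((n / K ^ 7) * ((n / K ^ 7) * (n / K ^ 7))) ^ 4 ≤ (E * (D * D)) ^ 4 := by gcongr
  have h3 : (E * (D * D)) ^ 4 ≤ (72 * B * n ^ 5) ^ 2 := by
    calc (E * (D * D)) ^ 4 = ((E * (D * D)) ^ 2) ^ 2 := by ring
      _ ≤ _ := by gcongr
  have h4 : (72 * B * n ^ 5) ^ 2 ≤ 20736 * n ^ 11 := by
    calc (72 * B * n ^ 5) ^ 2 = 5184 * n ^ 10 * (B * B) := by ring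
      _ ≤ 5184 * n ^ 10 * (4 * n) := by gcongr
      _ = _ := by ring
  have h5 : (20736 : ℝ) ≤ K ^ 15 := by have := e2 15; norm_num at this; linarith
  have h6 : n ^ 12 / K ^ 84 ≤ K ^ 15 * n ^ 11 := by
    calc n ^ 12 / K ^ 84 = ((n / K ^ 7) * ((n / K ^ 7) * (n / K ^ 7))) ^ 4 := by
          field_simp
      _ ≤ 20736 * n ^ 11 := h2.trans (h3.trans h4)
      _ ≤ _ := by gcongr
  rw [div_le_iff₀ (by positivity)] at h6
  have h7 : n ^ 11 * n ≤ n ^ 11 * K ^ 99 := by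
    calc n ^ 11 * n = n ^ 12 := by ring
      _ ≤ _ := h6
      _ = _ := by ring
  have h8 := le_of_mul_le_mul_left h7 (by positivity)
  have h9 : K ^ 99 * 2 ≤ K ^ 99 * K := by gcongr
  have h10 : K ^ 100 = K ^ 99 * K := by ring
  have : 0 < K ^ 99 := by positivity
  linarith

lemma three_sides {L : Finset (ℝ × ℝ)}
    (hP : ∀ i ∈ L, ∀ j₁ ∈ L, ∀ j₂ ∈ L, ∀ j₃ ∈ L,
      dt i j₁ j₂ = 0 ∨ dt i j₁ j₃ = 0 ∨ dt i j₂ j₃ = 0)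
    {i j k : ℝ × ℝ} (hi : i ∈ L) (hj : j ∈ L) (hk : k ∈ L) (hd : dt i j k ≠ 0) :
    ∀ l ∈ L, l = i ∨ l = j ∨ l = k := by
  intro l hl
  have hd1 : dt j i k ≠ 0 := by
    intro h; apply hd
    have : dt i j k = - dt j i k := by unfold dt; ring
    rw [this, h, neg_zero]
  have hd2 : dt k i j ≠ 0 := by
    intro h; apply hd; rw [← h]; unfold dt; ring
  have a1 := (hP i hi j hj k hk l hl).resolve_left hd
  have a2 := (hP j hj i hi k hk l hl).resolve_left hd1
  have a3 := (hP k hk i hi j hj l hl).resolve_left hd2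
  have s1 : ∀ x y z : ℝ × ℝ, dt x y z = 0 → dt y x z = 0 := by
    intro x y z h
    have : dt y x z = - dt x y z := by unfold dt; ring
    rw [this, h, neg_zero]
  rcases a1 with b1 | b1
  · rcases a3 with b3 | b3
    · exact Or.inl (dt_vertex b1 (s1 _ _ _ b3) hd)
    · exact Or.inr (Or.inl (dt_vertex (s1 _ _ _ b1) (s1 _ _ _ b3) hd1))
  · rcases a2 with b2 | b2
    · exact Or.inl (dt_vertex (s1 _ _ _ b2) b1 hd)
    · exact Or.inr (Or.inr (dt_vertex (s1 _ _ _ b1) (s1 _ _ _ b2) hd2))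

open Classical in
theorem affine_core (V L : Finset (ℝ × ℝ))
    (hcov : ∀ v ∈ V, ∃ l ∈ L, v.2 = l.1 * v.1 + l.2) (ε K : ℝ) (hε : 0 < ε)
    (hrich : ∀ l ∈ L, ε * V.card ≤ ((V.filter (fun v => v.2 = l.1 * v.1 + l.2)).card : ℝ))
    (hnc : ∃ i ∈ L, ∃ j ∈ L, ∃ k ∈ L, dt i j k ≠ 0)
    (hK : 2 ≤ K) (hKn : K ^ 100 ≤ (V.card : ℝ)) (hM : (L.card : ℝ) ≤ K) (hεK : 1 / ε ≤ K) :
    ε ^ 2 * (V.card : ℝ) ^ 2 / 1000 ≤ ((ordPairs V).card : ℝ) := by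
  by_contra hcon
  push Not at hcon
  obtain ⟨i₀, hi, j₀, hj, k₀, hk, hd⟩ := hnc
  set n : ℝ := (V.card : ℝ) with hn
  set M : ℝ := (L.card : ℝ) with hMdef
  have hK0 : 0 < K := by linarith
  have e2 : ∀ r : ℕ, (2 : ℝ) ^ r ≤ K ^ r := fun r => pow_le_pow_left₀ (by norm_num) hK r
  have hn0 : 0 < n := lt_of_lt_of_le (by positivity) hKn
  have hM1 : 1 ≤ M := by
    have : 0 < L.card := Finset.card_pos.mpr ⟨_, hi⟩
    rw [hMdef]; exact_mod_cast this
  have hεK1 : 1 ≤ ε * K := by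
    rw [div_le_iff₀ hε] at hεK
    linarith
  -- `ε n` is large
  have hnK : n ≤ (ε * n) * K := by nlinarith
  have hbig : K ^ 99 ≤ ε * n := by
    have : K ^ 99 * K ≤ (ε * n) * K := by
      calc K ^ 99 * K = K ^ 100 := by ring
        _ ≤ n := hKn
        _ ≤ _ := hnK
    exact le_of_mul_le_mul_right this hK0
  have hbig1 : 1024 * K ^ 2 ≤ ε * n := by
    have := e2 97
    have h10 : (1024 : ℝ) ≤ K ^ 97 := le_trans (by norm_num) this
    calc 1024 * K ^ 2 ≤ K ^ 97 * K ^ 2 := by gcongr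
      _ = K ^ 99 := by ring
      _ ≤ _ := hbig
  have hKK : K ≤ K ^ 2 := by nlinarith
  have hM2 : M * M ≤ K ^ 2 := by nlinarith
  set a0 : ℝ := ε * n / 2 with ha0
  have ha0p : 0 < a0 := by positivity
  have hA : ∀ l ∈ L, a0 ≤ ((Aset V L l).card : ℝ) := by
    intro l hl
    have h1 := hrich l hl
    have h2 : ((V.filter (fun v => v.2 = l.1 * v.1 + l.2)).card : ℝ) ≤
        ((Aset V L l).card : ℝ) + M := by
      have := Aset_card V L l
      rw [hMdef]
      exact_mod_cast this
    rw [ha0]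
    nlinarith
  have hO : 12 * ((ordPairs V).card : ℝ) ≤ a0 ^ 2 := by
    have : a0 ^ 2 = ε ^ 2 * n ^ 2 / 4 := by rw [ha0]; ring
    have : 0 < ε ^ 2 * n ^ 2 := by positivity
    linarith
  -- no three poles
  have hP : ∀ i ∈ L, ∀ j₁ ∈ L, ∀ j₂ ∈ L, ∀ j₃ ∈ L,
      dt i j₁ j₂ = 0 ∨ dt i j₁ j₃ = 0 ∨ dt i j₂ j₃ = 0 := by
    intro i hi' j₁ h1 j₂ h2 j₃ h3
    by_contra hc
    push Not at hc
    obtain ⟨d12, d13, d23⟩ := hc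
    set D : ℕ := ⌊ε * n / (16 * M)⌋₊ with hDdef
    set B : ℕ := Nat.sqrt V.card + 1 with hBdef
    have hMp : 0 < M := by linarith
    have hDle : (D : ℝ) ≤ ε * n / (16 * M) := Nat.floor_le (by positivity)
    have hDlt : ε * n / (16 * M) < (D : ℝ) + 1 := Nat.lt_floor_add_one _
    have hVpos : 1 ≤ V.card := by
      have : (0 : ℝ) < (V.card : ℝ) := hn0
      exact_mod_cast this
    have hB1 : V.card < B * B := Nat.lt_succ_sqrt V.card
    have hB2 : B * B ≤ 4 * V.card := by
      have h1 := Nat.sqrt_le V.card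
      have h2 : 1 ≤ Nat.sqrt V.card := Nat.le_sqrt.mpr (by omega)
      rw [hBdef]
      nlinarith
    have hDD : ((L.card * L.card + L.card * D : ℕ) : ℝ) < a0 / 2 := by
      push_cast
      rw [← hMdef]
      have : M * (D : ℝ) ≤ ε * n / 16 := by
        calc M * (D : ℝ) ≤ M * (ε * n / (16 * M)) := by gcongr
          _ = ε * n / 16 := by field_simp
      rw [ha0]
      nlinarith
    obtain ⟨E, hE1, hE2⟩ := three_poles V L hcov D B (Nat.succ_pos _) hB1 hB2 a0 ha0p hA hO hDD
      hi' h1 h2 h3 d12 d13 d23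
    refine num_contra K n (E : ℝ) (D : ℝ) (B : ℝ) hK hKn ?_ ?_ ?_ ?_
    · push_cast at hE1
      rw [← hMdef, ha0] at hE1
      rw [div_le_iff₀ (by positivity)]
      have hM4 : (M * M) * (M * M) ≤ K ^ 4 := by
        calc (M * M) * (M * M) ≤ K ^ 2 * K ^ 2 := by gcongr
          _ = K ^ 4 := by ring
      have hE0 : (0 : ℝ) ≤ (E : ℝ) := by positivity
      have h5 : ε * n / 2 / 2 ≤ K ^ 4 * E := hE1.trans (by gcongr)
      calc n ≤ (ε * n) * K := hnK
        _ ≤ (4 * (K ^ 4 * E)) * K := mul_le_mul_of_nonneg_right (by linarith) hK0.le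
        _ = E * (4 * K ^ 5) := by ring
    · have h5 : ε * n / (16 * K) ≤ ε * n / (16 * M) := by gcongr
      have h6 : 2 ≤ ε * n / (16 * K) := by
        rw [le_div_iff₀ (by positivity)]
        nlinarith
      have h7 : ε * n / (16 * K) / 2 ≤ D := by linarith
      refine le_trans ?_ h7
      rw [div_le_iff₀ (by positivity)]
      calc n ≤ (ε * n) * K := hnK
        _ = _ := by field_simp; ring
    · rw [hn]; exact_mod_cast hB2
    · have : ((E * (D * D)) ^ 2 : ℕ) ≤ ((72 * B * V.card ^ 5 : ℕ)) := hE2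
      have h5 : (((E * (D * D)) ^ 2 : ℕ) : ℝ) ≤ ((72 * B * V.card ^ 5 : ℕ) : ℝ) := by
        exact_mod_cast this
      push_cast at h5
      exact h5
  have hL := three_sides hP hi hj hk hd
  set s : ℕ := ⌊ε * n / 8⌋₊ with hs
  have hs1 : (s : ℝ) ≤ ε * n / 8 := Nat.floor_le (by positivity)
  have hs2 : ε * n / 8 < (s : ℝ) + 1 := Nat.lt_floor_add_one _
  have hK2 : 4 ≤ K ^ 2 := by have := e2 2; linarith
  have hs3 : ε * n / 16 ≤ (s : ℝ) := by linarith
  have h1 := triangle V L hcov hi hj hk hL hd s (by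
    intro l hl
    have h2 : (4 * (s : ℝ)) ≤ ((Aset V L l).card : ℝ) := by
      refine le_trans ?_ (hA l hl)
      rw [ha0]; linarith
    exact_mod_cast h2)
  have h2 : (s : ℝ) ^ 2 ≤ ((ordPairs V).card : ℝ) + n * (M * M) := by
    rw [hn, hMdef]; exact_mod_cast h1
  have h3 : (ε * n / 16) ^ 2 ≤ (s : ℝ) ^ 2 := by gcongr
  have h4 : n * (M * M) ≤ ε ^ 2 * n ^ 2 / 1000 := by
    have h5 : 1000 * K ^ 2 ≤ ε * (ε * n) := by
      have h6 : (1000 * K ^ 2) * K ≤ (ε * (ε * n)) * K := by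
        have h8 : (1000 : ℝ) ≤ K ^ 96 := le_trans (by norm_num) (e2 96)
        calc (1000 * K ^ 2) * K ≤ (K ^ 96 * K ^ 2) * K := by gcongr
          _ = K ^ 99 := by ring
          _ ≤ ε * n := hbig
          _ = 1 * (ε * n) := by ring
          _ ≤ (ε * K) * (ε * n) := by gcongr
          _ = _ := by ring
      exact le_of_mul_le_mul_right h6 hK0
    calc n * (M * M) ≤ n * K ^ 2 := by gcongr
      _ = (n / 1000) * (1000 * K ^ 2) := by ring
      _ ≤ (n / 1000) * (ε * (ε * n)) := by gcongr
      _ = _ := by ring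
  have h5 : (ε * n / 16) ^ 2 = ε ^ 2 * n ^ 2 / 256 := by ring
  have : 0 < ε ^ 2 * n ^ 2 := by positivity
  linarith

end OrdLines


namespace OrdLines

lemma exists_avoid {ι : Type*} [Finite ι] (p : ι → Submodule ℝ (Fin 3 → ℝ)) (hp : ∀ i, p i ≠ ⊤) :
    ∃ v, ∀ i, v ∉ p i := by
  by_contra hc
  push Not at hc
  have : ⋃ i, (p i : Set (Fin 3 → ℝ)) = Set.univ := by
    rw [Set.eq_univ_iff_forall]
    intro v
    obtain ⟨i, hi⟩ := hc v
    exact Set.mem_iUnion.mpr ⟨i, hi⟩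
  obtain ⟨i, hi⟩ := Subspace.exists_eq_top_of_iUnion_eq_univ this
  exact hp i hi

lemma span_pair_ne_top (a b : Fin 3 → ℝ) : Submodule.span ℝ {a, b} ≠ ⊤ := by
  classical
  intro h
  have h1 : Module.finrank ℝ (Submodule.span ℝ ({a, b} : Set (Fin 3 → ℝ))) = 3 := by
    rw [h, finrank_top]; simp
  have h2 := finrank_span_finset_le_card (R := ℝ) ({a, b} : Finset (Fin 3 → ℝ))
  rw [Finset.coe_pair] at h2
  have h3 := Finset.card_le_two (a := a) (b := b)
  unfold Set.finrank at h2
  omega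

/-- Generic coordinates: the lines are non-vertical and the points are finite. -/
lemma exists_coords {ι : Type*} [Finite ι] (W : ι → Submodule ℝ (Fin 3 → ℝ))
    (hW : ∀ i, Module.finrank ℝ (W i) = 2) (R : Finset (Fin 3 → ℝ)) (hR0 : ∀ v ∈ R, v ≠ 0)
    (hR : ∀ v ∈ R, ∃ i, v ∈ W i) (hRne : R.Nonempty) :
    ∃ B : (Fin 3 → ℝ) ≃ₗ[ℝ] (Fin 3 → ℝ), (∀ v ∈ R, B v 0 ≠ 0) ∧
      ∀ i, B.symm ![0, 0, 1] ∉ W i := by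
  obtain ⟨e, he⟩ := exists_avoid W (by
    intro i h
    have := hW i
    rw [h, finrank_top] at this
    simp at this)
  obtain ⟨u, hu⟩ := exists_avoid (fun v : R => Submodule.span ℝ {e, (v : Fin 3 → ℝ)})
    (fun v => span_pair_ne_top _ _)
  obtain ⟨w, hw⟩ := exists_avoid (fun _ : Unit => Submodule.span ℝ {u, e})
    (fun v => span_pair_ne_top _ _)
  have hw := hw ()
  have hu' : ∀ v ∈ R, u ∉ Submodule.span ℝ {e, v} := fun v hv => hu ⟨v, hv⟩
  have he0 : e ≠ 0 := by
    rintro rfl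
    obtain ⟨v, hv⟩ := hRne
    obtain ⟨i, -⟩ := hR v hv
    exact he i (W i).zero_mem
  have hue : ∀ c : ℝ, c • e ≠ u := by
    intro c h
    obtain ⟨v, hv⟩ := hRne
    apply hu' v hv
    rw [← h]
    exact Submodule.smul_mem _ _ (Submodule.subset_span (by simp))
  have hli : LinearIndependent ℝ ![w, u, e] := by
    refine linearIndependent_finCons.mpr ⟨?_, ?_⟩
    · rw [linearIndependent_fin2]
      exact ⟨he0, hue⟩
    · intro h
      apply hw
      have : Set.range ![u, e] = {u, e} := by
        simp [Matrix.range_cons, Set.pair_comm]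
      rwa [this] at h
  let b := basisOfLinearIndependentOfCardEqFinrank hli (by simp)
  have hb : ⇑b = ![w, u, e] := coe_basisOfLinearIndependentOfCardEqFinrank hli _
  refine ⟨b.equivFun, ?_, ?_⟩
  · intro v hv h0
    have hsum := b.sum_equivFun v
    rw [Fin.sum_univ_three, hb, h0] at hsum
    simp only [Matrix.cons_val_zero, Matrix.cons_val_one, Matrix.cons_val, zero_smul,
      zero_add] at hsum
    obtain ⟨i, hi⟩ := hR v hv
    set α := b.equivFun v 1
    set β := b.equivFun v 2
    by_cases hα : α = 0
    · rw [hα, zero_smul, zero_add] at hsum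
      have hβ : β ≠ 0 := by
        intro h
        rw [h, zero_smul] at hsum
        exact hR0 v hv hsum.symm
      apply he i
      rw [← hsum] at hi
      exact ((W i).smul_mem_iff hβ).mp hi
    · apply hu' v hv
      rw [Submodule.mem_span_pair]
      refine ⟨-β / α, 1 / α, ?_⟩
      rw [← hsum, smul_add, smul_smul, smul_smul]
      have h1 : 1 / α * α = 1 := by field_simp
      rw [h1, one_smul, add_comm u, ← add_assoc, ← add_smul]
      have h2 : -β / α + 1 / α * β = 0 := by field_simp; ring
      rw [h2, zero_smul, zero_add]
  · intro i h
    apply he i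
    have : b.equivFun.symm ![0, 0, 1] = e := by
      rw [Module.Basis.equivFun_symm_apply, Fin.sum_univ_three, hb]
      simp
    rwa [this] at h

lemma line_params (B : (Fin 3 → ℝ) ≃ₗ[ℝ] (Fin 3 → ℝ)) (W : Submodule ℝ (Fin 3 → ℝ))
    (hW : Module.finrank ℝ W = 2) (he : B.symm ![0, 0, 1] ∉ W) :
    ∃ l : ℝ × ℝ, ∀ v, v ∈ W ↔ B v 2 = l.1 * B v 1 + l.2 * B v 0 := by
  obtain ⟨f, hf, hle⟩ := Submodule.exists_le_ker_of_notMem he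
  have hf0 : f ≠ 0 := by rintro rfl; simp at hf
  have hker : W = LinearMap.ker f := by
    apply Submodule.eq_of_le_of_finrank_eq hle
    have := Module.Dual.finrank_ker_add_one_of_ne_zero (K := ℝ) (V₁ := Fin 3 → ℝ) (f := f) hf0
    simp at this
    omega
  set α := f (B.symm ![1, 0, 0])
  set β := f (B.symm ![0, 1, 0])
  set γ := f (B.symm ![0, 0, 1])
  have hfv : ∀ v, f v = α * B v 0 + β * B v 1 + γ * B v 2 := by
    intro v
    have h1 : B v = B v 0 • ![1, 0, 0] + B v 1 • ![0, 1, 0] + B v 2 • ![0, 0, 1] := by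
      ext i
      fin_cases i <;> simp
    have h2 : v = B v 0 • B.symm ![1, 0, 0] + B v 1 • B.symm ![0, 1, 0] +
        B v 2 • B.symm ![0, 0, 1] := by
      rw [← map_smul, ← map_smul, ← map_smul, ← map_add, ← map_add, ← h1, B.symm_apply_apply]
    conv_lhs => rw [h2]
    simp only [map_add, map_smul, smul_eq_mul]
    ring
  refine ⟨(-β / γ, -α / γ), fun v => ?_⟩
  rw [hker, LinearMap.mem_ker, hfv]
  constructor
  · intro h
    field_simp
    linarith
  · intro h
    simp only at h
    rw [h]
    field_simp
    ring

end OrdLines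


namespace OrdLines

/-- The subspace spanned by two points. -/
noncomputable def joinS (p q : RP2) : Submodule ℝ (Fin 3 → ℝ) := Submodule.span ℝ {p.rep, q.rep}

lemma finrank_joinS {p q : RP2} (h : p ≠ q) : Module.finrank ℝ (joinS p q) = 2 := by
  have h1 := (Projectivization.independent_pair_iff_ne p q).mpr h
  rw [Projectivization.independent_iff] at h1
  have h2 := finrank_span_eq_card h1
  have h3 : Set.range (Projectivization.rep ∘ ![p, q]) = {p.rep, q.rep} := by
    rw [Set.range_comp]
    simp [Matrix.range_cons, Set.image_insert_eq, Set.pair_comm]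
  rw [h3] at h2
  unfold joinS
  simpa using h2

lemma sub_le_iff (p : RP2) (W : Submodule ℝ (Fin 3 → ℝ)) : p.submodule ≤ W ↔ p.rep ∈ W := by
  rw [Projectivization.submodule_eq, Submodule.span_singleton_le_iff_mem]

/-- The line through two points. -/
noncomputable def joinL (p q : RP2) : Set RP2 := {x : RP2 | x.submodule ≤ joinS p q}

lemma left_mem_joinL (p q : RP2) : p ∈ joinL p q :=
  (sub_le_iff _ _).mpr (Submodule.subset_span (by simp))

lemma right_mem_joinL (p q : RP2) : q ∈ joinL p q :=
  (sub_le_iff _ _).mpr (Submodule.subset_span (by simp))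

lemma isProjLine_joinL {p q : RP2} (h : p ≠ q) : IsProjLine (joinL p q) :=
  ⟨_, finrank_joinS h, rfl⟩

lemma eq_joinL {L : Set RP2} (hL : IsProjLine L) {p q : RP2} (hp : p ∈ L) (hq : q ∈ L)
    (h : p ≠ q) : joinL p q = L := by
  obtain ⟨W, hW, rfl⟩ := hL
  have h1 : joinS p q ≤ W := by
    rw [joinS, Submodule.span_le]
    intro v hv
    rcases hv with rfl | hv
    · exact (sub_le_iff _ _).mp hp
    · rw [Set.mem_singleton_iff] at hv
      rw [hv]
      exact (sub_le_iff _ _).mp hq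
  have h2 : joinS p q = W := Submodule.eq_of_le_of_finrank_eq h1 (by rw [finrank_joinS h, hW])
  unfold joinL
  rw [h2]

lemma ordLines_finite {P : Set RP2} (hP : P.Finite) :
    {L : Set RP2 | IsProjLine L ∧ (P ∩ L).ncard = 2}.Finite := by
  refine ((hP.prod hP).image (fun z : RP2 × RP2 => joinL z.1 z.2)).subset ?_
  rintro L ⟨hL, hc⟩
  obtain ⟨p, q, hpq, he⟩ := Set.ncard_eq_two.mp hc
  have hp : p ∈ P ∩ L := by rw [he]; simp
  have hq : q ∈ P ∩ L := by rw [he]; simp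
  exact ⟨(p, q), ⟨hp.1, hq.1⟩, eq_joinL hL hp.2 hq.2 hpq⟩

/-- The affine chart. -/
noncomputable def chart (B : (Fin 3 → ℝ) ≃ₗ[ℝ] (Fin 3 → ℝ)) (p : RP2) : ℝ × ℝ :=
  (B p.rep 1 / B p.rep 0, B p.rep 2 / B p.rep 0)

lemma chart_inj (B : (Fin 3 → ℝ) ≃ₗ[ℝ] (Fin 3 → ℝ)) {p q : RP2} (hp : B p.rep 0 ≠ 0)
    (hq : B q.rep 0 ≠ 0) (h : chart B p = chart B q) : p = q := by
  have h1 : B p.rep 1 / B p.rep 0 = B q.rep 1 / B q.rep 0 := congrArg Prod.fst h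
  have h2 : B p.rep 2 / B p.rep 0 = B q.rep 2 / B q.rep 0 := congrArg Prod.snd h
  rw [div_eq_div_iff hp hq] at h1 h2
  rw [← p.mk_rep, ← q.mk_rep, Projectivization.mk_eq_mk_iff']
  refine ⟨B p.rep 0 / B q.rep 0, ?_⟩
  apply B.injective
  rw [map_smul]
  ext i
  rw [Pi.smul_apply, smul_eq_mul, div_mul_eq_mul_div, div_eq_iff hq]
  fin_cases i
  · simp
  · simp only [Fin.mk_one]; linarith
  · simp only [Fin.reduceFinMk]; linarith

lemma chart_collin (B : (Fin 3 → ℝ) ≃ₗ[ℝ] (Fin 3 → ℝ)) {p q r : RP2} (hp : B p.rep 0 ≠ 0)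
    (hq : B q.rep 0 ≠ 0) (hr : B r.rep 0 ≠ 0) (h : r ∈ joinL p q) :
    Collin (chart B p) (chart B q) (chart B r) := by
  have h1 := (sub_le_iff _ _).mp h
  rw [joinS, Submodule.mem_span_pair] at h1
  obtain ⟨α, β, h2⟩ := h1
  have h3 : ∀ i, B r.rep i = α * B p.rep i + β * B q.rep i := by
    intro i
    rw [← h2, map_add, map_smul, map_smul]
    rfl
  simp only [Collin, chart]
  generalize B p.rep = v at *
  generalize B q.rep = w at *
  have e0 := h3 0
  have e1 := h3 1
  have e2 := h3 2
  generalize B r.rep = x at *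
  have hr' := hr
  field_simp
  rw [e1, e2, e0]
  ring

open Classical in
lemma ordPairs_le {P : Set RP2} (hP : P.Finite) (B : (Fin 3 → ℝ) ≃ₗ[ℝ] (Fin 3 → ℝ))
    (hB : ∀ p ∈ P, B p.rep 0 ≠ 0) :
    (ordPairs (hP.toFinset.image (chart B))).card ≤ 2 * numOrdinaryLines P := by
  set V := hP.toFinset.image (chart B) with hV
  have ex : ∀ a ∈ V, ∃ p ∈ P, chart B p = a := by
    intro a ha
    rw [hV, Finset.mem_image] at ha
    obtain ⟨p, hp, h⟩ := ha
    exact ⟨p, hP.mem_toFinset.mp hp, h⟩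
  choose! g hg using ex
  set f : (ℝ × ℝ) × (ℝ × ℝ) → Set RP2 := fun z => joinL (g z.1) (g z.2) with hf
  have key : ∀ z ∈ ordPairs V, g z.1 ≠ g z.2 ∧ z.1 ∈ V ∧ z.2 ∈ V ∧
      P ∩ f z = {g z.1, g z.2} := by
    intro z hz
    rw [ordPairs, Finset.mem_filter, Finset.mem_product] at hz
    obtain ⟨⟨h1, h2⟩, h3, h4⟩ := hz
    refine ⟨?_, h1, h2, ?_⟩
    · intro h
      apply h3
      rw [← (hg _ h1).2, ← (hg _ h2).2, h]
    · ext r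
      constructor
      · rintro ⟨hr, hr'⟩
        have hc := chart_collin B (hB _ (hg _ h1).1) (hB _ (hg _ h2).1) (hB _ hr) hr'
        rw [(hg _ h1).2, (hg _ h2).2] at hc
        rcases h4 _ (Finset.mem_image_of_mem _ (hP.mem_toFinset.mpr hr)) hc with h | h
        · left
          exact chart_inj B (hB _ hr) (hB _ (hg _ h1).1) (by rw [h, (hg _ h1).2])
        · right
          exact chart_inj B (hB _ hr) (hB _ (hg _ h2).1) (by rw [h, (hg _ h2).2])
      · rintro (rfl | hr)
        · exact ⟨(hg _ h1).1, left_mem_joinL _ _⟩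
        · rw [Set.mem_singleton_iff] at hr
          rw [hr]
          exact ⟨(hg _ h2).1, right_mem_joinL _ _⟩
  have h1 := Finset.card_le_mul_card_image (f := f) (ordPairs V) 2 (by
    intro L hL
    rw [Finset.mem_image] at hL
    obtain ⟨z, hz, rfl⟩ := hL
    have hsub : (ordPairs V).filter (fun y => f y = f z) ⊆ {z, (z.2, z.1)} := by
      intro y hy
      rw [Finset.mem_filter] at hy
      obtain ⟨k1, k2, k3, k4⟩ := key z hz
      obtain ⟨m1, m2, m3, m4⟩ := key y hy.1
      rw [hy.2, k4] at m4
      have gi : ∀ a ∈ V, ∀ b ∈ V, g a = g b → a = b := by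
        intro a ha b hb h
        rw [← (hg _ ha).2, ← (hg _ hb).2, h]
      rcases (Set.pair_eq_pair_iff.mp m4) with ⟨u1, u2⟩ | ⟨u1, u2⟩
      · rw [Finset.mem_insert]; left
        exact Prod.ext (gi _ m2 _ k2 u1.symm) (gi _ m3 _ k3 u2.symm)
      · rw [Finset.mem_insert, Finset.mem_singleton]; right
        exact Prod.ext (gi _ m2 _ k3 u2.symm) (gi _ m3 _ k2 u1.symm)
    exact (Finset.card_le_card hsub).trans Finset.card_le_two)
  refine h1.trans (Nat.mul_le_mul_left 2 ?_)
  unfold numOrdinaryLines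
  rw [← Set.ncard_coe_finset]
  apply Set.ncard_le_ncard _ (ordLines_finite hP)
  intro L hL
  rw [Finset.mem_coe, Finset.mem_image] at hL
  obtain ⟨z, hz, rfl⟩ := hL
  obtain ⟨k1, k2, k3, k4⟩ := key z hz
  exact ⟨isProjLine_joinL k1, by rw [k4]; exact Set.ncard_pair k1⟩

lemma common_vec (L : Finset (ℝ × ℝ)) (h : ∀ i ∈ L, ∀ j ∈ L, ∀ k ∈ L, dt i j k = 0) :
    ∃ X Y Z : ℝ, ¬ (X = 0 ∧ Y = 0) ∧ ∀ l ∈ L, Z = l.1 * Y + l.2 * X := by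
  by_cases hL : ∃ i ∈ L, ∃ j ∈ L, i ≠ j
  · obtain ⟨i, hi, j, hj, hij⟩ := hL
    refine ⟨i.1 - j.1, j.2 - i.2, i.1 * (j.2 - i.2) + i.2 * (i.1 - j.1), ?_, ?_⟩
    · rintro ⟨h1, h2⟩
      exact hij (Prod.ext (by linarith) (by linarith))
    · intro l hl
      have := h i hi j hj l hl
      unfold dt at this
      linear_combination this
  · push Not at hL
    rcases L.eq_empty_or_nonempty with rfl | ⟨i, hi⟩
    · exact ⟨1, 0, 0, by norm_num, by simp⟩
    · refine ⟨1, 0, i.2, by norm_num, ?_⟩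
      intro l hl
      rw [hL l hl i hi]
      ring

end OrdLines

open OrdLines

/-- A set of `n` points on a union of `m ≥ 2` non-concurrent lines with at least
`ε n` points on each line spans `≫ ε¹² n² / m⁶` ordinary lines, provided
`m, 1/ε ≤ n^(1/10000)`. -/
theorem nonconcurrent_lines_ordinary :
    ∃ c : ℝ, 0 < c ∧
      ∀ (m : ℕ), 2 ≤ m → ∀ (ε : ℝ), 0 < ε →
        ∀ (n : ℕ) (P : Set RP2) (ℓ : Fin m → Set RP2),
          P.Finite → P.ncard = n →
          (∀ i, IsProjLine (ℓ i)) →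
          (¬ ∃ x : RP2, ∀ i, x ∈ ℓ i) →
          P ⊆ ⋃ i, ℓ i →
          (∀ i, ε * n ≤ ((P ∩ ℓ i).ncard : ℝ)) →
          (m : ℝ) ≤ (n : ℝ) ^ ((1 : ℝ) / 10000) →
          1 / ε ≤ (n : ℝ) ^ ((1 : ℝ) / 10000) →
          c * ε ^ 12 * (n : ℝ) ^ 2 / (m : ℝ) ^ 6 ≤ (numOrdinaryLines P : ℝ) := by
  classical
  refine ⟨1 / 2000, by norm_num, ?_⟩
  intro m hm ε hε n P ℓ hP hPn hline hnc hsub hrich hmK hεK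
  set K : ℝ := (n : ℝ) ^ ((1 : ℝ) / 10000) with hKdef
  have hm2 : (2 : ℝ) ≤ (m : ℝ) := by exact_mod_cast hm
  have hK2 : 2 ≤ K := hm2.trans hmK
  have hn0 : n ≠ 0 := by
    intro h
    rw [hKdef, h, Nat.cast_zero, Real.zero_rpow (by norm_num)] at hK2
    norm_num at hK2
  have hn1 : (1 : ℝ) ≤ (n : ℝ) := by exact_mod_cast Nat.one_le_iff_ne_zero.mpr hn0
  have hKn : K ^ 100 ≤ (n : ℝ) := by
    rw [hKdef, ← Real.rpow_natCast, ← Real.rpow_mul (by positivity)]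
    calc (n : ℝ) ^ ((1 : ℝ) / 10000 * ((100 : ℕ) : ℝ)) ≤ (n : ℝ) ^ (1 : ℝ) :=
          Real.rpow_le_rpow_of_exponent_le hn1 (by norm_num)
      _ = n := Real.rpow_one _
  choose W hW2 hWl using hline
  have hmem : ∀ i (x : RP2), x ∈ ℓ i ↔ x.rep ∈ W i := by
    intro i x
    rw [hWl i]
    exact sub_le_iff x (W i)
  have hPne : P.Nonempty := by
    rw [← Set.ncard_pos hP]
    omega
  obtain ⟨B, hB, hBe⟩ := exists_coords W hW2 (hP.toFinset.image Projectivization.rep)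
    (by
      intro v hv
      rw [Finset.mem_image] at hv
      obtain ⟨p, -, rfl⟩ := hv
      exact p.rep_nonzero)
    (by
      intro v hv
      rw [Finset.mem_image] at hv
      obtain ⟨p, hp, rfl⟩ := hv
      obtain ⟨i, hi⟩ := Set.mem_iUnion.mp (hsub (hP.mem_toFinset.mp hp))
      exact ⟨i, (hmem i p).mp hi⟩)
    (Finset.Nonempty.image ((Set.Finite.toFinset_nonempty hP).mpr hPne) _)
  have hBP : ∀ p ∈ P, B p.rep 0 ≠ 0 := fun p hp =>
    hB _ (Finset.mem_image_of_mem _ (hP.mem_toFinset.mpr hp))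
  choose l hl using fun i => line_params B (W i) (hW2 i) (hBe i)
  have hchart : ∀ p ∈ P, ∀ i, p ∈ ℓ i ↔ (chart B p).2 = (l i).1 * (chart B p).1 + (l i).2 := by
    intro p hp i
    have h0 := hBP p hp
    rw [hmem, hl]
    simp only [chart]
    constructor
    · intro h
      rw [h]
      field_simp
    · intro h
      field_simp at h
      linarith
  set V := hP.toFinset.image (chart B) with hV
  set L := Finset.univ.image l with hLdef
  have hinj : Set.InjOn (chart B) P := fun p hp q hq h => chart_inj B (hBP p hp) (hBP q hq) h
  have hVn : V.card = n := by
    rw [hV, Finset.card_image_of_injOn (by rw [hP.coe_toFinset]; exact hinj), ← hPn,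
      Set.ncard_eq_toFinset_card P hP]
  have hcov : ∀ v ∈ V, ∃ l ∈ L, v.2 = l.1 * v.1 + l.2 := by
    intro v hv
    rw [hV, Finset.mem_image] at hv
    obtain ⟨p, hp, rfl⟩ := hv
    rw [hP.mem_toFinset] at hp
    obtain ⟨i, hi⟩ := Set.mem_iUnion.mp (hsub hp)
    exact ⟨l i, Finset.mem_image_of_mem _ (Finset.mem_univ i), (hchart p hp i).mp hi⟩
  have hrichV : ∀ l ∈ L, ε * V.card ≤
      ((V.filter (fun v => v.2 = l.1 * v.1 + l.2)).card : ℝ) := by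
    intro l' hl'
    rw [hLdef, Finset.mem_image] at hl'
    obtain ⟨i, -, rfl⟩ := hl'
    rw [hVn]
    refine (hrich i).trans ?_
    have : (P ∩ ℓ i).ncard ≤ (V.filter (fun v => v.2 = (l i).1 * v.1 + (l i).2)).card := by
      rw [← Set.ncard_coe_finset]
      apply Set.ncard_le_ncard_of_injOn (chart B)
      · rintro p ⟨hp, hpl⟩
        rw [Finset.mem_coe, Finset.mem_filter]
        exact ⟨Finset.mem_image_of_mem _ (hP.mem_toFinset.mpr hp), (hchart p hp i).mp hpl⟩
      · exact hinj.mono Set.inter_subset_left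
    exact_mod_cast this
  have hncV : ∃ i ∈ L, ∃ j ∈ L, ∃ k ∈ L, dt i j k ≠ 0 := by
    by_contra hc
    push Not at hc
    obtain ⟨X, Y, Z, h0, hall⟩ := common_vec L hc
    have hv0 : B.symm ![X, Y, Z] ≠ 0 := by
      intro h
      have h1 : ![X, Y, Z] = 0 := by
        rw [← B.apply_symm_apply ![X, Y, Z], h, map_zero]
      exact h0 ⟨congrFun h1 0, congrFun h1 1⟩
    apply hnc
    refine ⟨Projectivization.mk ℝ _ hv0, ?_⟩
    intro i
    rw [hWl i]
    change (Projectivization.mk ℝ _ hv0).submodule ≤ W i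
    rw [Projectivization.submodule_mk, Submodule.span_singleton_le_iff_mem, hl,
      B.apply_symm_apply]
    exact hall (l i) (Finset.mem_image_of_mem _ (Finset.mem_univ i))
  have hLm : (L.card : ℝ) ≤ K := by
    have : L.card ≤ m := by
      refine Finset.card_image_le.trans ?_
      rw [Finset.card_univ, Fintype.card_fin]
    have h1 : (L.card : ℝ) ≤ (m : ℝ) := by exact_mod_cast this
    exact h1.trans hmK
  have main := affine_core V L hcov ε K hε hrichV hncV hK2 (by rw [hVn]; exact hKn) hLm hεK
  rw [hVn] at main
  have hord : ((ordPairs V).card : ℝ) ≤ 2 * (numOrdinaryLines P : ℝ) := by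
    exact_mod_cast ordPairs_le hP B hBP
  have hε1 : ε ≤ 1 := by
    have h1 := hrich ⟨0, by omega⟩
    have h2 : (P ∩ ℓ ⟨0, by omega⟩).ncard ≤ n := by
      rw [← hPn]
      exact Set.ncard_le_ncard Set.inter_subset_left hP
    have h3 : ((P ∩ ℓ ⟨0, by omega⟩).ncard : ℝ) ≤ n := by exact_mod_cast h2
    have h4 : ε * n ≤ 1 * n := by linarith
    exact le_of_mul_le_mul_right h4 (by linarith)
  have hfin : (1 / 2000 : ℝ) * ε ^ 12 * (n : ℝ) ^ 2 / (m : ℝ) ^ 6 ≤ ε ^ 2 * (n : ℝ) ^ 2 / 2000 := by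
    have h1 : ε ^ 12 ≤ ε ^ 2 := pow_le_pow_of_le_one hε.le hε1 (by norm_num)
    have h2 : (1 : ℝ) ≤ (m : ℝ) ^ 6 := one_le_pow₀ (by linarith)
    calc (1 / 2000 : ℝ) * ε ^ 12 * (n : ℝ) ^ 2 / (m : ℝ) ^ 6
        ≤ (1 / 2000 : ℝ) * ε ^ 12 * (n : ℝ) ^ 2 := div_le_self (by positivity) h2
      _ ≤ (1 / 2000 : ℝ) * ε ^ 2 * (n : ℝ) ^ 2 := by gcongr
      _ = _ := by ring
  linarith
end

section
/- There is an absolute constant ε > 0 such that the following holds. Let G be an abelian group, let n be a positive integer and K a nonnegative real with K ≤ εn, and let A, B, C be finite subsets of G whose cardinalities each differ from n by at most K. Suppose that the number of pairs (a,b) ∈ A × B with a + b ∉ C is at most Kn. Then there exist a finite subgroup H of G and elements x, y ∈ G such that |A △ (x+H)| ≤ 7K, |B △ (y+H)| ≤ 7K, and |C △ (x+y+H)| ≤ 7K, where △ denotes symmetric difference and x+H = {x+h : h ∈ H}. -/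
open Finset in
/-- Double counting along fibres. -/
lemma ag_dc {α β : Type*} [DecidableEq β] (P : Finset α) (f : α → β) (T : Finset β) (k : ℝ)
    (h : ∀ t ∈ T, k ≤ ((P.filter (fun p => f p = t)).card : ℝ)) :
    (T.card : ℝ) * k ≤ ((P.filter (fun p => f p ∈ T)).card : ℝ) := by
  have h1 := Finset.card_eq_sum_card_fiberwise (f := f) (s := P.filter (fun p => f p ∈ T)) (t := T)
    (by intro p hp; exact (Finset.mem_filter.1 hp).2)
  rw [h1]
  push_cast
  rw [← nsmul_eq_mul]
  apply Finset.card_nsmul_le_sum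
  intro t ht
  refine (h t ht).trans ?_
  norm_cast
  apply Finset.card_le_card
  intro p
  simp only [Finset.mem_filter]
  rintro ⟨h1, rfl⟩
  exact ⟨⟨h1, ht⟩, rfl⟩

section
open Finset
variable {G : Type*} [AddCommGroup G] [DecidableEq G]

/-- The number of elements of `A` that leave `A` when translated by `t`. -/
def agD (A : Finset G) (t : G) : ℕ := (A.filter (fun a => a + t ∉ A)).card

lemma agD_zero (A : Finset G) : agD A 0 = 0 := by
  simp [agD]

lemma agD_compl (A : Finset G) (t : G) :
    (A.filter (fun a => a + t ∈ A)).card + agD A t = A.card :=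
  Finset.card_filter_add_card_filter_not (s := A) (fun a => a + t ∈ A)

lemma agD_neg (A : Finset G) (t : G) : agD A (-t) = agD A t := by
  have h1 := agD_compl A t
  have h2 := agD_compl A (-t)
  have h3 : (A.filter (fun a => a + t ∈ A)).card = (A.filter (fun a => a + -t ∈ A)).card := by
    apply Finset.card_bij (fun a _ => a + t)
    · intro a ha
      simp only [Finset.mem_filter] at ha ⊢
      simpa using ha.symm
    · intro a _ b _ h
      exact add_right_cancel h
    · intro b hb
      simp only [Finset.mem_filter] at hb
      exact ⟨b + -t, by simpa using hb.symm, by simp⟩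
  omega

lemma agD_add (A : Finset G) (s t : G) : agD A (s + t) ≤ agD A s + agD A t := by
  have h : A.filter (fun a => a + (s + t) ∉ A) ⊆
      A.filter (fun a => a + s ∉ A) ∪ (A.filter (fun a => a + t ∉ A)).image (fun a => a - s) := by
    intro a ha
    simp only [Finset.mem_filter, Finset.mem_union, Finset.mem_image] at ha ⊢
    by_cases h : a + s ∈ A
    · right
      exact ⟨a + s, ⟨h, by simpa [add_assoc] using ha.2⟩, by simp⟩
    · left; exact ⟨ha.1, h⟩
  exact (Finset.card_le_card h).trans ((Finset.card_union_le _ _).trans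
    (Nat.add_le_add_left Finset.card_image_le _))

lemma agD_pairs (A T : Finset G) (r : ℝ) (hT : ∀ t ∈ T, (agD A t : ℝ) ≤ r) :
    (T.card : ℝ) * (A.card - r) ≤
      (((A ×ˢ A).filter (fun p => p.2 - p.1 ∈ T)).card : ℝ) := by
  apply ag_dc (A ×ˢ A) (fun p => p.2 - p.1)
  intro t ht
  have h1 := agD_compl A t
  have h2 : (A.filter (fun a => a + t ∈ A)).card ≤
      ((A ×ˢ A).filter (fun p : G × G => p.2 - p.1 = t)).card := by
    apply Finset.card_le_card_of_injOn (fun a => (a, a + t))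
    · intro a ha
      simpa using ha
    · intro a _ b _ h
      exact (Prod.ext_iff.1 h).1
  have h3 := hT t ht
  have h1' : ((A.filter (fun a => a + t ∈ A)).card : ℝ) + agD A t = A.card := by exact_mod_cast h1
  have h2' : ((A.filter (fun a => a + t ∈ A)).card : ℝ) ≤
      ((A ×ˢ A).filter (fun p : G × G => p.2 - p.1 = t)).card := by exact_mod_cast h2
  linarith

lemma agD_bound (A T : Finset G) (r : ℝ) (hT : ∀ t ∈ T, (agD A t : ℝ) ≤ r) :
    (T.card : ℝ) * (A.card - r) ≤ (A.card : ℝ) * A.card := by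
  refine (agD_pairs A T r hT).trans ?_
  have h := Finset.card_filter_le (A ×ˢ A) (fun p : G × G => p.2 - p.1 ∈ T)
  rw [Finset.card_product] at h
  exact_mod_cast h

/-- The pairs whose sum is not in `C`. -/
def agBad (A B C : Finset G) : Finset (G × G) := (A ×ˢ B).filter (fun p => p.1 + p.2 ∉ C)

open Classical in
/-- Crude structure. -/
lemma ag_crude (n : ℝ) (hn : 0 < n) (K : ℝ) (hKn : K ≤ (1 / 10000) * n)
    (A B C : Finset G) (hA : |(A.card : ℝ) - n| ≤ K) (hB : |(B.card : ℝ) - n| ≤ K)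
    (hC : |(C.card : ℝ) - n| ≤ K) (hbad : ((agBad A B C).card : ℝ) ≤ K * n) :
    ∃ (H : AddSubgroup G) (F : Finset G) (x y : G), (∀ g, g ∈ F ↔ g ∈ H) ∧
      (F.card : ℝ) ≤ 1.04 * n ∧
      ((A.filter (fun a => a - x ∈ H)).card : ℝ) ≥ 0.94 * n ∧
      ((B.filter (fun b => b - y ∈ H)).card : ℝ) ≥ 0.97 * n ∧
      ((C.filter (fun c => c - (x + y) ∈ H)).card : ℝ) ≥ 0.93 * n := by
  classical
  rw [abs_le] at hA hB hC
  set B' := B.filter (fun b => ((A.filter (fun a => a + b ∉ C)).card : ℝ) ≤ (1/100) * n) with hB'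
  have hB'card : (0.98 : ℝ) * n ≤ B'.card := by
    have h1 := Finset.card_filter_add_card_filter_not (s := B)
      (fun b => ((A.filter (fun a => a + b ∉ C)).card : ℝ) ≤ (1/100) * n)
    have h2 := ag_dc (agBad A B C) (fun p => p.2)
      (B.filter (fun b => ¬ ((A.filter (fun a => a + b ∉ C)).card : ℝ) ≤ (1/100) * n))
      ((1/100) * n) (by
        intro b hb
        rw [Finset.mem_filter, not_le] at hb
        refine hb.2.le.trans ?_
        norm_cast
        apply Finset.card_le_card_of_injOn (fun a => (a, b))
        · intro a ha
          simp only [Finset.coe_filter, Set.mem_ofPred_eq] at ha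
          simp [agBad, ha, hb.1]
        · intro a _ c _ h
          exact (Prod.ext_iff.1 h).1)
    have h3 : (((agBad A B C).filter (fun p => p.2 ∈ (B.filter (fun b =>
      ¬ ((A.filter (fun a => a + b ∉ C)).card : ℝ) ≤ (1/100) * n)))).card : ℝ) ≤
        (agBad A B C).card := by exact_mod_cast Finset.card_filter_le _ _
    have h1' : (B'.card : ℝ) + (B.filter (fun b =>
      ¬ ((A.filter (fun a => a + b ∉ C)).card : ℝ) ≤ (1/100) * n)).card = B.card := by
        exact_mod_cast h1
    set m : ℝ := ((B.filter (fun b =>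
      ¬ ((A.filter (fun a => a + b ∉ C)).card : ℝ) ≤ (1/100) * n)).card : ℝ)
    have h4 : (m * (1/100)) * n ≤ K * n := by linarith
    have h5 := le_of_mul_le_mul_right h4 hn
    linarith
  have hdiff : ∀ b ∈ B', ∀ c ∈ B', (agD A (b - c) : ℝ) ≤ (3/100) * n := by
    intro b hb c hc
    have hb2 := (Finset.mem_filter.1 hb).2
    have hc2 := (Finset.mem_filter.1 hc).2
    have hsub : (A.filter (fun a => a + (b - c) ∉ A)) ⊆ (A.filter (fun a => a + b ∉ C)) ∪
        (C \ (A.filter (fun a => a + c ∈ C)).image (fun a => a + c)).image (fun z => z - b) := by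
      intro a ha
      simp only [Finset.mem_filter, Finset.mem_union, Finset.mem_image, Finset.mem_sdiff] at ha ⊢
      by_cases h : a + b ∈ C
      · right
        refine ⟨a + b, ⟨h, ?_⟩, by simp⟩
        rintro ⟨e, ⟨he, -⟩, h2⟩
        apply ha.2
        have : a + (b - c) = e := by rw [← add_sub_assoc, ← h2]; simp
        rwa [this]
      · left; exact ⟨ha.1, h⟩
    have h1 := (Finset.card_le_card hsub).trans ((Finset.card_union_le _ _).trans
      (Nat.add_le_add_left Finset.card_image_le _))
    have h2 : (C \ (A.filter (fun a => a + c ∈ C)).image (fun a => a + c)).card +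
        (A.filter (fun a => a + c ∈ C)).card = C.card := by
      have := Finset.card_sdiff_add_card_eq_card
        (s := (A.filter (fun a => a + c ∈ C)).image (fun a => a + c)) (t := C) (by
          intro z hz
          simp only [Finset.mem_filter, Finset.mem_image] at hz
          obtain ⟨e, he, rfl⟩ := hz
          exact he.2)
      rwa [Finset.card_image_of_injective _ (add_left_injective c)] at this
    have h3 := Finset.card_filter_add_card_filter_not (s := A) (fun a => a + c ∈ C)
    have h1' : (agD A (b - c) : ℝ) ≤ (A.filter (fun a => a + b ∉ C)).card +
      (C \ (A.filter (fun a => a + c ∈ C)).image (fun a => a + c)).card := by exact_mod_cast h1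
    have h2' : ((C \ (A.filter (fun a => a + c ∈ C)).image (fun a => a + c)).card : ℝ) +
        (A.filter (fun a => a + c ∈ C)).card = C.card := by exact_mod_cast h2
    have h3' : ((A.filter (fun a => a + c ∈ C)).card : ℝ) +
        (A.filter (fun a => a + c ∉ C)).card = A.card := by exact_mod_cast h3
    linarith
  have hsize : ∀ T : Finset G, (∀ t ∈ T, (agD A t : ℝ) ≤ (9/100) * n) →
      (T.card : ℝ) ≤ 1.12 * n := by
    intro T hT
    have h := agD_bound A T _ hT
    have h0 : (0 : ℝ) ≤ T.card := Nat.cast_nonneg _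
    have h1 : (T.card : ℝ) * (0.9 * n) ≤ T.card * (A.card - (9/100) * n) :=
      mul_le_mul_of_nonneg_left (by linarith) h0
    have h2 : (A.card : ℝ) * A.card ≤ (1.0001 * n) * (1.0001 * n) :=
      mul_self_le_mul_self (Nat.cast_nonneg _) (by linarith)
    have h3 : (T.card * 0.9 : ℝ) * n ≤ (1.0001 * 1.0001 * n) * n := by linarith
    have h4 := le_of_mul_le_mul_right h3 hn
    linarith
  have hB'pos : (0 : ℝ) < B'.card := by linarith
  obtain ⟨y, hy⟩ : B'.Nonempty := by
    rw [← Finset.card_pos]; exact_mod_cast hB'pos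
  have hclose : ∀ t, (agD A t : ℝ) ≤ (6/100) * n → (agD A t : ℝ) ≤ (3/100) * n := by
    intro t ht
    have hnd : ¬ Disjoint (B'.image (fun b => b - y)) (B'.image (fun b => t + (b - y))) := by
      intro hd
      have h := hsize (B'.image (fun b => b - y) ∪ B'.image (fun b => t + (b - y))) (by
        intro u hu
        rw [Finset.mem_union, Finset.mem_image, Finset.mem_image] at hu
        rcases hu with ⟨b, hb, rfl⟩ | ⟨b, hb, rfl⟩
        · have := hdiff b hb y hy
          linarith
        · have h1 := hdiff b hb y hy
          have h2 : (agD A (t + (b - y)) : ℝ) ≤ agD A t + agD A (b - y) := by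
            exact_mod_cast agD_add A t (b - y)
          linarith)
      rw [Finset.card_union_of_disjoint hd,
        Finset.card_image_of_injective _ (sub_left_injective),
        Finset.card_image_of_injective _ (fun a b h => by simpa using h)] at h
      push_cast at h
      linarith
    rw [Finset.not_disjoint_iff] at hnd
    obtain ⟨u, h1, h2⟩ := hnd
    rw [Finset.mem_image] at h1 h2
    obtain ⟨b, hb, rfl⟩ := h1
    obtain ⟨c, hc, h⟩ := h2
    have : t = b - c := by
      have h' : t + (c - y) - (c - y) = b - y - (c - y) := by rw [h]
      simpa using h'
    rw [this]
    exact hdiff b hb c hc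
  let H : AddSubgroup G :=
    { carrier := {t | (agD A t : ℝ) ≤ (3/100) * n}
      zero_mem' := by
        simp only [Set.mem_ofPred_eq, agD_zero]
        push_cast; positivity
      add_mem' := by
        intro s t hs ht
        simp only [Set.mem_ofPred_eq] at hs ht ⊢
        apply hclose
        have h2 : (agD A (s + t) : ℝ) ≤ agD A s + agD A t := by
          exact_mod_cast agD_add A s t
        linarith
      neg_mem' := by
        intro t ht
        simp only [Set.mem_ofPred_eq] at ht ⊢
        rwa [agD_neg] }
  have hH : ∀ t, t ∈ H ↔ (agD A t : ℝ) ≤ (3/100) * n := fun t => Iff.rfl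
  let F : Finset G := ((A ×ˢ A).image (fun p => p.2 - p.1)).filter (fun t => t ∈ H)
  have hF : ∀ g, g ∈ F ↔ g ∈ H := by
    intro g
    simp only [F, Finset.mem_filter, and_iff_right_iff_imp]
    intro hg
    rw [hH] at hg
    have h1 := agD_compl A g
    have h1' : ((A.filter (fun a => a + g ∈ A)).card : ℝ) + agD A g = A.card := by exact_mod_cast h1
    have : (0 : ℝ) < ((A.filter (fun a => a + g ∈ A)).card : ℝ) := by linarith
    have : 0 < (A.filter (fun a => a + g ∈ A)).card := by exact_mod_cast this
    obtain ⟨a, ha⟩ := Finset.card_pos.1 this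
    rw [Finset.mem_filter] at ha
    rw [Finset.mem_image]
    exact ⟨(a, a + g), Finset.mk_mem_product ha.1 ha.2, by simp⟩
  have hFb : ∀ t ∈ F, (agD A t : ℝ) ≤ (3/100) * n := fun t ht => (hH t).1 ((hF t).1 ht)
  have hFle : (F.card : ℝ) ≤ 1.04 * n := by
    have h := agD_bound A F _ hFb
    have h0 : (0 : ℝ) ≤ F.card := Nat.cast_nonneg _
    have h1 : (F.card : ℝ) * (0.9699 * n) ≤ F.card * (A.card - (3/100) * n) :=
      mul_le_mul_of_nonneg_left (by linarith) h0
    have h2 : (A.card : ℝ) * A.card ≤ (1.0001 * n) * (1.0001 * n) :=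
      mul_self_le_mul_self (Nat.cast_nonneg _) (by linarith)
    have h3 : (F.card * 0.9699 : ℝ) * n ≤ (1.0001 * 1.0001 * n) * n := by linarith
    have h4 := le_of_mul_le_mul_right h3 hn
    linarith
  have hBH : ∀ b ∈ B', b - y ∈ H := fun b hb => hdiff b hb y hy
  have hFge : (0.98 : ℝ) * n ≤ F.card := by
    refine hB'card.trans ?_
    norm_cast
    apply Finset.card_le_card_of_injOn (fun b => b - y)
    · intro b hb
      exact (hF _).2 (hBH b hb)
    · intro a _ b _ h
      exact sub_left_injective h
  have hx : ∃ x ∈ A, ((A.filter (fun a => a - x ∈ H)).card : ℝ) ≥ 0.94 * n := by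
    by_contra! hcon
    have h1 := agD_pairs A F _ hFb
    have h2 := Finset.card_eq_sum_card_fiberwise (f := fun p : G × G => p.1)
      (s := (A ×ˢ A).filter (fun p => p.2 - p.1 ∈ F)) (t := A) (by
        intro p hp
        simp only [Finset.coe_filter, Set.mem_ofPred_eq, Finset.mem_product] at hp
        exact hp.1.1)
    rw [h2] at h1
    push_cast at h1
    have h3 := Finset.sum_le_card_nsmul A (fun x => ((((A ×ˢ A).filter
      (fun p => p.2 - p.1 ∈ F)).filter (fun p => p.1 = x)).card : ℝ)) (0.94 * n) (by
        intro x hx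
        refine le_trans ?_ (hcon x hx).le
        norm_cast
        apply Finset.card_le_card_of_injOn (fun p => p.2)
        · intro p hp
          simp only [Finset.coe_filter, Set.mem_ofPred_eq, Finset.mem_product, Finset.mem_filter, hF]
            at hp ⊢
          obtain ⟨⟨⟨h1, h2⟩, h3⟩, rfl⟩ := hp
          exact ⟨h2, h3⟩
        · intro p hp q hq h
          simp only [Finset.coe_filter, Set.mem_ofPred_eq] at hp hq
          exact Prod.ext (hp.2.trans hq.2.symm) h)
    rw [nsmul_eq_mul] at h3
    have h4 : (0.98 * n) * (0.9699 * n) ≤ (F.card : ℝ) * (A.card - (3/100) * n) :=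
      mul_le_mul hFge (by linarith) (by positivity) (by positivity)
    have h5 : (A.card : ℝ) * (0.94 * n) ≤ (1.0001 * n) * (0.94 * n) :=
      mul_le_mul_of_nonneg_right (by linarith) (by positivity)
    have h6 : 0 < n * n := by positivity
    nlinarith
  obtain ⟨x, hxA, hx⟩ := hx
  refine ⟨H, F, x, y, hF, hFle, hx, ?_, ?_⟩
  · have : (B'.card : ℝ) ≤ (B.filter (fun b => b - y ∈ H)).card := by
      norm_cast
      apply Finset.card_le_card
      intro b hb
      rw [Finset.mem_filter]
      exact ⟨(Finset.mem_filter.1 hb).1, hBH b hb⟩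
    linarith
  · have hy2 := (Finset.mem_filter.1 hy).2
    have : (A.filter (fun a => a - x ∈ H)).card ≤ (A.filter (fun a => a + y ∉ C)).card +
        (C.filter (fun c => c - (x + y) ∈ H)).card := by
      have hs : A.filter (fun a => a - x ∈ H) ⊆ A.filter (fun a => a + y ∉ C) ∪
          (C.filter (fun c => c - (x + y) ∈ H)).image (fun c => c - y) := by
        intro a ha
        simp only [Finset.mem_filter, Finset.mem_union, Finset.mem_image] at ha ⊢
        by_cases h : a + y ∈ C
        · right
          exact ⟨a + y, ⟨h, by simpa using ha.2⟩, by simp⟩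
        · left; exact ⟨ha.1, h⟩
      exact (Finset.card_le_card hs).trans ((Finset.card_union_le _ _).trans
        (Nat.add_le_add_left Finset.card_image_le _))
    have : ((A.filter (fun a => a - x ∈ H)).card : ℝ) ≤ (A.filter (fun a => a + y ∉ C)).card +
        (C.filter (fun c => c - (x + y) ∈ H)).card := by exact_mod_cast this
    linarith

/-- The bootstrapped inequality. -/
lemma ag_boot (n : ℝ) (hn : 0 < n) (K : ℝ) (hKn : K ≤ (1 / 10000) * n)
    (A B C : Finset G) (hC : (C.card : ℝ) ≤ n + K)
    (hbad : ((agBad A B C).card : ℝ) ≤ K * n)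
    (H : AddSubgroup G) [DecidablePred (· ∈ H)] (F : Finset G) (x y : G)
    (hF : ∀ g, g ∈ F ↔ g ∈ H)
    (hFle : (F.card : ℝ) ≤ 1.04 * n)
    (hA0 : ((A.filter (fun a => a - x ∈ H)).card : ℝ) ≥ 0.94 * n)
    (hB0 : ((B.filter (fun b => b - y ∈ H)).card : ℝ) ≥ 0.97 * n)
    (hC0 : ((C.filter (fun c => c - (x + y) ∈ H)).card : ℝ) ≥ 0.93 * n) :
    (((A.filter (fun a => a - x ∉ H)).card : ℝ) + (B.filter (fun b => b - y ∉ H)).card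
      + (F.filter (fun h => x + y + h ∉ C)).card) * 0.8 ≤ K := by
  set A0 := A.filter (fun a => a - x ∈ H) with hA0d
  set B0 := B.filter (fun b => b - y ∈ H) with hB0d
  set A1 := A.filter (fun a => a - x ∉ H) with hA1d
  set B1 := B.filter (fun b => b - y ∉ H) with hB1d
  set C1 := C.filter (fun c => c - (x + y) ∉ H) with hC1d
  set E := F.filter (fun h => x + y + h ∉ C) with hEd
  have hC1 : (C1.card : ℝ) ≤ 0.08 * n := by
    have := Finset.card_filter_add_card_filter_not (s := C) (fun c => c - (x + y) ∈ H)
    have : ((C.filter (fun c => c - (x + y) ∈ H)).card : ℝ) + C1.card = C.card := by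
      exact_mod_cast this
    linarith
  have key : ∀ a b : G, a - x + (b - y) = a + b - (x + y) := by intro a b; abel
  have k1 : (A1.card : ℝ) * (0.8 * n) ≤ ((agBad A1 B0 C).card : ℝ) := by
    refine (ag_dc (agBad A1 B0 C) (fun p => p.1) A1 (0.8 * n) ?_).trans
      (by exact_mod_cast Finset.card_filter_le _ _)
    intro a ha
    have ha2 := (Finset.mem_filter.1 ha).2
    have h1 := Finset.card_filter_add_card_filter_not (s := B0) (fun b => a + b ∈ C)
    have h2 : (B0.filter (fun b => a + b ∈ C)).card ≤ C1.card := by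
      apply Finset.card_le_card_of_injOn (fun b => a + b)
      · intro b hb
        simp only [hB0d, hC1d, Finset.coe_filter, Set.mem_ofPred_eq, Finset.mem_filter] at hb ⊢
        refine ⟨hb.2, fun h => ha2 ?_⟩
        rw [← key] at h
        exact (H.add_mem_cancel_right hb.1.2).1 h
      · intro b _ c _ h
        exact add_left_cancel h
    have h3 : (B0.filter (fun b => a + b ∉ C)).card ≤
        ((agBad A1 B0 C).filter (fun p => p.1 = a)).card := by
      apply Finset.card_le_card_of_injOn (fun b => (a, b))
      · intro b hb
        simp only [Finset.coe_filter, Set.mem_ofPred_eq] at hb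
        simp only [agBad, Finset.coe_filter, Set.mem_ofPred_eq, Finset.mem_filter,
          Finset.mem_product]
        exact ⟨⟨⟨ha, hb.1⟩, hb.2⟩, trivial⟩
      · intro b _ c _ h
        exact (Prod.ext_iff.1 h).2
    have h4 : (B0.card : ℝ) ≤ C1.card + ((agBad A1 B0 C).filter (fun p => p.1 = a)).card := by
      norm_cast; omega
    linarith
  have k2 : (B1.card : ℝ) * (0.8 * n) ≤ ((agBad A0 B1 C).card : ℝ) := by
    refine (ag_dc (agBad A0 B1 C) (fun p => p.2) B1 (0.8 * n) ?_).trans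
      (by exact_mod_cast Finset.card_filter_le _ _)
    intro b hb
    have hb2 := (Finset.mem_filter.1 hb).2
    have h1 := Finset.card_filter_add_card_filter_not (s := A0) (fun a => a + b ∈ C)
    have h2 : (A0.filter (fun a => a + b ∈ C)).card ≤ C1.card := by
      apply Finset.card_le_card_of_injOn (fun a => a + b)
      · intro a ha
        simp only [hA0d, hC1d, Finset.coe_filter, Set.mem_ofPred_eq, Finset.mem_filter] at ha ⊢
        refine ⟨ha.2, fun h => hb2 ?_⟩
        rw [← key] at h
        exact (H.add_mem_cancel_left ha.1.2).1 h
      · intro a _ c _ h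
        exact add_right_cancel h
    have h3 : (A0.filter (fun a => a + b ∉ C)).card ≤
        ((agBad A0 B1 C).filter (fun p => p.2 = b)).card := by
      apply Finset.card_le_card_of_injOn (fun a => (a, b))
      · intro a ha
        simp only [Finset.coe_filter, Set.mem_ofPred_eq] at ha
        simp only [agBad, Finset.coe_filter, Set.mem_ofPred_eq, Finset.mem_filter,
          Finset.mem_product]
        exact ⟨⟨⟨ha.1, hb⟩, ha.2⟩, trivial⟩
      · intro a _ c _ h
        exact (Prod.ext_iff.1 h).1
    have h4 : (A0.card : ℝ) ≤ C1.card + ((agBad A0 B1 C).filter (fun p => p.2 = b)).card := by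
      norm_cast; omega
    linarith
  have k3 : (E.card : ℝ) * (0.8 * n) ≤ ((agBad A0 B0 C).card : ℝ) := by
    refine (ag_dc (agBad A0 B0 C) (fun p => p.1 + p.2 - (x + y)) E (0.8 * n) ?_).trans
      (by exact_mod_cast Finset.card_filter_le _ _)
    intro h hh
    rw [hEd, Finset.mem_filter, hF] at hh
    have hu : (A0.image (fun a => a - x) ∪ B0.image (fun b => h - (b - y))).card ≤ F.card := by
      apply Finset.card_le_card
      intro g hg
      rw [Finset.mem_union, Finset.mem_image, Finset.mem_image] at hg
      rw [hF]
      rcases hg with ⟨a, ha, rfl⟩ | ⟨b, hb, rfl⟩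
      · exact (Finset.mem_filter.1 ha).2
      · exact H.sub_mem hh.1 (Finset.mem_filter.1 hb).2
    have hi := Finset.card_union_add_card_inter (A0.image (fun a => a - x))
      (B0.image (fun b => h - (b - y)))
    rw [Finset.card_image_of_injective _ sub_left_injective,
      Finset.card_image_of_injective _ (fun a b h => by simpa using h)] at hi
    have h3 : (A0.image (fun a => a - x) ∩ B0.image (fun b => h - (b - y))).card ≤
        ((agBad A0 B0 C).filter (fun p => p.1 + p.2 - (x + y) = h)).card := by
      apply Finset.card_le_card_of_injOn (fun g => (g + x, h - g + y))
      · intro g hg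
        simp only [Finset.coe_inter, Finset.coe_image, Set.mem_inter_iff, Set.mem_image,
          Finset.mem_coe] at hg
        obtain ⟨⟨a, ha, rfl⟩, ⟨b, hb, hba⟩⟩ := hg
        have e1 : a - x + x = a := by simp
        have e2 : h - (a - x) + y = b := by rw [← hba]; abel
        have e3 : a + b = x + y + h := by rw [← e2]; abel
        simp only [agBad, Finset.coe_filter, Set.mem_ofPred_eq, Finset.mem_filter,
          Finset.mem_product, e1, e2]
        refine ⟨⟨⟨ha, hb⟩, ?_⟩, ?_⟩
        · rw [e3]; exact hh.2
        · rw [e3]; abel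
      · intro g _ k _ h
        exact add_right_cancel (Prod.ext_iff.1 h).1
    have h4 : (A0.card : ℝ) + B0.card ≤ F.card +
        ((agBad A0 B0 C).filter (fun p => p.1 + p.2 - (x + y) = h)).card := by
      norm_cast; omega
    linarith
  have hd1 : Disjoint (agBad A1 B0 C) (agBad A0 B1 C) := by
    rw [Finset.disjoint_left]
    intro p hp hq
    simp only [agBad, hA1d, hB0d, hA0d, hB1d, Finset.mem_filter, Finset.mem_product] at hp hq
    exact hp.1.1.2 hq.1.1.2
  have hd2 : Disjoint (agBad A1 B0 C ∪ agBad A0 B1 C) (agBad A0 B0 C) := by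
    rw [Finset.disjoint_left]
    intro p hp hq
    simp only [agBad, hA1d, hB0d, hA0d, hB1d, Finset.mem_filter, Finset.mem_product,
      Finset.mem_union] at hp hq
    rcases hp with hp | hp
    · exact hp.1.1.2 hq.1.1.2
    · exact hp.1.2.2 hq.1.2.2
  have htot : (agBad A1 B0 C ∪ agBad A0 B1 C ∪ agBad A0 B0 C).card ≤ (agBad A B C).card := by
    apply Finset.card_le_card
    intro p hp
    simp only [agBad, hA1d, hB0d, hA0d, hB1d, Finset.mem_filter, Finset.mem_product,
      Finset.mem_union] at hp ⊢
    tauto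
  rw [Finset.card_union_of_disjoint hd2, Finset.card_union_of_disjoint hd1] at htot
  have htot' : ((agBad A1 B0 C).card : ℝ) + (agBad A0 B1 C).card + (agBad A0 B0 C).card ≤
    (agBad A B C).card := by exact_mod_cast htot
  refine le_of_mul_le_mul_right ?_ hn
  linarith

/-- Size of a symmetric difference with a coset. -/
lemma ag_symm (A F : Finset G) (H : AddSubgroup G) [DecidablePred (· ∈ H)]
    (hF : ∀ g, g ∈ F ↔ g ∈ H) (x : G) :
    (symmDiff (A : Set G) ((x + ·) '' (H : Set G))).ncard =
        (A.filter (fun a => a - x ∉ H)).card + (F.filter (fun h => x + h ∉ A)).card ∧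
      A.card + (F.filter (fun h => x + h ∉ A)).card =
        F.card + (A.filter (fun a => a - x ∉ H)).card := by
  have himg : ((x + ·) '' (H : Set G)) = ((F.image (x + ·) : Finset G) : Set G) := by
    ext g
    simp [hF]
  have e1 : A \ F.image (x + ·) = A.filter (fun a => a - x ∉ H) := by
    ext a
    simp only [Finset.mem_sdiff, Finset.mem_image, Finset.mem_filter, hF]
    refine and_congr_right fun _ => not_congr ?_
    constructor
    · rintro ⟨h, hh, rfl⟩
      simpa using hh
    · intro h
      exact ⟨_, h, by simp⟩
  have e2 : F.image (x + ·) \ A = (F.filter (fun h => x + h ∉ A)).image (x + ·) := by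
    ext a
    simp only [Finset.mem_sdiff, Finset.mem_image, Finset.mem_filter]
    constructor
    · rintro ⟨⟨h, hh, rfl⟩, h2⟩
      exact ⟨h, ⟨hh, h2⟩, rfl⟩
    · rintro ⟨h, ⟨hh, h2⟩, rfl⟩
      exact ⟨⟨h, hh, rfl⟩, h2⟩
  have c2 : (F.image (x + ·) \ A).card = (F.filter (fun h => x + h ∉ A)).card := by
    rw [e2, Finset.card_image_of_injective _ (add_right_injective x)]
  have c3 : (F.image (x + ·)).card = F.card :=
    Finset.card_image_of_injective _ (add_right_injective x)
  constructor
  · rw [himg, ← Finset.coe_symmDiff, Set.ncard_coe_finset, symmDiff_def, Finset.sup_eq_union,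
      Finset.card_union_of_disjoint disjoint_sdiff_sdiff, c2, e1]
  · have h1 := Finset.card_sdiff_add_card_inter A (F.image (x + ·))
    have h2 := Finset.card_sdiff_add_card_inter (F.image (x + ·)) A
    rw [Finset.inter_comm] at h2
    rw [e1] at h1
    omega

end

/-- The "almost-group" proposition: if `A`, `B`, `C` are finite subsets of an
abelian group, all of cardinality within `K ≤ ε n` of `n`, and at most `K n` pairs
`(a, b) ∈ A × B` have `a + b ∉ C`, then `A`, `B`, `C` are within `7K` of cosets
`x + H`, `y + H`, `x + y + H` of a finite subgroup `H`. -/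
theorem almost_group :
    ∃ ε : ℝ, 0 < ε ∧
      ∀ (G : Type*) [AddCommGroup G], ∀ (n : ℕ) (K : ℝ),
        0 < n → 0 ≤ K → K ≤ ε * n →
        ∀ A B C : Set G, A.Finite → B.Finite → C.Finite →
          |(A.ncard : ℝ) - n| ≤ K →
          |(B.ncard : ℝ) - n| ≤ K →
          |(C.ncard : ℝ) - n| ≤ K →
          ({p : G × G | p.1 ∈ A ∧ p.2 ∈ B ∧ p.1 + p.2 ∉ C}.ncard : ℝ) ≤ K * n →
          ∃ (H : AddSubgroup G) (x y : G), (H : Set G).Finite ∧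
            ((symmDiff A ((x + ·) '' (H : Set G))).ncard : ℝ) ≤ 7 * K ∧
            ((symmDiff B ((y + ·) '' (H : Set G))).ncard : ℝ) ≤ 7 * K ∧
            ((symmDiff C ((x + y + ·) '' (H : Set G))).ncard : ℝ) ≤ 7 * K := by
  classical
  refine ⟨1 / 10000, by norm_num, ?_⟩
  intro G _ n K hn hK hKn A B C hA hB hC cA cB cC hbad
  lift A to Finset G using hA
  lift B to Finset G using hB
  lift C to Finset G using hC
  rw [Set.ncard_coe_finset] at cA cB cC
  have hn' : (0 : ℝ) < n := by exact_mod_cast hn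
  have hset : {p : G × G | p.1 ∈ (A : Set G) ∧ p.2 ∈ (B : Set G) ∧ p.1 + p.2 ∉ (C : Set G)} =
      (agBad A B C : Set (G × G)) := by
    ext p
    simp [agBad, and_assoc]
  rw [hset, Set.ncard_coe_finset] at hbad
  obtain ⟨H, F, x, y, hF, hFle, hA0, hB0, hC0⟩ :=
    ag_crude (n : ℝ) hn' K hKn A B C cA cB cC hbad
  rw [abs_le] at cA cB cC
  have hb := ag_boot (n : ℝ) hn' K hKn A B C (by linarith) hbad H F x y hF hFle
    (by convert hA0) (by convert hB0) (by convert hC0)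
  obtain ⟨sA, tA⟩ := ag_symm A F H hF x
  obtain ⟨sB, tB⟩ := ag_symm B F H hF y
  obtain ⟨sC, tC⟩ := ag_symm C F H hF (x + y)
  have tA' := congrArg (Nat.cast : ℕ → ℝ) tA
  have tB' := congrArg (Nat.cast : ℕ → ℝ) tB
  have tC' := congrArg (Nat.cast : ℕ → ℝ) tC
  push_cast at tA' tB' tC'
  have p1 : (0 : ℝ) ≤ ((A.filter (fun a => a - x ∉ H)).card : ℝ) := Nat.cast_nonneg _
  have p2 : (0 : ℝ) ≤ ((B.filter (fun a => a - y ∉ H)).card : ℝ) := Nat.cast_nonneg _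
  have p3 : (0 : ℝ) ≤ ((F.filter (fun h => x + y + h ∉ C)).card : ℝ) := Nat.cast_nonneg _
  have p4 : (0 : ℝ) ≤ ((F.filter (fun h => x + h ∉ A)).card : ℝ) := Nat.cast_nonneg _
  refine ⟨H, x, y, ?_, ?_, ?_, ?_⟩
  · refine F.finite_toSet.subset ?_
    intro g hg
    exact (hF g).2 hg
  · rw [sA]; push_cast; linarith
  · rw [sB]; push_cast; linarith
  · rw [sC]; push_cast; linarith
end
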